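/- arXiv:1101.5367 — 2 statements merged into one kernel-verified Lean document; each statement's English description precedes it below -/
import Mathlib

section
/- There exists a function f : ℕ → ℕ such that the following holds. Let FH be a Frobenius group of order 12 with kernel F (elementary abelian of order 4) and complement H (of order 3), acting by automorphisms on a finite group G with gcd(|G|, 12) = 1, in such a manner that C_G(F) = 1 and C_G(H) has exponent dividing e. Then the exponent of G is at most f(e). -/
namespace FrobTwelve

/-- Three additive subgroups of a Lie ring behaving as the nonzero components of a grading by the
Klein four-group. -/
structure Tri {L : Type*} [LieRing L] (A B C : AddSubgroup L) : Prop where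
  aa : ∀ x ∈ A, ∀ y ∈ A, ⁅x, y⁆ = 0
  bb : ∀ x ∈ B, ∀ y ∈ B, ⁅x, y⁆ = 0
  cc : ∀ x ∈ C, ∀ y ∈ C, ⁅x, y⁆ = 0
  ab : ∀ x ∈ A, ∀ y ∈ B, ⁅x, y⁆ ∈ C
  bc : ∀ x ∈ B, ∀ y ∈ C, ⁅x, y⁆ ∈ A
  ca : ∀ x ∈ C, ∀ y ∈ A, ⁅x, y⁆ ∈ B

namespace Tri

variable {L : Type*} [LieRing L] {A B C : AddSubgroup L}

theorem rot (h : Tri A B C) : Tri B C A := ⟨h.bb, h.cc, h.aa, h.bc, h.ca, h.ab⟩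

theorem ba (h : Tri A B C) : ∀ x ∈ B, ∀ y ∈ A, ⁅x, y⁆ ∈ C := fun x hx y hy => by
  rw [← lie_skew]; exact C.neg_mem (h.ab y hy x hx)

theorem cb (h : Tri A B C) : ∀ x ∈ C, ∀ y ∈ B, ⁅x, y⁆ ∈ A := h.rot.ba
theorem ac (h : Tri A B C) : ∀ x ∈ A, ∀ y ∈ C, ⁅x, y⁆ ∈ B := h.rot.rot.ba

theorem swap (h : Tri A B C) : Tri A C B := ⟨h.aa, h.cc, h.bb, h.ac, h.cb, h.ba⟩

/-- ads of the same type commute -/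
theorem comm (h : Tri A B C) {x x' : L} (hx : x ∈ A) (hx' : x' ∈ A) (w : L) :
    ⁅x, ⁅x', w⁆⁆ = ⁅x', ⁅x, w⁆⁆ := by
  rw [leibniz_lie, h.aa x hx x' hx', zero_lie, zero_add]

theorem l4 (h : Tri A B C) {x u : L} (hx : x ∈ A) (hu : u ∈ A) (v : L) :
    ⁅⁅x, v⁆, u⁆ = ⁅x, ⁅v, u⁆⁆ := by
  rw [lie_lie, h.aa x hx u hu, lie_zero, sub_zero]

/-- `YZ` on `B` is `ad ⁅y,z⁆` -/
theorem yz (h : Tri A B C) {y z w : L} (hy : y ∈ B) (hw : w ∈ B) :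
    ⁅y, ⁅z, w⁆⁆ = ⁅⁅y, z⁆, w⁆ := (h.rot.l4 hy hw z).symm

/-- `ad (Z Z' y) u = Y Z' Z u` -/
theorem l5 (h : Tri A B C) {y z z' u : L} (hy : y ∈ B) (hz : z ∈ C) (hz' : z' ∈ C) (hu : u ∈ A) :
    ⁅⁅z, ⁅z', y⁆⁆, u⁆ = ⁅y, ⁅z', ⁅z, u⁆⁆⁆ := by
  have h1 : ⁅⁅z', y⁆, u⁆ = 0 := h.aa _ (h.cb _ hz' _ hy) _ hu
  have h2 : ⁅y, ⁅z, u⁆⁆ = 0 := h.bb _ hy _ (h.ca _ hz _ hu)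
  rw [lie_lie, h1, lie_lie z' y, h2, lie_zero, lie_zero, zero_sub, zero_sub, neg_neg]

/-- `ad (Z Z' y) v = Z Z' Y v` on `C` -/
theorem l6 (h : Tri A B C) {y z z' v : L} (hz : z ∈ C) (hz' : z' ∈ C) (hv : v ∈ C) :
    ⁅⁅z, ⁅z', y⁆⁆, v⁆ = ⁅z, ⁅z', ⁅y, v⁆⁆⁆ := by
  rw [h.rot.rot.l4 hz hv, h.rot.rot.l4 hz' hv]

theorem l2 (h : Tri A B C) {y y' z z' u : L} (hy : y ∈ B) (hy' : y' ∈ B) (hz : z ∈ C)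
    (hz' : z' ∈ C) (hu : u ∈ A) :
    ⁅y, ⁅y', ⁅z, ⁅z', u⁆⁆⁆⁆ = ⁅z, ⁅z', ⁅y, ⁅y', u⁆⁆⁆⁆ := by
  have hb : ⁅z', ⁅z, y'⁆⁆ ∈ B := h.ca _ hz' _ (h.cb _ hz _ hy')
  rw [← h.l5 hy' hz' hz hu, h.rot.comm hy hb, h.l6 hz' hz (h.ba _ hy _ hu), h.rot.comm hy' hy,
    h.rot.rot.comm hz' hz]

theorem l3 (h : Tri A B C) {x y z u : L} (hx : x ∈ A) (hy : y ∈ B) (hz : z ∈ C) (hu : u ∈ A) :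
    ⁅z, ⁅x, ⁅y, u⁆⁆⁆ = - ⁅y, ⁅x, ⁅z, u⁆⁆⁆ := by
  have hb : ⁅z, u⁆ ∈ B := h.ca _ hz _ hu
  rw [← h.l4 hx hu, h.rot.rot.comm hz (h.ab _ hx _ hy), lie_lie, h.bb _ hy _ hb]; simp

/-- iterate of ad -/
def itr (x : L) (k : ℕ) (v : L) : L := (fun w => ⁅x, w⁆)^[k] v

@[simp] theorem itr_zero (x v : L) : itr x 0 v = v := rfl
theorem itr_succ (x v : L) (k : ℕ) : itr x (k+1) v = ⁅x, itr x k v⁆ :=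
  Function.iterate_succ_apply' _ _ _
theorem itr_succ' (x v : L) (k : ℕ) : itr x (k+1) v = itr x k ⁅x, v⁆ :=
  Function.iterate_succ_apply _ _ _

theorem itr_lie (h : Tri A B C) {x u : L} (hx : x ∈ A) (hu : u ∈ A) (v : L) (k : ℕ) :
    ⁅itr x k v, u⁆ = itr x k ⁅v, u⁆ := by
  induction k with
  | zero => rfl
  | succ k ih => rw [itr_succ, itr_succ, h.l4 hx hu, ih]

theorem itr_even_mem (h : Tri A B C) {x v : L} (hx : x ∈ A) (hv : v ∈ B) (k : ℕ) :
    itr x (2*k) v ∈ B := by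
  induction k with
  | zero => exact hv
  | succ k ih =>
    rw [show 2*(k+1) = 2*k+1+1 by ring, itr_succ, itr_succ]
    exact h.ac _ hx _ (h.ab _ hx _ ih)

theorem itr_odd_mem (h : Tri A B C) {x v : L} (hx : x ∈ A) (hv : v ∈ B) (k : ℕ) :
    itr x (2*k+1) v ∈ C := by
  rw [itr_succ]; exact h.ab _ hx _ (h.itr_even_mem hx hv k)

theorem itr_odd (h : Tri A B C) {x v w : L} (hx : x ∈ A) (hv : v ∈ B) (hw : w ∈ B) (k : ℕ) :
    ⁅itr x (2*k+1) v, w⁆ = - ⁅v, itr x (2*k+1) w⁆ := by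
  have key : ∀ {v w : L}, v ∈ B → w ∈ B → ⁅⁅x, v⁆, w⁆ = - ⁅v, ⁅x, w⁆⁆ := by
    intro v w hv hw
    rw [lie_lie, h.bb _ hv _ hw]; simp
  have key' : ∀ {v w : L}, v ∈ C → w ∈ C → ⁅⁅x, v⁆, w⁆ = - ⁅v, ⁅x, w⁆⁆ := by
    intro v w hv hw
    rw [lie_lie, h.cc _ hv _ hw]; simp
  induction k generalizing w with
  | zero => exact key hv hw
  | succ k ih =>
    have e : 2*(k+1)+1 = 2*k+1+1+1 := by ring
    rw [e, itr_succ, key (w := w) _ hw, itr_succ, key' (h.itr_odd_mem hx hv k) (h.ab _ hx _ hw),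
      ih (h.ac _ hx _ (h.ab _ hx _ hw)), itr_succ' x w (2*k+1+1), itr_succ' x ⁅x,w⁆ (2*k+1)]
    · rw [neg_neg]
    · rw [itr_succ]; exact h.ac _ hx _ (h.itr_odd_mem hx hv k)

theorem itr_comm (h : Tri A B C) {x x' : L} (hx : x ∈ A) (hx' : x' ∈ A) (k : ℕ) (w : L) :
    ⁅x', itr x k w⁆ = itr x k ⁅x', w⁆ := by
  induction k with
  | zero => rfl
  | succ k ih => rw [itr_succ, itr_succ, h.comm hx' hx, ih]

theorem itr_add (x v w : L) (k : ℕ) : itr x k (v + w) = itr x k v + itr x k w := by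
  induction k with
  | zero => rfl
  | succ k ih => rw [itr_succ, itr_succ, itr_succ, ih, lie_add]

/-- the fundamental recurrence -/
theorem recur (h : Tri A B C) {x y z u : L} (hx : x ∈ A) (hy : y ∈ B) (hz : z ∈ C) (hu : u ∈ A)
    (i : ℕ) :
    ⁅x + y + z, ⁅x + y + z, itr x (2*i) (⁅y, u⁆ + ⁅z, u⁆)⁆⁆ =
      itr x (2*(i+1)) (⁅y, u⁆ + ⁅z, u⁆) +
      itr x (2*i) (⁅y, ⁅y, ⁅y, u⁆⁆ + ⁅z, ⁅z, u⁆⁆⁆ + ⁅z, ⁅y, ⁅y, u⁆⁆ + ⁅z, ⁅z, u⁆⁆⁆) := by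
  have hyu : ⁅y, u⁆ ∈ C := h.ba _ hy _ hu
  have hzu : ⁅z, u⁆ ∈ B := h.ca _ hz _ hu
  have m1 : itr x (2*i) ⁅y, u⁆ ∈ C := h.swap.itr_even_mem hx hyu i
  have m2 : itr x (2*i) ⁅z, u⁆ ∈ B := h.itr_even_mem hx hzu i
  have z1 : ⁅z, itr x (2*i) ⁅y, u⁆⁆ = 0 := h.cc _ hz _ m1
  have z2 : ⁅y, itr x (2*i) ⁅z, u⁆⁆ = 0 := h.bb _ hy _ m2
  have m3 : ⁅y, itr x (2*i) ⁅y, u⁆⁆ ∈ A := h.bc _ hy _ m1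
  have m4 : ⁅z, itr x (2*i) ⁅z, u⁆⁆ ∈ A := h.cb _ hz _ m2
  have z3 := h.aa _ hx _ m3
  have z4 := h.aa _ hx _ m4
  have m5 : itr x (2*i+1) ⁅y, u⁆ ∈ B := h.swap.itr_odd_mem hx hyu i
  have m6 : itr x (2*i+1) ⁅z, u⁆ ∈ C := h.itr_odd_mem hx hzu i
  have z5 : ⁅y, itr x (2*i+1) ⁅y, u⁆⁆ = 0 := h.bb _ hy _ m5
  have z6 : ⁅z, itr x (2*i+1) ⁅z, u⁆⁆ = 0 := h.cc _ hz _ m6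
  have odd : ⁅z, itr x (2*i+1) ⁅y, u⁆⁆ = - ⁅y, itr x (2*i+1) ⁅z, u⁆⁆ := by
    rw [← h.itr_lie hx hu, h.rot.rot.comm hz (h.itr_odd_mem hx hy i), h.itr_odd hx hy hzu]
  have e1 : ∀ {B C : AddSubgroup L} {y : L}, Tri A B C → y ∈ B →
      ⁅y, ⁅y, itr x (2*i) ⁅y, u⁆⁆⁆ = itr x (2*i) ⁅y, ⁅y, ⁅y, u⁆⁆⁆ := by
    intro B C y h hy
    rw [← h.itr_lie hx (u := ⁅y, ⁅y, u⁆⁆) (h.bc _ hy _ (h.ba _ hy _ hu)), ← h.itr_lie hx hu]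
    have := h.itr_even_mem hx hy i
    rw [h.rot.comm hy this, h.rot.comm hy this]
  have e2 : ∀ {B C : AddSubgroup L} {y z : L}, Tri A B C → y ∈ B → z ∈ C →
      ⁅y, ⁅z, itr x (2*i) ⁅z, u⁆⁆⁆ = itr x (2*i) ⁅y, ⁅z, ⁅z, u⁆⁆⁆ := by
    intro B C y z h hy hz
    rw [h.yz hy (h.itr_even_mem hx (h.ca _ hz _ hu) i), h.itr_comm hx (h.bc _ hy _ hz),
      h.yz hy (h.ca _ hz _ hu)]
  have f1 := e1 h hy
  have f2 := e1 h.swap hz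
  have f3 := e2 h hy hz
  have f4 := e2 h.swap hz hy
  have s1 := fun v => (itr_succ x v (2*i)).symm
  have s2 := fun v => (itr_succ x v (2*i+1)).symm
  rw [show 2*(i+1) = 2*i+1+1 by ring]
  simp only [itr_add, lie_add, add_lie, z1, z2, z3, z4, s1, s2, z5, z6, odd, f1, f2, f3, f4, lie_zero]
  abel

/-! ### derived triples -/

theorem xfy (h : Tri A B C) {x y z u : L} (hx : x ∈ A) (hy : y ∈ B) (hz : z ∈ C) (hu : u ∈ A) :
    ⁅⁅y, ⁅y, x⁆⁆, ⁅y, u⁆⁆ = ⁅x, ⁅y, ⁅y, ⁅y, u⁆⁆⁆⁆ ∧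
    ⁅⁅z, ⁅z, x⁆⁆, ⁅y, u⁆⁆ = ⁅x, ⁅y, ⁅z, ⁅z, u⁆⁆⁆⁆ := by
  have hyu : ⁅y, u⁆ ∈ C := h.ba _ hy _ hu
  have hzu : ⁅z, u⁆ ∈ B := h.ca _ hz _ hu
  constructor
  · exact h.rot.rot.l5 hx hy hy hyu
  · rw [h.l6 hz hz hyu, h.l3 hx hy hz hu, h.yz (z := z) hy hzu, h.comm hx (h.bc _ hy _ hz), lie_neg,
      h.swap.yz hz (h.ab _ hx _ hzu), ← lie_skew y z, neg_lie]

theorem yf (h : Tri A B C) {x y z u : L} (hx : x ∈ A) (hy : y ∈ B) (hz : z ∈ C) (hu : u ∈ A) :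
    ⁅⁅z, ⁅z, y⁆⁆, u⁆ = ⁅y, ⁅z, ⁅z, u⁆⁆⁆ ∧ ⁅⁅x, ⁅x, y⁆⁆, u⁆ = ⁅x, ⁅x, ⁅y, u⁆⁆⁆ := by
  refine ⟨h.l5 hy hz hz hu, ?_⟩
  rw [h.l4 hx hu, h.l4 hx hu]

theorem yzf (h : Tri A B C) {x y z w : L} (hx : x ∈ A) (hy : y ∈ B) (hz : z ∈ C) (hw : w ∈ B) :
    ⁅y, ⁅⁅x, ⁅x, z⁆⁆, w⁆⁆ = ⁅x, ⁅x, ⁅y, ⁅z, w⁆⁆⁆⁆ ∧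
    ⁅y, ⁅⁅y, ⁅y, z⁆⁆, w⁆⁆ = ⁅y, ⁅y, ⁅y, ⁅z, w⁆⁆⁆⁆ := by
  have hxw : ⁅x, w⁆ ∈ C := h.ab _ hx _ hw
  constructor
  · rw [h.rot.l5 hz hx hx hw, h.yz hy (h.ac _ hx _ hxw), h.yz hy hw, 
      h.comm (h.bc _ hy _ hz) hx, h.comm (h.bc _ hy _ hz) hx]
  · rw [h.rot.l4 hy hw, h.rot.l4 hy hw]

end Tri
end FrobTwelve


namespace FrobTwelve
namespace Tri

section

variable {L : Type*} [LieRing L] {A B C : AddSubgroup L}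

/-- `φ ↦ X² ∘ φ` -/
def post (A : AddSubgroup L) (x : L) : Module.End ℤ (A → L) where
  toFun φ u := ⁅x, ⁅x, φ u⁆⁆
  map_add' φ ψ := by ext u; simp
  map_smul' n φ := by ext u; simp

/-- `φ ↦ φ ∘ d` -/
def pre (d : A → A) : Module.End ℤ (A → L) where
  toFun φ u := φ (d u)
  map_add' _ _ := rfl
  map_smul' _ _ := rfl

theorem post_apply (x : L) (φ : A → L) (u : A) : post A x φ u = ⁅x, ⁅x, φ u⁆⁆ := rfl
theorem pre_apply (d : A → A) (φ : A → L) (u : A) : pre d φ u = φ (d u) := rfl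

/-- `u ↦ Y² u` -/
def sq (h : Tri A B C) (y : L) (hy : y ∈ B) (u : A) : A :=
  ⟨⁅y, ⁅y, (u : L)⁆⁆, h.bc _ hy _ (h.ba _ hy _ u.2)⟩

theorem sq_coe (h : Tri A B C) (y : L) (hy : y ∈ B) (u : A) :
    (h.sq y hy u : L) = ⁅y, ⁅y, (u : L)⁆⁆ := rfl

/-- `u ↦ ⁅y, u⁆` -/
def adf (A : AddSubgroup L) (y : L) : A → L := fun u => ⁅y, (u : L)⁆

theorem post_pre (x : L) (d : A → A) : Commute (post A x) (pre d) := by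
  ext φ u; rfl

theorem pre_sq_comm (h : Tri A B C) {y y' : L} (hy : y ∈ B) (hy' : y' ∈ B) :
    Commute (pre (h.sq y hy)) (pre (h.sq y' hy')) := by
  ext φ u
  change φ _ = φ _
  congr 1
  ext
  simp only [sq_coe]
  simp only [h.rot.comm hy hy']

theorem pre_sq_comm' (h : Tri A B C) {y z : L} (hy : y ∈ B) (hz : z ∈ C) :
    Commute (pre (h.sq y hy)) (pre (h.swap.sq z hz)) := by
  ext φ u
  change φ _ = φ _
  congr 1
  ext
  simp only [sq_coe]
  exact (h.l2 hy hy hz hz u.2).symm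

theorem post_comm (h : Tri A B C) {x x' : L} (hx : x ∈ A) (hx' : x' ∈ A) :
    Commute (post A x) (post A x') := by
  ext φ u
  change ⁅x, ⁅x, ⁅x', ⁅x', φ u⁆⁆⁆⁆ = ⁅x', ⁅x', ⁅x, ⁅x, φ u⁆⁆⁆⁆
  simp only [h.comm hx hx']

def eOp (h : Tri A B C) (x y z : L) (hy : y ∈ B) (hz : z ∈ C) : Module.End ℤ (A → L) :=
  post A x + (pre (h.sq y hy) + pre (h.swap.sq z hz))

theorem pow_eOp (h : Tri A B C) {x y z : L} (hx : x ∈ A) (hy : y ∈ B) (hz : z ∈ C) (n : ℕ) :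
    (post A (x+y+z) ^ n) (adf A y + adf A z) = (h.eOp x y z hy hz ^ n) (adf A y + adf A z) := by
  set D := post A (x+y+z) with hD
  set T1 := post A x with hT1
  set P := pre (h.sq y hy) + pre (h.swap.sq z hz) with hP
  set F0 := adf A y + adf A z with hF0
  have hc : Commute T1 P := (post_pre _ _).add_right (post_pre _ _)
  have hcD : Commute D P := (post_pre _ _).add_right (post_pre _ _)
  have hF : ∀ k u, (T1 ^ k) F0 u = itr x (2*k) (⁅y, (u:L)⁆ + ⁅z, (u:L)⁆) := by
    intro k
    induction k with
    | zero => intro u; rfl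
    | succ k ih =>
      intro u
      rw [pow_succ', Module.End.mul_apply, hT1, post_apply, ← hT1, ih,
        show 2*(k+1) = 2*k+1+1 by ring, itr_succ, itr_succ]
  have base : ∀ k, D ((T1 ^ k) F0) = (T1 + P) ((T1^k) F0) := by
    intro k
    ext u
    rw [hD, post_apply, hF, h.recur hx hy hz u.2, LinearMap.add_apply, Pi.add_apply,
      ← Module.End.mul_apply, ← pow_succ', hF, hP, LinearMap.add_apply, Pi.add_apply,
      pre_apply, pre_apply, hF, hF, ← itr_add]
    congr 2
    simp only [sq_coe, lie_add]
    abel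
  have e1 : ∀ n k, ((T1 + P)^(n+1)) ((T1 ^ k) F0) = ((T1+P)^n) ((T1^(k+1)) F0)
      + P (((T1+P)^n) ((T1^k) F0)) := by
    intro n k
    have hcc0 : Commute ((T1+P)^n) P := (hc.add_left (Commute.refl P)).pow_left _
    rw [pow_succ (T1+P), Module.End.mul_apply, LinearMap.add_apply, map_add,
      ← Module.End.mul_apply T1, ← pow_succ', ← Module.End.mul_apply _ P, hcc0.eq,
      Module.End.mul_apply]
  have gen : ∀ n k, D (((T1 + P)^n) ((T1 ^ k) F0)) = ((T1 + P)^(n+1)) ((T1^k) F0) := by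
    intro n
    induction n with
    | zero => intro k; simpa using base k
    | succ n ih =>
      intro k
      have e2 : D (P (((T1+P)^n) ((T1^k) F0))) = P (D (((T1+P)^n) ((T1^k) F0))) := by
        rw [← Module.End.mul_apply, hcD.eq, Module.End.mul_apply]
      rw [e1, map_add, ih, e2, ih, ← e1]
  change (D ^ n) F0 = ((T1 + P) ^ n) F0
  induction n with
  | zero => rfl
  | succ n ih =>
    rw [pow_succ', Module.End.mul_apply, ih]
    simpa using gen n 0

theorem itr_odd_apply (h : Tri A B C) {x y z : L} (hx : x ∈ A) (n : ℕ) (u : A) :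
    itr (x+y+z) (2*n+1) (u : L) = (post A (x+y+z) ^ n) (adf A y + adf A z) u := by
  induction n with
  | zero =>
    simp [adf, itr_succ, h.aa x hx u u.2]
  | succ n ih =>
    rw [pow_succ', Module.End.mul_apply, post_apply, ← ih,
      show 2*(n+1)+1 = (2*n+1)+1+1 by ring, itr_succ, itr_succ]

theorem step1a (h : Tri A B C) (h2 : ∀ w : L, w + w = 0 → w = 0)
    {x y z : L} (hx : x ∈ A) (hy : y ∈ B) (hz : z ∈ C) (m : ℕ)
    (hD : ∀ u : L, itr (x + y + z) (2*m+1) u = 0)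
    (hD' : ∀ u : L, itr (y - x - z) (2*m+1) u = 0) :
    (h.eOp x y z hy hz ^ m) (adf A y) = 0 := by
  have e : h.eOp (-x) y (-z) hy (C.neg_mem hz) = h.eOp x y z hy hz := by
    unfold eOp
    congr 1
    · ext φ u; simp only [post_apply, neg_lie, lie_neg, neg_neg]
    · congr 2
      ext u; simp only [sq_coe, neg_lie, lie_neg, neg_neg]
  have h1 := h.pow_eOp hx hy hz m
  have h3 := h.pow_eOp (A.neg_mem hx) hy (C.neg_mem hz) m
  rw [e] at h3
  have k1 : (post A (x+y+z) ^ m) (adf A y + adf A z) = 0 := by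
    ext u; rw [← h.itr_odd_apply hx, hD]; rfl
  have k3 : (post A (-x+y+-z) ^ m) (adf A y + adf A (-z)) = 0 := by
    ext u; rw [← h.itr_odd_apply (A.neg_mem hx), show -x+y+-z = y-x-z by abel, hD']; rfl
  rw [k1] at h1
  rw [k3] at h3
  have h5 : (h.eOp x y z hy hz ^ m) (adf A y) + (h.eOp x y z hy hz ^ m) (adf A y) = 0 := by
    have hz0 : adf A (-z) = - adf A z := by ext u; simp [adf]
    rw [hz0] at h3
    have := congrArg₂ (· + ·) h1 h3
    simp only [map_add, map_neg, add_zero] at this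
    rw [this]; abel
  ext u
  exact h2 _ (congrFun h5 u)

end
end Tri
end FrobTwelve


namespace FrobTwelve

theorem poly_ideal {S : Type*} [CommRing S] (I : Ideal S) (a b c : S) (m : ℕ)
    (h1 : (a + (b + c)) ^ m ∈ I)
    (h2 : ((c + a) * (a * (b + c)^2 + b * (c + a)^2 + c * (a + b)^2)) ^ m ∈ I)
    (h3 : ((c + 2*a) * (a * (b + 2*c)^2 + b * (c + 2*a)^2 + c * (a + 2*b)^2)) ^ m ∈ I) :
    (6 * b ^ 7) ^ (3 * m) ∈ I := by
  have key : 6 * b^7 =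
    ((15)*a^2*b^4*c^0 + (23)*a^2*b^3*c^1 + (-17)*a^2*b^2*c^2 + (-16)*a^2*b^1*c^3 + (-3)*a^2*b^0*c^4
     + (-6)*a^1*b^5*c^0 + (35)*a^1*b^4*c^1 + (18)*a^1*b^3*c^2 + (-54)*a^1*b^2*c^3
     + (-28)*a^1*b^1*c^4 + (-3)*a^1*b^0*c^5 + (6)*a^0*b^6*c^0 + (-6)*a^0*b^5*c^1
     + (17)*a^0*b^4*c^2 + (-7)*a^0*b^3*c^3 + (-13)*a^0*b^2*c^4 + (-3)*a^0*b^1*c^5)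
       * (a + (b + c))
    + (((3)*a^0*b^0*c^3 + (13)*a^0*b^1*c^2 + (10)*a^0*b^2*c^1 + (-7)*a^0*b^3*c^0)
       * ((c + a) * (a * (b + c)^2 + b * (c + a)^2 + c * (a + b)^2))
    + ((-3)*a^0*b^2*c^1 + (-1)*a^0*b^3*c^0)
       * ((c + 2*a) * (a * (b + 2*c)^2 + b * (c + 2*a)^2 + c * (a + 2*b)^2))) := by
    ring
  have mp : ∀ u v : S, v ^ m ∈ I → (u * v) ^ m ∈ I := fun u v hv => by
    rw [mul_pow]; exact I.mul_mem_left _ hv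
  rw [key]
  refine Ideal.add_pow_mem_of_pow_mem_of_le I (mp _ _ h1)
    (Ideal.add_pow_mem_of_pow_mem_of_le I (mp _ _ h2) (mp _ _ h3) (k := 2 * m) (by omega)) (by omega)

theorem aux {S : Type*} [CommRing S] (g e : S) (k : ℕ) :
    (g * e) ^ (k + 1) = g ^ k * (e ^ (k + 1) * g) := by ring

theorem poly_end {R M : Type*} [Ring R] [AddCommGroup M] [Module R M] (a b c : R) (m : ℕ) (Y : M)
    (hab : Commute a b) (hac : Commute a c) (hbc : Commute b c)
    (h1 : (a + (b + c)) ^ m • Y = 0)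
    (h2 : (a * (b + c)^2 + b * (c + a)^2 + c * (a + b)^2) ^ m • (c + a) • Y = 0)
    (h3 : (a * (b + 2*c)^2 + b * (c + 2*a)^2 + c * (a + 2*b)^2) ^ m • (c + 2*a) • Y = 0) :
    (6 * b ^ 7) ^ (3 * m) • Y = 0 := by
  by_cases hm : m = 0
  · subst hm; simpa using h1
  let s : Set R := {a, b, c}
  let _ : CommRing (Algebra.adjoin ℤ s) := 
    { (inferInstance : Ring (Algebra.adjoin ℤ s)) with
      mul_comm := by
        have := Algebra.isMulCommutative_adjoin ℤ (s := s) (by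
          simp only [s, Set.mem_insert_iff, Set.mem_singleton_iff]
          rintro x (rfl|rfl|rfl) y (rfl|rfl|rfl) <;>
            simp only [hab.eq, hac.eq, hbc.eq])
        exact fun x y => this.is_comm.comm x y }
  let I : Ideal (Algebra.adjoin ℤ s) :=
    { carrier := {x | (x : R) • Y = 0}
      add_mem' := by
        intro x y hx hy
        simp only [Set.mem_setOf_eq] at *
        change ((x : R) + (y:R)) • Y = 0
        rw [add_smul, hx, hy, add_zero]
      zero_mem' := by
        change (0 : R) • Y = 0
        simp
      smul_mem' := by
        intro x y hy
        simp only [Set.mem_setOf_eq] at *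
        change ((x : R) * (y:R)) • Y = 0
        rw [mul_smul, hy, smul_zero] }
  have ha : a ∈ Algebra.adjoin ℤ s := Algebra.subset_adjoin (by simp [s])
  have hb : b ∈ Algebra.adjoin ℤ s := Algebra.subset_adjoin (by simp [s])
  have hc : c ∈ Algebra.adjoin ℤ s := Algebra.subset_adjoin (by simp [s])
  have := poly_ideal I ⟨a, ha⟩ ⟨b, hb⟩ ⟨c, hc⟩ m h1 ?_ ?_
  · exact this
  · obtain ⟨k, rfl⟩ := Nat.exists_eq_succ_of_ne_zero hm
    rw [aux]
    apply I.mul_mem_left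
    change (_ * _ : R) • Y = 0
    rw [mul_smul]
    exact h2
  · obtain ⟨k, rfl⟩ := Nat.exists_eq_succ_of_ne_zero hm
    rw [aux]
    apply I.mul_mem_left
    change (_ * _ : R) • Y = 0
    rw [mul_smul]
    exact h3

end FrobTwelve


namespace FrobTwelve
namespace Tri
section
variable {L : Type*} [LieRing L] {A B C : AddSubgroup L}

theorem step1b (h : Tri A B C) {x y z : L} (hx : x ∈ A) (hy : y ∈ B) (hz : z ∈ C) (β : ℤ)
    {xf yf zf : L} (hxf : xf = ⁅y, ⁅y, x⁆⁆ + β • ⁅z, ⁅z, x⁆⁆)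
    (hyf : yf = ⁅z, ⁅z, y⁆⁆ + β • ⁅x, ⁅x, y⁆⁆) (hzf : zf = ⁅x, ⁅x, z⁆⁆ + β • ⁅y, ⁅y, z⁆⁆)
    (mxf : xf ∈ A) (myf : yf ∈ B) (mzf : zf ∈ C) (m : ℕ)
    (hn : (h.eOp xf yf zf myf mzf ^ m) (adf A yf) = 0)
    {a b c : Module.End ℤ (A → L)} (ha : a = post A x) (hb : b = pre (h.sq y hy))
    (hc : c = pre (h.swap.sq z hz)) :
    ((a * (b + β • c)^2 + b * (c + β • a)^2 + c * (a + β • b)^2) ^ m)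
      ((c + β • a) (adf A y)) = 0 := by
  have cab : Commute a b := by rw [ha, hb]; exact post_pre _ _
  have cac : Commute a c := by rw [ha, hc]; exact post_pre _ _
  have cbc : Commute b c := by rw [hb, hc]; exact h.pre_sq_comm' hy hz
  have hyzzu : ∀ u ∈ A, ⁅y, ⁅y, u⁆⁆ ∈ A := fun u hu => h.bc _ hy _ (h.ba _ hy _ hu)
  have hzzu : ∀ u ∈ A, ⁅z, ⁅z, u⁆⁆ ∈ A := fun u hu => h.cb _ hz _ (h.ca _ hz _ hu)
  have kx : ∀ u ∈ A, ⁅xf, ⁅y, u⁆⁆ = ⁅x, ⁅y, ⁅y, ⁅y, u⁆⁆ + β • ⁅z, ⁅z, u⁆⁆⁆⁆ := by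
    intro u hu
    rw [hxf, add_lie, smul_lie, (h.xfy hx hy hz hu).1, (h.xfy hx hy hz hu).2]
    simp only [lie_add, lie_smul]
  have ky : ∀ u ∈ A, ⁅yf, u⁆ = ⁅y, ⁅z, ⁅z, u⁆⁆⁆ + β • ⁅x, ⁅x, ⁅y, u⁆⁆⁆ := by
    intro u hu
    rw [hyf, add_lie, smul_lie, (h.yf hx hy hz hu).1, (h.yf hx hy hz hu).2]
  have kz : ∀ w ∈ B, ⁅y, ⁅zf, w⁆⁆ = ⁅x, ⁅x, ⁅y, ⁅z, w⁆⁆⁆⁆ + β • ⁅y, ⁅y, ⁅y, ⁅z, w⁆⁆⁆⁆ := by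
    intro w hw
    rw [hzf, add_lie, smul_lie, lie_add, lie_smul, (h.yzf hx hy hz hw).1, (h.yzf hx hy hz hw).2]
  have hg : adf A yf = (c + β • a) (adf A y) := by
    ext u
    rw [ha, hc]
    change ⁅yf, (u:L)⁆ = ⁅y, ⁅z, ⁅z, (u:L)⁆⁆⁆ + β • ⁅x, ⁅x, ⁅y, (u:L)⁆⁆⁆
    exact ky u u.2
  set Θ := h.eOp xf yf zf myf mzf with hΘ
  have cΘa : Commute Θ a := by
    rw [ha]
    exact (h.post_comm mxf hx).add_left ((post_pre _ _).symm.add_left (post_pre _ _).symm)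
  have cΘb : Commute Θ b := by
    rw [hb]
    exact (post_pre _ _).add_left ((h.pre_sq_comm _ _).add_left (h.pre_sq_comm' _ _).symm)
  have cΘc : Commute Θ c := by
    rw [hc]
    exact (post_pre _ _).add_left ((h.pre_sq_comm' _ _).add_left (h.swap.pre_sq_comm _ _))
  have t1 : post A xf (adf A y) = (a * (b + β • c)^2) (adf A y) := by
    ext u
    have m1 := hyzzu u u.2
    have m2 := hzzu u u.2
    have e1 : post A xf (adf A y) u =
        ⁅x, ⁅x, ⁅y, ⁅y, ⁅y, ⁅y, ⁅y, (u:L)⁆⁆⁆⁆ + β • ⁅z, ⁅z, ⁅y, ⁅y, (u:L)⁆⁆⁆⁆⁆⁆⁆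
        + β • ⁅x, ⁅x, ⁅y, ⁅y, ⁅y, ⁅z, ⁅z, (u:L)⁆⁆⁆⁆ + β • ⁅z, ⁅z, ⁅z, ⁅z, (u:L)⁆⁆⁆⁆⁆⁆⁆ := by
      change ⁅xf, ⁅xf, ⁅y, (u:L)⁆⁆⁆ = _
      rw [kx u u.2, h.comm mxf hx, lie_add y, lie_smul, lie_add, lie_smul, kx _ m1, kx _ m2]
      simp only [lie_add, lie_smul]
    rw [e1, ha, hb, hc]
    simp only [pow_two, Module.End.mul_apply, post_apply, LinearMap.add_apply, LinearMap.smul_apply,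
      Pi.add_apply, Pi.smul_apply, pre_apply, adf, sq_coe, lie_add, lie_smul, smul_add]
  have t2 : pre (h.sq yf myf) (adf A y) = (b * (c + β • a)^2) (adf A y) := by
    ext u
    have m1 := hyzzu u u.2
    have m2 := hzzu u u.2
    have e1 : pre (h.sq yf myf) (adf A y) u = ⁅y, ⁅z, ⁅z, ⁅y, ⁅y, ⁅z, ⁅z, (u:L)⁆⁆⁆⁆⁆⁆⁆
        + β • ⁅x, ⁅x, ⁅y, ⁅y, ⁅y, ⁅z, ⁅z, (u:L)⁆⁆⁆⁆⁆⁆⁆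
        + β • ⁅x, ⁅x, ⁅y, ⁅z, ⁅z, ⁅y, ⁅y, (u:L)⁆⁆⁆⁆⁆ + β • ⁅x, ⁅x, ⁅y, ⁅y, ⁅y, (u:L)⁆⁆⁆⁆⁆⁆⁆ := by
      change ⁅y, ⁅yf, ⁅yf, (u:L)⁆⁆⁆ = _
      rw [h.rot.comm hy myf, ky _ (h.bc _ hy _ (h.ba _ myf _ u.2)), ← h.l2 hy myf hz hz u.2,
        h.rot.comm hy myf, h.rot.comm hy myf, ky _ (hyzzu _ m2), h.rot.comm hy myf, h.rot.comm hy myf,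
        ky _ m1]
    rw [e1, ha, hb, hc]
    simp only [pow_two, Module.End.mul_apply, post_apply, LinearMap.add_apply, LinearMap.smul_apply,
      Pi.add_apply, Pi.smul_apply, pre_apply, adf, sq_coe, lie_add, lie_smul, smul_add]
    rw [h.l2 hy hy hz hz u.2]
  have t3 : pre (h.swap.sq zf mzf) (adf A y) = (c * (a + β • b)^2) (adf A y) := by
    ext u
    have m3 := h.ca _ hz _ u.2
    have e1 : pre (h.swap.sq zf mzf) (adf A y) u = 
        ⁅x, ⁅x, ⁅x, ⁅x, ⁅y, ⁅z, ⁅z, (u:L)⁆⁆⁆⁆⁆⁆⁆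
        + β • ⁅x, ⁅x, ⁅y, ⁅y, ⁅y, ⁅z, ⁅z, (u:L)⁆⁆⁆⁆⁆⁆⁆
        + β • ⁅y, ⁅y, ⁅x, ⁅x, ⁅y, ⁅z, ⁅z, (u:L)⁆⁆⁆⁆⁆ + β • ⁅y, ⁅y, ⁅y, ⁅z, ⁅z, (u:L)⁆⁆⁆⁆⁆⁆⁆ := by
      change ⁅y, ⁅zf, ⁅zf, (u:L)⁆⁆⁆ = _
      rw [kz _ (h.ca _ mzf _ u.2), h.rot.rot.comm hz mzf, kz _ m3]
      simp only [lie_add, lie_smul]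
    have e2 : ⁅y, ⁅y, ⁅x, ⁅x, ⁅y, ⁅z, ⁅z, (u:L)⁆⁆⁆⁆⁆⁆⁆ = ⁅x, ⁅x, ⁅y, ⁅y, ⁅y, ⁅z, ⁅z, (u:L)⁆⁆⁆⁆⁆⁆⁆ := by
      rw [h.rot.rot.l2 hx hx hy hy (h.ba _ hy _ (hzzu _ u.2))]
    rw [e1, ha, hb, hc]
    simp only [pow_two, Module.End.mul_apply, post_apply, LinearMap.add_apply, LinearMap.smul_apply,
      Pi.add_apply, Pi.smul_apply, pre_apply, adf, sq_coe, lie_add, lie_smul, smul_add]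
    rw [e2]
  set ef := a * (b + β • c)^2 + b * (c + β • a)^2 + c * (a + β • b)^2 with hef
  have t : Θ (adf A y) = ef (adf A y) := by
    rw [hΘ, hef, eOp, LinearMap.add_apply, LinearMap.add_apply, t1, t2, t3, LinearMap.add_apply,
      LinearMap.add_apply, add_assoc]
  have cΘe : Commute Θ ef := by
    refine ((cΘa.mul_right ?_).add_right (cΘb.mul_right ?_)).add_right (cΘc.mul_right ?_)
    · exact (cΘb.add_right (cΘc.smul_right β)).pow_right _
    · exact (cΘc.add_right (cΘa.smul_right β)).pow_right _
    · exact (cΘa.add_right (cΘb.smul_right β)).pow_right _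
  have cg : ∀ s : Module.End ℤ (A → L), Commute a s → Commute b s → Commute c s → Commute ef s := by
    intro s ha hb hc
    refine ((ha.mul_left ?_).add_left (hb.mul_left ?_)).add_left (hc.mul_left ?_)
    · exact (hb.add_left (hc.smul_left β)).pow_left _
    · exact (hc.add_left (ha.smul_left β)).pow_left _
    · exact (ha.add_left (hb.smul_left β)).pow_left _
  have cge : Commute ef (c + β • a) := (cg c cac cbc (Commute.refl _)).add_right
    ((cg a (Commute.refl _) cab.symm cac.symm).smul_right β)
  have cgΘ : Commute Θ (c + β • a) := cΘc.add_right (cΘa.smul_right β)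
  have pw : ∀ k, (Θ ^ k) (adf A y) = (ef ^ k) (adf A y) := by
    intro k
    induction k with
    | zero => rfl
    | succ k ih =>
      rw [pow_succ', Module.End.mul_apply, ih, ← Module.End.mul_apply, (cΘe.pow_right k).eq,
        Module.End.mul_apply, t, ← Module.End.mul_apply, ← pow_succ]
  rw [← Module.End.mul_apply, (cge.pow_left m).eq, Module.End.mul_apply, ← pw,
    ← Module.End.mul_apply, ← (cgΘ.pow_left m).eq, Module.End.mul_apply, ← hg, hn]

/-- nilpotency condition for a triple -/
def NilT (m : ℕ) (x y z : L) : Prop :=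
  (∀ u : L, itr (x + y + z) (2*m+1) u = 0) ∧ (∀ u : L, itr (y - x - z) (2*m+1) u = 0)

theorem stepI (h : Tri A B C) (h2 : ∀ w : L, w + w = 0 → w = 0) (h3 : ∀ w : L, w + w + w = 0 → w = 0)
    {x y z : L} (hx : x ∈ A) (hy : y ∈ B) (hz : z ∈ C) (m : ℕ)
    (n0 : NilT m x y z)
    (n1 : ∀ β : ℤ, β = 1 ∨ β = 2 → NilT m (⁅y, ⁅y, x⁆⁆ + β • ⁅z, ⁅z, x⁆⁆)
      (⁅z, ⁅z, y⁆⁆ + β • ⁅x, ⁅x, y⁆⁆) (⁅x, ⁅x, z⁆⁆ + β • ⁅y, ⁅y, z⁆⁆)) (u : L) (hu : u ∈ A) :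
    itr y (42 * m + 1) u = 0 := by
  have mx : ∀ β : ℤ, ⁅y, ⁅y, x⁆⁆ + β • ⁅z, ⁅z, x⁆⁆ ∈ A := fun β =>
    A.add_mem (h.bc _ hy _ (h.ba _ hy _ hx)) (A.zsmul_mem (h.cb _ hz _ (h.ca _ hz _ hx)) β)
  have my : ∀ β : ℤ, ⁅z, ⁅z, y⁆⁆ + β • ⁅x, ⁅x, y⁆⁆ ∈ B := fun β =>
    B.add_mem (h.ca _ hz _ (h.cb _ hz _ hy)) (B.zsmul_mem (h.ac _ hx _ (h.ab _ hx _ hy)) β)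
  have mz : ∀ β : ℤ, ⁅x, ⁅x, z⁆⁆ + β • ⁅y, ⁅y, z⁆⁆ ∈ C := fun β =>
    C.add_mem (h.ab _ hx _ (h.ac _ hx _ hz)) (C.zsmul_mem (h.ba _ hy _ (h.bc _ hy _ hz)) β)
  have k0 := h.step1a h2 hx hy hz m n0.1 n0.2
  have k1 := h.step1b hx hy hz 1 rfl rfl rfl (mx 1) (my 1) (mz 1) m
    (h.step1a h2 (mx 1) (my 1) (mz 1) m (n1 1 (Or.inl rfl)).1 (n1 1 (Or.inl rfl)).2) rfl rfl rfl
  have k2 := h.step1b hx hy hz 2 rfl rfl rfl (mx 2) (my 2) (mz 2) m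
    (h.step1a h2 (mx 2) (my 2) (mz 2) m (n1 2 (Or.inr rfl)).1 (n1 2 (Or.inr rfl)).2) rfl rfl rfl
  simp only [one_smul] at k1
  simp only [zsmul_eq_mul, Int.cast_ofNat] at k2
  have := poly_end (R := Module.End ℤ (A → L)) (post A x) (pre (h.sq y hy)) (pre (h.swap.sq z hz)) m
    (adf A y) (post_pre _ _) (post_pre _ _) (h.pre_sq_comm' hy hz) k0 k1 k2
  have hcom : Commute (6 : Module.End ℤ (A → L)) (pre (h.sq y hy) ^ 7) :=
    (Nat.cast_commute 6 _)
  rw [hcom.mul_pow] at this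
  have six : ∀ w : L, (6 : ℤ) • w = 0 → w = 0 := by
    intro w hw
    apply h2
    apply h3
    rw [← hw]
    have : (6 : ℤ) = 1 + 1 + 1 + 1 + 1 + 1 := rfl
    rw [this]
    simp only [add_smul, one_smul]
    abel
  have six' : ∀ k (v : A → L), ((6 : Module.End ℤ (A → L)) ^ k) v = 0 → v = 0 := by
    intro k
    induction k with
    | zero => intro v hv; exact hv
    | succ k ih =>
      intro v hv
      rw [pow_succ, Module.End.mul_apply] at hv
      have := ih _ hv
      ext u
      apply six
      have := congrFun this u
      rw [show (6 : Module.End ℤ (A → L)) = ((6 : ℕ) : Module.End ℤ (A → L)) by simp,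
        Module.End.natCast_apply] at this
      rw [Pi.smul_apply] at this
      exact (natCast_zsmul (v u) 6).trans this
  rw [mul_smul] at this
  have := six' _ _ this
  have hT : ∀ k (u : A), (pre (h.sq y hy) ^ k) (adf A y) u = itr y (2*k+1) (u : L) := by
    intro k
    induction k with
    | zero => intro u; rfl
    | succ k ih =>
      intro u
      rw [pow_succ', Module.End.mul_apply, pre_apply, ih, sq_coe, ← itr_succ', ← itr_succ']
      rfl
  have := congrFun this ⟨u, hu⟩
  rw [← pow_mul] at this
  change (pre (h.sq y hy) ^ _) (adf A y) _ = 0 at this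
  rw [hT] at this
  rw [show 42 * m + 1 = 2 * (7 * (3 * m)) + 1 by ring]
  exact this

end
end Tri
end FrobTwelve


attribute [local instance] LieRing.ofAssociativeRing

namespace FrobTwelve

/-- Abstract system of triples in an associative ring. -/
structure Sys {E : Type} [Ring E] (N : ℕ) (T : ℕ → (Fin 3 → E) → Prop) : Prop where
  add : ∀ n v w, T n v → T n w → T n (v + w)
  neg : ∀ n v, T n v → T n (-v)
  cr : ∀ m n v w, T m v → T n w → T (m + n) (fun i => ⁅v (i+1), w (i+2)⁆)
  cr' : ∀ m n v w, T m v → T n w → T (m + n) (fun i => ⁅v (i+2), w (i+1)⁆)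
  same : ∀ m n v w, T m v → T n w → ∀ i, ⁅v i, w i⁆ = 0
  nil : ∀ n v, T n v → ∀ i, (v i + v (i+1) + v (i+2)) ^ N = 0
  nil' : ∀ n v, T n v → ∀ i, (v (i+1) - v i - v (i+2)) ^ N = 0
  two : ∃ k : ℕ, (k : E) * 2 = 1
  three : ∃ k : ℕ, (k : E) * 3 = 1

theorem ad_nil {E : Type} [Ring E] (s : E) (N : ℕ) (hs : s ^ N = 0) (u : E) :
    Tri.itr s (2*N+1) u = 0 := by
  have h1 : ∀ k u, Tri.itr s k u = ((LinearMap.mulLeft ℤ s - LinearMap.mulRight ℤ s) ^ k) u := by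
    intro k
    induction k with
    | zero => intro u; rfl
    | succ k ih =>
      intro u
      rw [Tri.itr_succ, ih, pow_succ', Module.End.mul_apply]
      simp [Ring.lie_def]
  rw [h1, sub_eq_add_neg]
  have hc : Commute (LinearMap.mulLeft ℤ s) (-LinearMap.mulRight ℤ s) :=
    (LinearMap.commute_mulLeft_right s s).neg_right
  rw [hc.add_pow_eq_zero_of_add_le_succ_of_pow_eq_zero (m := N) (n := N) (k := 2*N+1)]
  · rfl
  · rw [LinearMap.pow_mulLeft, hs]; simp
  · rw [neg_pow, LinearMap.pow_mulRight, hs]; simp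
  · omega

namespace Sys
variable {E : Type} [Ring E] {N : ℕ} {T : ℕ → (Fin 3 → E) → Prop}

/-- the components -/
def comp (T : ℕ → (Fin 3 → E) → Prop) (i : Fin 3) : AddSubgroup E :=
  AddSubgroup.closure {x | ∃ n v, T n v ∧ v i = x}

theorem mem_comp {n : ℕ} {v : Fin 3 → E} (hv : T n v) (i : Fin 3) : v i ∈ comp T i :=
  AddSubgroup.subset_closure ⟨n, v, hv, rfl⟩

theorem lie_mem_of {S S' : Set E} {P : AddSubgroup E} (h : ∀ x ∈ S, ∀ y ∈ S', ⁅x, y⁆ ∈ P) :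
    ∀ x ∈ AddSubgroup.closure S, ∀ y ∈ AddSubgroup.closure S', ⁅x, y⁆ ∈ P := by
  intro x hx y hy
  induction hx using AddSubgroup.closure_induction with
  | mem x hx =>
    induction hy using AddSubgroup.closure_induction with
    | mem y hy => exact h x hx y hy
    | zero => simp
    | add a b _ _ ha hb => rw [lie_add]; exact P.add_mem ha hb
    | neg a _ ha => rw [lie_neg]; exact P.neg_mem ha
  | zero => simp
  | add a b _ _ ha hb => rw [add_lie]; exact P.add_mem ha hb
  | neg a _ ha => rw [neg_lie]; exact P.neg_mem ha

theorem tri_same (h : Sys N T) (i : Fin 3) : ∀ x ∈ comp T i, ∀ y ∈ comp T i, ⁅x, y⁆ = 0 := by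
  intro x hx y hy
  have := lie_mem_of (P := ⊥) (S := {x | ∃ n v, T n v ∧ v i = x})
    (S' := {x | ∃ n v, T n v ∧ v i = x}) ?_ x hx y hy
  · simpa using this
  · rintro _ ⟨m, v, hv, rfl⟩ _ ⟨n, w, hw, rfl⟩
    rw [h.same m n v w hv hw]; exact zero_mem _

theorem tri_diff (h : Sys N T) (i : Fin 3) :
    ∀ x ∈ comp T (i+1), ∀ y ∈ comp T (i+2), ⁅x, y⁆ ∈ comp T i := by
  apply lie_mem_of
  rintro _ ⟨m, v, hv, rfl⟩ _ ⟨n, w, hw, rfl⟩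
  exact mem_comp (h.cr m n v w hv hw) i

theorem f1 (i : Fin 3) : i + 1 + 1 = i + 2 := by revert i; decide
theorem f2 (i : Fin 3) : i + 1 + 2 = i := by revert i; decide
theorem f3 (i : Fin 3) : i + 2 + 1 = i := by revert i; decide
theorem f4 (i : Fin 3) : i + 2 + 2 = i + 1 := by revert i; decide

theorem tri (h : Sys N T) (i : Fin 3) : Tri (comp T i) (comp T (i+1)) (comp T (i+2)) where
  aa := h.tri_same _
  bb := h.tri_same _
  cc := h.tri_same _
  ab := by
    have := h.tri_diff (i+2); rwa [f3, f4] at this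
  bc := h.tri_diff i
  ca := by
    have := h.tri_diff (i+1); rwa [f1, f2] at this

theorem h2 (h : Sys N T) : ∀ w : E, w + w = 0 → w = 0 := by
  obtain ⟨k, hk⟩ := h.two
  intro w hw
  rw [← two_mul] at hw
  rw [← one_mul w, ← hk, mul_assoc, hw, mul_zero]

theorem h3 (h : Sys N T) : ∀ w : E, w + w + w = 0 → w = 0 := by
  obtain ⟨k, hk⟩ := h.three
  intro w hw
  rw [← two_mul, ← add_one_mul, two_add_one_eq_three] at hw
  rw [← one_mul w, ← hk, mul_assoc, hw, mul_zero]

theorem nsmul (h : Sys N T) {n : ℕ} {v w : Fin 3 → E} (hv : T n v) (hw : T n w) (β : ℤ)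
    (hβ : β = 1 ∨ β = 2) : T n (v + β • w) := by
  rcases hβ with rfl | rfl
  · rw [one_smul]; exact h.add _ _ _ hv hw
  · rw [two_smul]; exact h.add _ _ _ hv (h.add _ _ _ hw hw)

theorem adNil (h : Sys N T) {n : ℕ} {v : Fin 3 → E} (hv : T n v) (j i : Fin 3) (u : E)
    (hu : u ∈ comp T i) : Tri.itr (v j) (42 * N + 1) u = 0 := by
  have key : ∀ j i : Fin 3, j = i ∨ j = i + 1 ∨ j = i + 2 := by decide
  have w1 : T (n + (n + n)) (fun i => ⁅v (i+1), ⁅v (i+1), v i⁆⁆) := by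
    have := h.cr n _ v _ hv (h.cr' n n v v hv hv)
    simpa only [f3, f4] using this
  have w2 : T (n + (n + n)) (fun i => ⁅v (i+2), ⁅v (i+2), v i⁆⁆) := by
    have := h.cr' n _ v _ hv (h.cr n n v v hv hv)
    simpa only [f1, f2] using this
  rcases key j i with rfl | rfl | rfl
  · rw [Tri.itr_succ', h.tri_same j _ (mem_comp hv j) u hu]
    have : ∀ k, Tri.itr (v j) k 0 = 0 := by
      intro k
      induction k with
      | zero => rfl
      | succ k ih => rw [Tri.itr_succ, ih, lie_zero]
    exact this _
  · refine (h.tri i).stepI h.h2 h.h3 (mem_comp hv _) (mem_comp hv _) (mem_comp hv _) N ?_ ?_ u hu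
    · exact ⟨ad_nil _ _ (h.nil n v hv i), ad_nil _ _ (h.nil' n v hv i)⟩
    · intro β hβ
      have k := h.nsmul w1 w2 β hβ
      have a := ad_nil _ _ (h.nil _ _ k i)
      have b := ad_nil _ _ (h.nil' _ _ k i)
      simp only [Pi.add_apply, Pi.smul_apply, f1, f2, f3, f4] at a b
      exact ⟨a, b⟩
  · refine (h.tri i).swap.stepI h.h2 h.h3 (mem_comp hv _) (mem_comp hv _) (mem_comp hv _) N ?_ ?_ u hu
    · refine ⟨?_, ?_⟩
      · have := ad_nil _ _ (h.nil n v hv i)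
        rwa [add_right_comm] at this
      · have := ad_nil _ _ (h.nil' n v hv (i+1))
        rwa [f1, f2, sub_right_comm] at this
    · intro β hβ
      have k := h.nsmul w2 w1 β hβ
      have a := ad_nil _ _ (h.nil _ _ k i)
      have b := ad_nil _ _ (h.nil' _ _ k (i+1))
      rw [add_right_comm] at a
      rw [sub_right_comm] at b
      simp only [Pi.add_apply, Pi.smul_apply, f1, f2, f3, f4] at a b
      exact ⟨a, b⟩

end Sys
end FrobTwelve


namespace FrobTwelve

/-- pigeonhole for words in commuting letters -/
theorem pig {R Λ : Type*} [Monoid R] [Fintype Λ] [DecidableEq Λ] (f : Λ → R) (l : List Λ)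
    (hc : ∀ a ∈ l, ∀ b ∈ l, Commute (f a) (f b))
    (M : ℕ) (hl : Fintype.card Λ * M < l.length) :
    ∃ a ∈ l, ∃ r : R, (l.map f).prod = r * f a ^ M := by
  have h1 : ∃ a, M < l.count a := by
    by_contra hcon
    push Not at hcon
    have h2 : l.length = ∑ a : Λ, l.count a := by
      have := Multiset.sum_count_eq_card (s := Finset.univ) (m := (l : Multiset Λ)) (by simp)
      simpa using this.symm
    have h3 : ∑ a : Λ, l.count a ≤ ∑ _a : Λ, M := Finset.sum_le_sum fun a _ => hcon a
    simp at h3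
    omega
  obtain ⟨a, ha⟩ := h1
  have hal : a ∈ l := List.count_pos_iff.mp (by omega)
  refine ⟨a, hal, ((l.filter (fun b => !decide (b = a))).map f).prod * f a ^ (l.count a - M), ?_⟩
  have hp : (l.filter (fun b => !decide (b = a)) ++ l.filter (fun b => decide (b = a))).Perm l :=
    List.perm_append_comm.trans (List.filter_append_perm (fun b => decide (b = a)) l)
  have h2 : (l.map f).prod = ((l.filter (fun b => !decide (b = a)) ++
      l.filter (fun b => decide (b = a))).map f).prod := by
    apply List.Perm.prod_eq' (hp.symm.map f)
    apply List.Pairwise.map f (R := fun a b => Commute (f a) (f b)) (fun _ _ h => h)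
    exact List.pairwise_of_forall_mem_list (fun a ha b hb => hc a ha b hb)
  rw [h2, List.map_append, List.prod_append, mul_assoc, ← pow_add]
  congr 1
  have h4 : l.filter (fun b => decide (b = a)) = List.replicate (l.count a) a := by
    have := List.filter_eq (l := l) a
    simpa [eq_comm] using this
  rw [h4, List.map_replicate, List.prod_replicate]
  congr 1
  omega

section
variable {L : Type} [LieRing L] {Q : Type}

/-- apply a word of ads, head first -/
def act (t : Q → L) : List Q → L → L
  | [], u => u
  | q :: l, u => act t l ⁅t q, u⁆

theorem act_append (t : Q → L) (l l' : List Q) (u : L) : act t (l ++ l') u = act t l' (act t l u) := by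
  induction l generalizing u with
  | nil => rfl
  | cons q l ih => exact ih _

theorem act_zero (t : Q → L) (l : List Q) : act t l 0 = 0 := by
  induction l with
  | nil => rfl
  | cons q l ih => rw [act, lie_zero, ih]

/-- ad as an endofunction -/
def adE (a : L) : Function.End L := fun w => ⁅a, w⁆

theorem act_eq (t : Q → L) (l : List Q) (u : L) :
    act t l u = ((l.reverse.map (fun q => adE (t q))).prod) u := by
  induction l generalizing u with
  | nil => rfl
  | cons q l ih => 
    rw [act, ih]
    simp only [List.reverse_cons, List.map_append, List.map_cons, List.map_nil, List.prod_append,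
      List.prod_cons, List.prod_nil, mul_one]
    rfl

theorem end_pow (a : L) (k : ℕ) (u : L) : (adE a ^ k) u = Tri.itr a k u := by
  induction k with
  | zero => rfl
  | succ k ih => rw [Tri.itr_succ, ← ih, pow_succ']; rfl

variable {A : Fin 3 → AddSubgroup L} (hA : ∀ i, Tri (A i) (A (i+1)) (A (i+2)))
  {t : Q → L} {ty : Q → Fin 3} (hty : ∀ q, t q ∈ A (ty q))
  {M : ℕ} (hM : ∀ q i, ∀ u ∈ A i, Tri.itr (t q) M u = 0)

include hA hty in
theorem run_mem {i : Fin 3} (l : List Q) (hl : ∀ q ∈ l, ty q = i) (w : L)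
    (hw : w ∈ A (i+1) ∨ w ∈ A (i+2)) : act t l w ∈ A (i+1) ∨ act t l w ∈ A (i+2) := by
  induction l generalizing w with
  | nil => exact hw
  | cons q l ih =>
    refine ih (fun q' hq' => hl q' (by simp [hq'])) _ ?_
    have hq : t q ∈ A i := by rw [← hl q (by simp)]; exact hty q
    rcases hw with hw | hw
    · right; exact (hA i).ab _ hq _ hw
    · left; exact (hA i).ac _ hq _ hw

include hA hty in
theorem run_lie {i : Fin 3} (l : List Q) (hl : ∀ q ∈ l, ty q = i) (v u : L) (hu : u ∈ A i) :
    act t l ⁅v, u⁆ = ⁅act t l v, u⁆ := by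
  induction l generalizing v with
  | nil => rfl
  | cons q l ih =>
    have hq : t q ∈ A i := by rw [← hl q (by simp)]; exact hty q
    rw [act, act, ← ih (fun q' hq' => hl q' (by simp [hq'])), (hA i).l4 hq hu]

include hA hty hM in
theorem run_zero [Fintype Q] [DecidableEq Q] {i j : Fin 3} (l : List Q) (hl : ∀ q ∈ l, ty q = i)
    (hlen : Fintype.card Q * M < l.length) (w : L) (hw : w ∈ A j) : act t l w = 0 := by
  rw [act_eq]
  obtain ⟨a, ha, r, hr⟩ := pig (fun q => adE (t q)) l.reverse (by
      intro a ha b hb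
      have h1 : t a ∈ A i := by rw [← hl a (by simpa using ha)]; exact hty a
      have h2 : t b ∈ A i := by rw [← hl b (by simpa using hb)]; exact hty b
      funext u
      exact (hA i).comm h1 h2 u) M (by simpa using hlen)
  have hz : act t l 0 = 0 := act_zero t l
  rw [act_eq, hr] at hz
  rw [hr]
  have e1 : (r * adE (t a) ^ M) w = r (Tri.itr (t a) M w) := by
    rw [← end_pow]; rfl
  have e2 : (r * adE (t a) ^ M) 0 = r (Tri.itr (t a) M 0) := by
    rw [← end_pow]; rfl
  rw [e1, hM a j w hw]
  rw [e2, hM a j 0 (A j).zero_mem] at hz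
  exact hz

/-- operators of loop type on `A i` -/
def IsOp (A : Fin 3 → AddSubgroup L) (M : ℕ) (i : Fin 3) (F : Function.End (A i)) : Prop :=
  ∃ k, (k = i + 1 ∨ k = i + 2) ∧ ∃ a ∈ A k, ∃ b ∈ A k, (∀ j, ∀ u ∈ A j, Tri.itr a M u = 0) ∧
    ∀ u : A i, (F u : L) = ⁅a, ⁅b, (u : L)⁆⁆

include hA in
theorem IsOp.comm {i : Fin 3} {F F' : Function.End (A i)} (h : IsOp A M i F) (h' : IsOp A M i F') :
    Commute F F' := by
  obtain ⟨k, hk, a, ha, b, hb, -, hF⟩ := h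
  obtain ⟨k', hk', a', ha', b', hb', -, hF'⟩ := h'
  funext u
  change F (F' u) = F' (F u)
  ext
  rw [hF, hF', hF', hF]
  rcases hk with rfl | rfl <;> rcases hk' with rfl | rfl
  · have := (hA i).rot
    rw [this.comm hb ha', this.comm hb hb', this.comm ha ha', this.comm ha hb']
  · exact (hA i).l2 ha hb ha' hb' u.2
  · exact ((hA i).l2 ha' hb' ha hb u.2).symm
  · have := (hA i).rot.rot
    rw [this.comm hb ha', this.comm hb hb', this.comm ha ha', this.comm ha hb']

include hA in
theorem IsOp.pow {i : Fin 3} {F : Function.End (A i)} (h : IsOp A M i F) (u : A i) :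
    (F ^ M) u = 0 := by
  obtain ⟨k, hk, a, ha, b, hb, hn, hF⟩ := h
  have hab : ∀ w, ⁅a, ⁅b, w⁆⁆ = ⁅b, ⁅a, w⁆⁆ := fun w => (hA k).comm ha hb w
  have hab' : ∀ m w, ⁅b, Tri.itr a m w⁆ = Tri.itr a m ⁅b, w⁆ := fun m w => (hA k).itr_comm ha hb m w
  have key : ∀ m, ((F ^ m) u : L) = Tri.itr b m (Tri.itr a m u) := by
    intro m
    induction m with
    | zero => rfl
    | succ m ih =>
      rw [pow_succ']
      change ((F ((F ^ m) u) : A i) : L) = _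
      rw [hF, ih, hab, (hA k).itr_comm hb ha, ← Tri.itr_succ, ← Tri.itr_succ]
  ext
  rw [key, hn i u u.2]
  have : ∀ k, Tri.itr b k 0 = 0 := by
      intro k
      induction k with
      | zero => rfl
      | succ k ih => rw [Tri.itr_succ, ih, lie_zero]
  exact this _

open Classical in
/-- the loop as an operator -/
noncomputable def lp (A : Fin 3 → AddSubgroup L) (t : Q → L) (i : Fin 3)
    (p : Q × List Q × Q) : Function.End (A i) :=
  fun u => if h : ⁅t p.2.2, act t p.2.1 ⁅t p.1, (u : L)⁆⁆ ∈ A i then ⟨_, h⟩ else 0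

include hA hty hM in
theorem lp_spec {i : Fin 3} (p : Q × List Q × Q) (hl : ∀ q ∈ p.2.1, ty q = i) (h2 : ty p.2.2 ≠ i) :
    IsOp A M i (lp A t i p) ∧
      ∀ u : A i, (lp A t i p u : L) = ⁅t p.2.2, act t p.2.1 ⁅t p.1, (u : L)⁆⁆ := by
  obtain ⟨q1, l, q2⟩ := p
  simp only at hl h2 ⊢
  have hi0 : ∀ j, ∀ u ∈ A j, Tri.itr (0:L) M u = 0 ∨ True := fun _ _ _ => Or.inr trivial
  suffices hs : ∃ k, (k = i + 1 ∨ k = i + 2) ∧ ∃ a ∈ A k, ∃ b ∈ A k,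
      (∀ j, ∀ u ∈ A j, Tri.itr a M u = 0) ∧
      ∀ u : A i, ⁅t q2, act t l ⁅t q1, (u : L)⁆⁆ = ⁅a, ⁅b, (u : L)⁆⁆ by
    obtain ⟨k, hk, a, ha, b, hb, hn, hF⟩ := hs
    have mem : ∀ u : A i, ⁅t q2, act t l ⁅t q1, (u : L)⁆⁆ ∈ A i := by
      intro u
      rw [hF]
      rcases hk with rfl | rfl
      · exact (hA i).bc _ ha _ ((hA i).ba _ hb _ u.2)
      · exact (hA i).cb _ ha _ ((hA i).ca _ hb _ u.2)
    have e : ∀ u : A i, (lp A t i (q1, l, q2) u : L) = ⁅t q2, act t l ⁅t q1, (u : L)⁆⁆ := by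
      intro u
      simp only [lp]
      rw [dif_pos (mem u)]
    exact ⟨⟨k, hk, a, ha, b, hb, hn, fun u => by rw [e, hF]⟩, e⟩
  have key : ∀ j i : Fin 3, j = i ∨ j = i + 1 ∨ j = i + 2 := by decide
  have h2' : ty q2 = i + 1 ∨ ty q2 = i + 2 := by
    rcases key (ty q2) i with h | h | h
    · exact absurd h h2
    · exact Or.inl h
    · exact Or.inr h
  have hv : ∀ u : A i, ⁅t q2, act t l ⁅t q1, (u : L)⁆⁆ = ⁅t q2, ⁅act t l (t q1), (u : L)⁆⁆ := by
    intro u; rw [run_lie hA hty l hl _ _ u.2]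
  have hq2 := hty q2
  rcases key (ty q1) i with h | h | h
  · refine ⟨ty q2, h2', t q2, hq2, 0, (A _).zero_mem, hM q2, fun u => ?_⟩
    rw [(hA i).aa (t q1) (h ▸ hty q1) u u.2, act_zero, zero_lie]
  all_goals
    have h1 : t q1 ∈ A (i+1) ∨ t q1 ∈ A (i+2) := by
      have := hty q1
      rw [h] at this
      first | exact Or.inl this | exact Or.inr this
    have hm := run_mem hA hty l hl (t q1) h1
    rcases h2' with h2' | h2' <;> rcases hm with hm | hm <;> rw [h2'] at hq2
    · exact ⟨_, Or.inl rfl, t q2, hq2, _, hm, hM q2, hv⟩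
    · refine ⟨_, Or.inl rfl, t q2, hq2, 0, (A _).zero_mem, hM q2, fun u => ?_⟩
      rw [hv, (hA i).bb _ hq2 _ ((hA i).ca _ hm _ u.2), zero_lie, lie_zero]
    · refine ⟨_, Or.inr rfl, t q2, hq2, 0, (A _).zero_mem, hM q2, fun u => ?_⟩
      rw [hv, (hA i).cc _ hq2 _ ((hA i).ba _ hm _ u.2), zero_lie, lie_zero]
    · exact ⟨_, Or.inr rfl, t q2, hq2, _, hm, hM q2, hv⟩

/-- finite alphabet of loops -/
abbrev Loop (Q : Type) (c : ℕ) : Type := Q × {l : List Q // l.length < c} × Q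

instance loopFinite (Q : Type) [Finite Q] (c : ℕ) : Finite (Loop Q c) := by
  have : Finite {l : List Q // l.length < c} := (List.finite_length_lt Q c).to_subtype
  infer_instance

include hA hty hM in
theorem decomp [Fintype Q] [DecidableEq Q] {i : Fin 3} (k : ℕ) (W : List Q)
    (hW : k * (Fintype.card Q * M + 3) ≤ W.length) (u : A i) :
    act t W u = 0 ∨ ∃ (ls : List (Loop Q (Fintype.card Q * M + 1))) (W' : List Q), ls.length = k ∧
      (∀ p ∈ ls, IsOp A M i (lp A t i (p.1, p.2.1.1, p.2.2))) ∧
      act t W u = act t W'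
        ((((ls.map (fun p => lp A t i (p.1, p.2.1.1, p.2.2))).prod : Function.End (A i)) u : A i) : L) := by
  induction k generalizing W u with
  | zero => right; exact ⟨[], W, rfl, by simp, rfl⟩
  | succ k ih =>
    rcases W with _ | ⟨q1, W⟩
    · simp at hW
    set l := W.takeWhile (fun q => decide (ty q = i)) with hl
    set r := W.dropWhile (fun q => decide (ty q = i)) with hr
    have hlr : W = l ++ r := List.takeWhile_append_dropWhile.symm
    have hlt : ∀ q ∈ l, ty q = i := fun q hq => by simpa using List.mem_takeWhile_imp hq
    have hact : act t (q1 :: W) u = act t r (act t l ⁅t q1, (u:L)⁆) := by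
      rw [act]; conv_lhs => rw [hlr]
      rw [act_append]
    by_cases hlen : Fintype.card Q * M < l.length
    · left
      have key : ∀ j i : Fin 3, j = i ∨ j = i + 1 ∨ j = i + 2 := by decide
      rw [hact]
      have : ⁅t q1, (u:L)⁆ ∈ A (i + 1) ∨ ⁅t q1, (u:L)⁆ ∈ A (i+2) := by
        have hq := hty q1
        rcases key (ty q1) i with h | h | h <;> rw [h] at hq
        · rw [(hA i).aa _ hq _ u.2]; exact Or.inl (A _).zero_mem
        · exact Or.inr ((hA i).ba _ hq _ u.2)
        · exact Or.inl ((hA i).ca _ hq _ u.2)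
      rcases this with h | h <;> rw [run_zero hA hty hM l hlt hlen _ h, act_zero]
    · have hlen' : l.length + r.length = W.length := by
        conv_rhs => rw [hlr]
        simp
      simp only [List.length_cons] at hW
      have hr1 : k * (Fintype.card Q * M + 3) + 1 ≤ r.length := by
        have : (k+1) * (Fintype.card Q * M + 3) = k * (Fintype.card Q * M + 3) + Fintype.card Q * M + 3 := by ring
        omega
      rcases hr' : r with _ | ⟨q2, W2⟩
      · rw [hr'] at hr1; simp at hr1
      have h2 : ty q2 ≠ i := by
        have : r ≠ [] := by rw [hr']; simp
        have h3 := List.head_dropWhile_not (fun q => decide (ty q = i)) this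
        simp only [← hr, hr', List.head_cons] at h3
        simpa using h3
      obtain ⟨hop, hval⟩ := lp_spec hA hty hM (q1, l, q2) hlt h2
      have e : act t (q1 :: W) u = act t W2 (lp A t i (q1, l, q2) u) := by
        rw [hact, hr', act, hval]
      rw [hr'] at hr1
      simp only [List.length_cons] at hr1
      rcases ih W2 (by omega) (lp A t i (q1, l, q2) u) with h | ⟨ls, W', h1, h3, h4⟩
      · left; rw [e, h]
      · right
        refine ⟨ls ++ [(q1, ⟨l, by omega⟩, q2)], W', by simp [h1], ?_, ?_⟩
        · intro p hp
          rcases List.mem_append.mp hp with hp | hp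
          · exact h3 p hp
          · simp at hp; subst hp; exact hop
        · rw [e, h4, List.map_append, List.prod_append]
          simp only [List.map_cons, List.map_nil, List.prod_cons, List.prod_nil, mul_one]
          rfl

/-- length bound for nonzero words -/
noncomputable def wb (Q : Type) [Fintype Q] (M : ℕ) : ℕ :=
  (Nat.card (Loop Q (Fintype.card Q * M + 1)) * M + 1) * (Fintype.card Q * M + 3)

include hA hty hM in
theorem words_vanish [Fintype Q] [DecidableEq Q] {i : Fin 3} (W : List Q) (hW : wb Q M ≤ W.length)
    (u : L) (hu : u ∈ A i) : act t W u = 0 := by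
  classical
  rcases decomp hA hty hM _ W hW ⟨u, hu⟩ with h | ⟨ls, W', h1, h2, h3⟩
  · exact h
  · let _ : Fintype (Loop Q (Fintype.card Q * M + 1)) := Fintype.ofFinite _
    have hz : ∀ F : Function.End (A i), IsOp A M i F → F 0 = 0 := by
      rintro F ⟨k, hk, a, ha, b, hb, hn, hF⟩
      ext; rw [hF]; simp
    obtain ⟨a, ha, r, hr⟩ := pig (fun p : Loop Q (Fintype.card Q * M + 1) =>
      lp A t i (p.1, p.2.1.1, p.2.2)) ls (fun a ha b hb => (h2 a ha).comm hA (h2 b hb)) M (by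
        rw [h1, Nat.card_eq_fintype_card]; omega)
    have hz2 : ∀ ls : List (Loop Q (Fintype.card Q * M + 1)),
        (∀ p ∈ ls, IsOp A M i (lp A t i (p.1, p.2.1.1, p.2.2))) →
        ((ls.map (fun p => lp A t i (p.1, p.2.1.1, p.2.2))).prod : Function.End (A i)) 0 = 0 := by
      intro ls
      induction ls with
      | nil => intro _; rfl
      | cons p ls ih =>
        intro h
        rw [List.map_cons, List.prod_cons]
        change lp A t i _ _ = 0
        rw [ih (fun p hp => h p (by simp [hp]))]
        exact hz _ (h p (by simp))
    have hz3 := hz2 ls h2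
    rw [hr] at hz3
    rw [h3, hr]
    have e : ∀ w : A i, (r * lp A t i (a.1, a.2.1.1, a.2.2) ^ M) w = r 0 := by
      intro w
      change r ((lp A t i (a.1, a.2.1.1, a.2.2) ^ M) w) = r 0
      rw [(h2 a ha).pow hA]
    rw [e] at hz3 ⊢
    rw [hz3]
    exact act_zero t W'

end
end FrobTwelve


attribute [local instance] LieRing.ofAssociativeRing

namespace FrobTwelve

/-- iterated triple products of the generating triples -/
def triW {E : Type} [Ring E] (t : Fin 3 → Fin 3 → E) : List (Fin 3 × Bool) → Fin 3 → Fin 3 → E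
  | [], j0, i => t j0 i
  | (j, true) :: W, j0, i => ⁅t j (i+1), triW t W j0 (i+2)⁆
  | (j, false) :: W, j0, i => ⁅t j (i+2), triW t W j0 (i+1)⁆

theorem triW_map {E E' : Type} [Ring E] [Ring E'] (f : E →+* E') (t : Fin 3 → Fin 3 → E)
    (W : List (Fin 3 × Bool)) (j0 i : Fin 3) :
    triW (fun j i => f (t j i)) W j0 i = f (triW t W j0 i) := by
  induction W generalizing i with
  | nil => rfl
  | cons a W ih =>
    obtain ⟨j, b⟩ := a
    cases b <;> simp [triW, ih, Ring.lie_def]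

theorem triW_T {E : Type} [Ring E] {N : ℕ} {T : ℕ → (Fin 3 → E) → Prop} (h : Sys N T)
    {t : Fin 3 → Fin 3 → E} (ht : ∀ j, T 1 (t j)) (W : List (Fin 3 × Bool)) (j0 : Fin 3) :
    ∃ n, T n (triW t W j0) := by
  induction W with
  | nil => exact ⟨1, ht j0⟩
  | cons a W ih =>
    obtain ⟨j, b⟩ := a
    obtain ⟨n, hn⟩ := ih
    cases b
    · exact ⟨_, h.cr' 1 n _ _ (ht j) hn⟩
    · exact ⟨_, h.cr 1 n _ _ (ht j) hn⟩

theorem triW_act {E : Type} [Ring E] (t : Fin 3 → Fin 3 → E) (W : List (Fin 3 × Bool))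
    (j0 i : Fin 3) : ∃ (l : List (Fin 3 × Fin 3)) (i' : Fin 3), l.length = W.length ∧
      triW t W j0 i = act (fun q : Fin 3 × Fin 3 => t q.1 q.2) l (t j0 i') := by
  induction W generalizing i with
  | nil => exact ⟨[], i, rfl, rfl⟩
  | cons a W ih =>
    obtain ⟨j, b⟩ := a
    cases b
    · obtain ⟨l, i', h1, h2⟩ := ih (i+1)
      refine ⟨l ++ [(j, i+2)], i', by simp [h1], ?_⟩
      rw [act_append, triW, h2]; rfl
    · obtain ⟨l, i', h1, h2⟩ := ih (i+2)
      refine ⟨l ++ [(j, i+1)], i', by simp [h1], ?_⟩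
      rw [act_append, triW, h2]; rfl

theorem mul_blocks {E Q : Type} [Ring E] (g : Q → E) (v : E) (hv : ∀ x, v * x = x * v) (k : ℕ)
    (h : ∀ l : List Q, l.length = k → ∃ x, (l.map g).prod = x * v) (n : ℕ) :
    ∀ l : List Q, l.length = k * n → ∃ x, (l.map g).prod = x * v ^ n := by
  induction n with
  | zero => intro l _; exact ⟨_, by rw [pow_zero, mul_one]⟩
  | succ n ih =>
    intro l hl
    obtain ⟨x, hx⟩ := h (l.take k) (by rw [List.length_take, hl, mul_add, mul_one]; omega)
    obtain ⟨y, hy⟩ := ih (l.drop k) (by rw [List.length_drop, hl, mul_add, mul_one]; omega)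
    refine ⟨x * y, ?_⟩
    rw [← List.take_append_drop k l, List.map_append, List.prod_append, hx, hy, pow_succ']
    rw [mul_assoc, ← mul_assoc v, hv y, mul_assoc, mul_assoc]

theorem stepIII (N : ℕ) (n : ℕ) : ∀ (E : Type) [Ring E] (t : Fin 3 → Fin 3 → E)
    (𝒲 : Finset (List (Fin 3 × Bool) × Fin 3 × Fin 3)), 𝒲.card = n →
    Subring.closure {x | ∃ j i, t j i = x} = ⊤ →
    (∃ k : ℕ, (k : E) * 2 = 1) →
    (∀ W j j0 i, ⁅t j i, triW t W j0 i⁆ = 0) →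
    (∀ W j0 i, (triW t W j0 i + triW t W j0 (i+1) + triW t W j0 (i+2)) ^ N = 0) →
    (∀ W j0 i, (triW t W j0 (i+1) - triW t W j0 i - triW t W j0 (i+2)) ^ N = 0) →
    (∀ W j0 i, (W, j0, i) ∉ 𝒲 → triW t W j0 i = 0) →
    ∀ l : List (Fin 3 × Fin 3), l.length = (2*N)^n →
      (l.map (fun q : Fin 3 × Fin 3 => t q.1 q.2)).prod = 0 := by
  induction n with
  | zero =>
    intro E _ t 𝒲 hc hgen htwo hsame hnil hnil' hz l hl
    rw [Finset.card_eq_zero] at hc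
    subst hc
    rw [pow_zero] at hl
    obtain ⟨q, rfl⟩ := List.length_eq_one_iff.mp hl
    simp only [List.map_cons, List.map_nil, List.prod_cons, List.prod_nil, mul_one]
    exact hz [] q.1 q.2 (by simp)
  | succ n ih =>
    intro E _ t 𝒲 hc hgen htwo hsame hnil hnil' hz l hl
    have hne : 𝒲.Nonempty := by rw [← Finset.card_pos]; omega
    obtain ⟨⟨W, j0, i⟩, hw, hmax⟩ := Finset.exists_max_image 𝒲 (fun p => p.1.length) hne
    set v := triW t W j0 i with hv
    have hlong : ∀ a i', triW t (a :: W) j0 i' = 0 := by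
      intro a i'
      apply hz
      intro hmem
      have := hmax _ hmem
      simp at this
    have hcg : ∀ j i', ⁅t j i', v⁆ = 0 := by
      intro j i'
      have key : ∀ i' i : Fin 3, i' = i ∨ i' = i + 1 ∨ i' = i + 2 := by decide
      rcases key i' i with rfl | rfl | rfl
      · exact hsame W j j0 i'
      · have := hlong (j, false) (i+2)
        rwa [triW, Sys.f4, Sys.f3] at this
      · have := hlong (j, true) (i+1)
        rwa [triW, Sys.f1, Sys.f2] at this
    have hcen : ∀ x, v * x = x * v := by
      intro x
      have hx : x ∈ Subring.closure {x | ∃ j i, t j i = x} := by rw [hgen]; trivial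
      induction hx using Subring.closure_induction with
      | mem x hx =>
        obtain ⟨j, i', rfl⟩ := hx
        have := hcg j i'
        rw [Ring.lie_def] at this
        exact (sub_eq_zero.mp this).symm
      | zero => simp
      | one => simp
      | add a b _ _ ha hb => rw [mul_add, add_mul, ha, hb]
      | neg a _ ha => rw [mul_neg, neg_mul, ha]
      | mul a b _ _ ha hb => rw [← mul_assoc, ha, mul_assoc, hb, mul_assoc]
    have hvn : v ^ (2 * N) = 0 := by
      obtain ⟨k, hk⟩ := htwo
      set s := triW t W j0 i + triW t W j0 (i+1) + triW t W j0 (i+2) with hs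
      have h1 : s ^ N = 0 := hnil W j0 i
      have h2 : (2 * v - s) ^ N = 0 := by
        have := hnil' W j0 (i+2)
        rw [Sys.f3, Sys.f4] at this
        rw [← this]; congr 1; rw [hs, two_mul]; abel
      have hcom : Commute s (2 * v - s) := by
        refine Commute.sub_right ?_ (Commute.refl s)
        exact ((Nat.cast_commute 2 s).symm).mul_right (hcen s).symm
      have h3 : (2 * v) ^ (2 * N) = 0 := by
        have := hcom.add_pow_eq_zero_of_add_le_succ_of_pow_eq_zero (k := 2 * N) h1 h2 (by omega)
        rwa [add_sub_cancel] at this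
      have h4 : v = (k : E) * (2 * v) := by rw [← mul_assoc, hk, one_mul]
      have h5 : Commute (k : E) (2 * v) := Nat.cast_commute _ _
      rw [h4, h5.mul_pow, h3, mul_zero]
    let I : Ideal E := Ideal.span {v}
    have hI : ∀ x, x ∈ I ↔ ∃ y, y * v = x := fun x => Ideal.mem_span_singleton'
    have : I.IsTwoSided := ⟨by
      intro a b ha
      obtain ⟨y, rfl⟩ := (hI a).mp ha
      rw [hI]
      exact ⟨y * b, by rw [mul_assoc, mul_assoc, hcen]⟩⟩
    let f : E →+* E ⧸ I := Ideal.Quotient.mk I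
    have hf : Function.Surjective f := Ideal.Quotient.mk_surjective
    have hfv : f v = 0 := by
      rw [Ideal.Quotient.eq_zero_iff_mem, hI]; exact ⟨1, one_mul v⟩
    have hl2 : ∀ l : List (Fin 3 × Fin 3), l.length = (2*N)^n →
        ∃ x, (l.map (fun q : Fin 3 × Fin 3 => t q.1 q.2)).prod = x * v := by
      intro l hl
      have := ih (E ⧸ I) (fun j i => f (t j i)) (𝒲.erase (W, j0, i))
        (by rw [Finset.card_erase_of_mem hw]; omega) ?_ ?_ ?_ ?_ ?_ ?_ l hl
      · have e : (l.map (fun q : Fin 3 × Fin 3 => f (t q.1 q.2))).prod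
            = f (l.map (fun q : Fin 3 × Fin 3 => t q.1 q.2)).prod := by
          rw [map_list_prod, List.map_map]; rfl
        rw [e, Ideal.Quotient.eq_zero_iff_mem, hI] at this
        obtain ⟨y, hy⟩ := this
        exact ⟨y, hy.symm⟩
      · have := congrArg (Subring.map f) hgen
        rw [RingHom.map_closure, ← RingHom.range_eq_map, RingHom.range_eq_top.mpr hf] at this
        rw [← this]
        congr 1
        ext x
        constructor
        · rintro ⟨j, i, rfl⟩; exact ⟨_, ⟨j, i, rfl⟩, rfl⟩
        · rintro ⟨_, ⟨j, i, rfl⟩, rfl⟩; exact ⟨j, i, rfl⟩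
      · obtain ⟨k, hk⟩ := htwo
        refine ⟨k, ?_⟩
        have := congrArg f hk
        rw [map_mul, map_natCast, map_ofNat, map_one] at this
        exact this
      · intro W j j0 i
        rw [triW_map, Ring.lie_def, ← map_mul, ← map_mul, ← map_sub, ← Ring.lie_def, hsame, map_zero]
      · intro W j0 i
        rw [triW_map, triW_map, triW_map, ← map_add, ← map_add, ← map_pow, hnil, map_zero]
      · intro W j0 i
        rw [triW_map, triW_map, triW_map, ← map_sub, ← map_sub, ← map_pow, hnil', map_zero]
      · intro W' j0' i' hn
        rw [triW_map]
        by_cases he : (W', j0', i') = (W, j0, i)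
        · simp only [Prod.mk.injEq] at he
          obtain ⟨rfl, rfl, rfl⟩ := he
          exact hfv
        · rw [hz W' j0' i' (fun hmem => hn (Finset.mem_erase.mpr ⟨he, hmem⟩)), map_zero]
    obtain ⟨x, hx⟩ := mul_blocks _ v hcen _ hl2 (2*N) l (by rw [hl, pow_succ])
    rw [hx, hvn, mul_zero]

theorem wordsFinite (c : ℕ) :
    {p : List (Fin 3 × Bool) × Fin 3 × Fin 3 | p.1.length < c}.Finite := by
  have h1 : {l : List (Fin 3 × Bool) | l.length < c}.Finite := List.finite_length_lt _ c
  refine (h1.prod (Set.finite_univ (α := Fin 3 × Fin 3))).subset ?_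
  rintro ⟨l, q⟩ h
  exact ⟨h, trivial⟩

/-- the bound for the nilpotency of the associative envelope -/
noncomputable def bigK (N : ℕ) : ℕ :=
  (2*N)^(wordsFinite (wb (Fin 3 × Fin 3) (42 * N + 1))).toFinset.card

theorem abstract_main (N : ℕ) (E : Type) [Ring E] (T : ℕ → (Fin 3 → E) → Prop) (h : Sys N T)
    (t : Fin 3 → Fin 3 → E) (ht : ∀ j, T 1 (t j)) (l : List (Fin 3 × Fin 3))
    (hl : l.length = bigK N) : (l.map (fun q : Fin 3 × Fin 3 => t q.1 q.2)).prod = 0 := by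
  set c := wb (Fin 3 × Fin 3) (42 * N + 1) with hc
  have hvan : ∀ W j0 i, c ≤ W.length → triW t W j0 i = 0 := by
    intro W j0 i hW
    obtain ⟨l, i', h1, h2⟩ := triW_act t W j0 i
    rw [h2]
    exact words_vanish (A := Sys.comp T) h.tri (t := fun q : Fin 3 × Fin 3 => t q.1 q.2)
      (ty := fun q => q.2) (fun q => Sys.mem_comp (ht q.1) q.2) (M := 42 * N + 1)
      (fun q i u hu => h.adNil (ht q.1) q.2 i u hu) l (by rw [h1]; exact hW) _
      (Sys.mem_comp (ht j0) i')
  let S := Subring.closure {x | ∃ j i, t j i = x}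
  let t' : Fin 3 → Fin 3 → S := fun j i => ⟨t j i, Subring.subset_closure ⟨j, i, rfl⟩⟩
  have hinj : Function.Injective S.subtype := Subtype.val_injective
  have htri : ∀ W j0 i, S.subtype (triW t' W j0 i) = triW t W j0 i := fun W j0 i =>
    (triW_map S.subtype t' W j0 i).symm
  have := stepIII N _ S t' (wordsFinite c).toFinset rfl ?_ ?_ ?_ ?_ ?_ ?_ l hl
  · have h2 := congrArg S.subtype this
    rw [map_list_prod, List.map_map, map_zero] at h2
    exact h2
  · have key : Function.Injective (Subring.map S.subtype) := by
      intro A B hAB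
      have := congrArg (Subring.comap S.subtype) hAB
      rwa [Subring.comap_map_eq_self_of_injective hinj,
        Subring.comap_map_eq_self_of_injective hinj] at this
    apply key
    rw [RingHom.map_closure, ← RingHom.range_eq_map, Subring.range_subtype]
    change _ = Subring.closure _
    congr 1
    ext x
    constructor
    · rintro ⟨_, ⟨j, i, rfl⟩, rfl⟩; exact ⟨j, i, rfl⟩
    · rintro ⟨j, i, rfl⟩; exact ⟨_, ⟨j, i, rfl⟩, rfl⟩
  · obtain ⟨k, hk⟩ := h.two
    refine ⟨k, hinj ?_⟩
    rw [map_mul, map_natCast, map_ofNat, map_one]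
    exact hk
  · intro W j j0 i
    apply hinj
    obtain ⟨n, hn⟩ := triW_T h ht W j0
    have := h.same 1 n _ _ (ht j) hn i
    rw [Ring.lie_def] at this ⊢
    rw [map_sub, map_mul, map_mul, htri, map_zero]
    exact this
  · intro W j0 i
    apply hinj
    obtain ⟨n, hn⟩ := triW_T h ht W j0
    rw [map_pow, map_add, map_add, htri, htri, htri, map_zero]
    exact h.nil n _ hn i
  · intro W j0 i
    apply hinj
    obtain ⟨n, hn⟩ := triW_T h ht W j0
    rw [map_pow, map_sub, map_sub, htri, htri, htri, map_zero]
    exact h.nil' n _ hn i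
  · intro W j0 i hn
    apply hinj
    rw [htri, map_zero]
    apply hvan
    simpa using hn

end FrobTwelve


namespace FrobTwelve

open Polynomial in
theorem exists_gr (R : Type) [Ring R] (A : ℕ → AddSubgroup R) (h1 : (1 : R) ∈ A 0)
    (hmul : ∀ m n x y, x ∈ A m → y ∈ A n → x * y ∈ A (m + n)) :
    ∃ (E : Type) (_ : Ring E) (μ : ℕ → R → E),
      (∀ n x y, x ∈ A n → y ∈ A n → μ n (x + y) = μ n x + μ n y) ∧
      (∀ m n x y, x ∈ A m → y ∈ A n → μ (m + n) (x * y) = μ m x * μ n y) ∧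
      μ 0 1 = 1 ∧
      (∀ n x, x ∈ A n → (μ n x = 0 ↔ x ∈ A (n + 1))) := by
  let S : Subring R[X] :=
    { carrier := {f | ∀ n, coeff f n ∈ A n}
      mul_mem' := by
        intro a b ha hb n
        rw [coeff_mul]
        refine AddSubgroup.sum_mem _ ?_
        intro q hq
        rw [Finset.HasAntidiagonal.mem_antidiagonal] at hq
        rw [← hq]
        exact hmul _ _ _ _ (ha _) (hb _)
      one_mem' := by
        intro n
        rw [coeff_one]
        split_ifs with h
        · subst h; exact h1
        · exact zero_mem _
      add_mem' := by
        intro a b ha hb n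
        rw [coeff_add]; exact add_mem (ha n) (hb n)
      zero_mem' := by intro n; rw [coeff_zero]; exact zero_mem _
      neg_mem' := by
        intro a ha n
        rw [coeff_neg]; exact neg_mem (ha n) }
  let J : Ideal S :=
    { carrier := {f | ∀ n, coeff f.1 n ∈ A (n + 1)}
      add_mem' := by
        intro a b ha hb n
        change coeff (a.1 + b.1) n ∈ _
        rw [coeff_add]; exact add_mem (ha n) (hb n)
      zero_mem' := by
        intro n
        change coeff (0 : R[X]) n ∈ _
        rw [coeff_zero]; exact zero_mem _
      smul_mem' := by
        intro a b hb n
        change coeff (a.1 * b.1) n ∈ _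
        rw [coeff_mul]
        refine AddSubgroup.sum_mem _ ?_
        intro q hq
        rw [Finset.HasAntidiagonal.mem_antidiagonal] at hq
        rw [← hq, add_assoc]
        exact hmul _ _ _ _ (a.2 _) (hb _) }
  have hmemJ : ∀ f : S, f ∈ J ↔ ∀ n, coeff f.1 n ∈ A (n + 1) := fun f => Iff.rfl
  have : J.IsTwoSided := ⟨by
    intro a b ha n
    change coeff (a.1 * b.1) n ∈ _
    rw [coeff_mul]
    refine AddSubgroup.sum_mem _ ?_
    intro q hq
    rw [Finset.HasAntidiagonal.mem_antidiagonal] at hq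
    have := hmul _ _ _ _ (ha q.1) (b.2 q.2)
    rw [← hq]
    rwa [show q.1 + q.2 + 1 = q.1 + 1 + q.2 by ring]⟩
  have hmon : ∀ n x, x ∈ A n → monomial n x ∈ S := by
    intro n x hx k
    rw [coeff_monomial]
    split_ifs with h
    · subst h; exact hx
    · exact zero_mem _
  classical
  let μ : ℕ → R → S ⧸ J := fun n x =>
    if h : x ∈ A n then Ideal.Quotient.mk J ⟨monomial n x, hmon n x h⟩ else 0
  have hμ : ∀ n x (h : x ∈ A n), μ n x = Ideal.Quotient.mk J ⟨monomial n x, hmon n x h⟩ :=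
    fun n x h => dif_pos h
  refine ⟨S ⧸ J, inferInstance, μ, ?_, ?_, ?_, ?_⟩
  · intro n x y hx hy
    rw [hμ _ _ hx, hμ _ _ hy, hμ _ _ (add_mem hx hy), ← RingHom.map_add]
    congr 1
    apply Subtype.ext
    change _ = monomial n x + monomial n y
    rw [← map_add]
  · intro m n x y hx hy
    rw [hμ _ _ hx, hμ _ _ hy, hμ _ _ (hmul _ _ _ _ hx hy), ← RingHom.map_mul]
    congr 1
    apply Subtype.ext
    change _ = monomial m x * monomial n y
    rw [monomial_mul_monomial]
  · rw [hμ _ _ h1, ← RingHom.map_one (Ideal.Quotient.mk J)]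
    congr 1
  · intro n x hx
    rw [hμ _ _ hx, Ideal.Quotient.eq_zero_iff_mem, hmemJ]
    constructor
    · intro h
      have := h n
      simpa using this
    · intro h k
      change coeff (monomial n x) k ∈ _
      rw [coeff_monomial]
      split_ifs with h'
      · subst h'; exact h
      · exact zero_mem _

end FrobTwelve


attribute [local instance] LieRing.ofAssociativeRing

namespace FrobTwelve

/-- Dimension-type filtration of a `p`-group together with its graded image. -/
structure Fil (p : ℕ) {G : Type} [Group G] {E : Type} [Ring E] (D : ℕ → Subgroup G)
    (lam : ℕ → G → E) : Prop where
  one : D 1 = ⊤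
  inv : ∀ (θ : MulAut G) n x, x ∈ D n → θ x ∈ D n
  anti : ∀ n, D (n + 1) ≤ D n
  mul : ∀ n, 1 ≤ n → ∀ x y, x ∈ D n → y ∈ D n → lam n (x * y) = lam n x + lam n y
  ker : ∀ n x, x ∈ D n → (lam n x = 0 ↔ x ∈ D (n + 1))
  comm : ∀ m n x y, x ∈ D m → y ∈ D n → x * y * x⁻¹ * y⁻¹ ∈ D (m + n) ∧
    ⁅lam m x, lam n y⁆ = lam (m + n) (x * y * x⁻¹ * y⁻¹)
  nil : ∀ n x k, x ∈ D n → x ^ p ^ k = 1 → lam n x ^ p ^ k = 0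
  char : (p : E) = 0
  fin : ∀ (ι : Type) (t : ι → E) (K : ℕ), (∀ x, lam 1 x ∈ AddSubgroup.closure (Set.range t)) →
    (∀ l : List ι, l.length = K → (l.map t).prod = 0) → ∀ (x : G) (k : ℕ), K ≤ p ^ k → x ^ p ^ k = 1

section
variable (p : ℕ) [hp : Fact p.Prime] (G : Type) [Group G]

/-- the augmentation -/
noncomputable def aug : MonoidAlgebra (ZMod p) G →+* ZMod p :=
  (MonoidAlgebra.lift (ZMod p) (ZMod p) G 1).toRingHom

/-- the augmentation ideal -/
noncomputable def augI : Ideal (MonoidAlgebra (ZMod p) G) := RingHom.ker (aug p G)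

instance : (augI p G).IsTwoSided := inferInstanceAs (RingHom.ker (aug p G)).IsTwoSided

/-- `g - 1` -/
noncomputable def del (g : G) : MonoidAlgebra (ZMod p) G := MonoidAlgebra.of (ZMod p) G g - 1

theorem aug_of (g : G) : aug p G (MonoidAlgebra.of (ZMod p) G g) = 1 := by
  simp [aug]

theorem aug_smul (c : ZMod p) (x) : aug p G (c • x) = c * aug p G x := by
  simp [aug]

theorem del_mem (g : G) : del p G g ∈ augI p G := by
  rw [augI, RingHom.mem_ker, del, map_sub, aug_of, map_one, sub_self]

theorem smul_eq_nsmul (c : ZMod p) (x : MonoidAlgebra (ZMod p) G) : c • x = c.val • x := by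
  rw [← Nat.cast_smul_eq_nsmul (ZMod p), ZMod.natCast_zmod_val]

theorem augdecomp (x : MonoidAlgebra (ZMod p) G) :
    x - (aug p G x) • (1 : MonoidAlgebra (ZMod p) G)
      ∈ AddSubgroup.closure (Set.range (del p G)) := by
  induction x using MonoidAlgebra.induction_on with
  | of m =>
    rw [aug_of, one_smul]
    exact AddSubgroup.subset_closure ⟨m, rfl⟩
  | add x y hx hy =>
    rw [map_add, add_smul]
    convert add_mem hx hy using 1
    abel
  | smul r x hx =>
    rw [aug_smul, mul_smul, ← smul_sub, smul_eq_nsmul]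
    exact nsmul_mem hx _

theorem augI_eq (x) (hx : x ∈ augI p G) : x ∈ AddSubgroup.closure (Set.range (del p G)) := by
  have := augdecomp p G x
  rw [augI, RingHom.mem_ker] at hx
  rwa [hx, zero_smul, sub_zero] at this

theorem pow_mul_mem {m n : ℕ} {x y} (hx : x ∈ augI p G ^ m) (hy : y ∈ augI p G ^ n) :
    x * y ∈ augI p G ^ (m + n) := by
  rw [Ideal.IsTwoSided.pow_add]; exact Ideal.mul_mem_mul hx hy

theorem map_del (θ : MulAut G) (g : G) :
    MonoidAlgebra.mapDomainRingHom (ZMod p) (θ : G →* G) (del p G g) = del p G (θ g) := by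
  rw [del, map_sub, map_one, del]
  congr 1
  simp [MonoidAlgebra.mapDomainRingHom_apply]

theorem inv_pow (θ : MulAut G) (n : ℕ) (x) (hx : x ∈ augI p G ^ n) :
    MonoidAlgebra.mapDomainRingHom (ZMod p) (θ : G →* G) x ∈ augI p G ^ n := by
  induction n generalizing x with
  | zero => rw [Submodule.pow_zero, Ideal.one_eq_top]; trivial
  | succ n ih =>
    rw [Ideal.IsTwoSided.pow_succ] at hx
    induction hx using Submodule.mul_induction_on' with
    | mem_mul_mem a ha b hb =>
      rw [map_mul, Ideal.IsTwoSided.pow_succ]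
      refine Ideal.mul_mem_mul ?_ (ih b hb)
      have := augI_eq p G a ha
      clear ha
      induction this using AddSubgroup.closure_induction with
      | mem x hx =>
        obtain ⟨g, rfl⟩ := hx
        rw [map_del]
        exact del_mem p G (θ g)
      | zero => rw [map_zero]; exact zero_mem _
      | add x y _ _ hx hy => rw [map_add]; exact add_mem hx hy
      | neg x _ hx => rw [map_neg]; exact neg_mem hx
    | add x _ y _ hx hy => rw [map_add]; exact add_mem hx hy

theorem del_mul (g h : G) :
    del p G (g * h) = del p G g + del p G h + del p G g * del p G h := by
  simp only [del, map_mul]; noncomm_ring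

theorem del_inv (g : G) :
    del p G g⁻¹ = - (MonoidAlgebra.of (ZMod p) G g⁻¹ * del p G g) := by
  simp only [del, mul_sub, ← map_mul, inv_mul_cancel, map_one]; noncomm_ring

theorem del_comm (g h : G) :
    del p G (g * h * g⁻¹ * h⁻¹) = (del p G g * del p G h - del p G h * del p G g) +
      (del p G g * del p G h - del p G h * del p G g) * del p G (g⁻¹ * h⁻¹) := by
  have e : (del p G g * del p G h - del p G h * del p G g)
    = MonoidAlgebra.of (ZMod p) G (g * h) - MonoidAlgebra.of (ZMod p) G (h * g) := by
    simp only [del, map_mul]; noncomm_ring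
  rw [e, del, del, mul_sub, mul_one, add_sub_cancel, sub_mul, ← map_mul, ← map_mul]
  congr 1
  · congr 1; group
  · rw [← map_one (MonoidAlgebra.of (ZMod p) G)]; congr 1; group

/-- dimension subgroups -/
noncomputable def dimD (n : ℕ) : Subgroup G where
  carrier := {g | del p G g ∈ augI p G ^ n}
  mul_mem' := by
    intro a b ha hb
    change del p G (a * b) ∈ augI p G ^ n
    rw [del_mul]
    exact add_mem (add_mem ha hb) (Ideal.mul_mem_left _ _ hb)
  one_mem' := by
    change del p G 1 ∈ augI p G ^ n
    rw [del, map_one, sub_self]; exact zero_mem _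
  inv_mem' := by
    intro a ha
    change del p G a⁻¹ ∈ augI p G ^ n
    rw [del_inv]
    exact neg_mem (Ideal.mul_mem_left _ _ ha)

theorem mem_dimD (n : ℕ) (g : G) : g ∈ dimD p G n ↔ del p G g ∈ augI p G ^ n := Iff.rfl

theorem del_pow (g : G) (k : ℕ) : del p G g ^ p ^ k = del p G (g ^ p ^ k) := by
  have : CharP (MonoidAlgebra (ZMod p) G) p :=
    charP_of_injective_algebraMap (algebraMap (ZMod p) _).injective p
  rw [del, sub_pow_char_pow_of_commute p k (Commute.one_right _), one_pow, ← map_pow, del]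

theorem del_eq_zero (g : G) : del p G g = 0 ↔ g = 1 := by
  rw [del, sub_eq_zero, ← map_one (MonoidAlgebra.of (ZMod p) G)]
  exact (MonoidAlgebra.of_injective (R := ZMod p) (M := G)).eq_iff

theorem nilp [Finite G] (hG : IsPGroup p G) (K : ℕ) (hK : augI p G ^ K ≤ augI p G ^ (K + 1)) :
    augI p G ^ K = ⊥ := by
  let X : Ideal (MonoidAlgebra (ZMod p) G) :=
    { carrier := {x | ∀ y ∈ augI p G ^ K, y * x = 0}
      add_mem' := by
        intro a b ha hb y hy
        rw [mul_add, ha y hy, hb y hy, add_zero]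
      zero_mem' := by intro y _; rw [mul_zero]
      smul_mem' := by
        intro a b hb y hy
        rw [smul_eq_mul, ← mul_assoc]
        exact hb _ (Ideal.mul_mem_right _ _ hy) }
  by_cases hX : X = ⊤
  · rw [eq_bot_iff]
    intro y hy
    have h1 : (1 : MonoidAlgebra (ZMod p) G) ∈ X := by rw [hX]; trivial
    have := h1 y hy
    rwa [mul_one] at this
  exfalso
  let Q := MonoidAlgebra (ZMod p) G ⧸ X
  let _ : MulAction G Q := MulAction.compHom Q (MonoidAlgebra.of (ZMod p) G)
  have hfR : Finite (MonoidAlgebra (ZMod p) G) := by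
    have : Finite (G →₀ ZMod p) := Finite.of_injective (fun f => (f : G → ZMod p))
      DFunLike.coe_injective
    exact Finite.of_injective (MonoidAlgebra.coeff) MonoidAlgebra.coeff_injective
  have hfin : Finite Q := Finite.of_surjective _ (Submodule.mkQ_surjective X)
  have hnt : Nontrivial Q := Submodule.Quotient.nontrivial_iff.mpr hX
  obtain ⟨q, hq⟩ := exists_ne (0 : Q)
  have hord : addOrderOf q = p := by
    apply addOrderOf_eq_prime _ hq
    obtain ⟨x, rfl⟩ := Submodule.mkQ_surjective X q
    rw [← map_nsmul]
    have : p • x = 0 := by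
      rw [← Nat.cast_smul_eq_nsmul (ZMod p), CharP.cast_eq_zero, zero_smul]
    rw [this, map_zero]
  have hdvd : p ∣ Nat.card Q := hord ▸ addOrderOf_dvd_natCard q
  obtain ⟨b, hb, hb0⟩ := hG.exists_fixed_point_of_prime_dvd_card_of_fixed_point Q hdvd
    (a := 0) (fun g => smul_zero (MonoidAlgebra.of (ZMod p) G g))
  obtain ⟨x, rfl⟩ := Submodule.mkQ_surjective X b
  apply hb0
  symm
  rw [Submodule.mkQ_apply, Submodule.Quotient.mk_eq_zero]
  have h1 : ∀ a ∈ augI p G, a * x ∈ X := by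
    intro a ha
    have := augI_eq p G a ha
    clear ha
    induction this using AddSubgroup.closure_induction with
    | mem y hy =>
      obtain ⟨g, rfl⟩ := hy
      have := hb g
      change (MonoidAlgebra.of (ZMod p) G g) • X.mkQ x = X.mkQ x at this
      rw [← map_smul, ← sub_eq_zero, ← map_sub, Submodule.mkQ_apply,
        Submodule.Quotient.mk_eq_zero] at this
      rw [del, sub_mul, one_mul]
      exact this
    | zero => rw [zero_mul]; exact zero_mem _
    | add x y _ _ hx hy => rw [add_mul]; exact add_mem hx hy
    | neg x _ hx => rw [neg_mul]; exact neg_mem hx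
  intro y hy
  replace hy := hK hy
  rw [Ideal.IsTwoSided.pow_add, Submodule.pow_one] at hy
  induction hy using Submodule.mul_induction_on' with
  | mem_mul_mem c hc a ha =>
    rw [mul_assoc]
    exact h1 a ha c hc
  | add a _ b _ h2 h3 => rw [add_mul, h2, h3, add_zero]

end

end FrobTwelve


attribute [local instance] LieRing.ofAssociativeRing

namespace FrobTwelve

theorem exists_fil (p : ℕ) [Fact p.Prime] (G : Type) [Group G] [Finite G] (hG : IsPGroup p G) :
    ∃ (E : Type) (_ : Ring E) (D : ℕ → Subgroup G) (lam : ℕ → G → E), Fil p D lam := by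
  obtain ⟨E, _, μ, hadd, hmul, hone, hker⟩ := exists_gr (MonoidAlgebra (ZMod p) G)
    (fun n => (augI p G ^ n).toAddSubgroup)
    (by
      change (1 : MonoidAlgebra (ZMod p) G) ∈ augI p G ^ 0
      rw [Submodule.pow_zero, Ideal.one_eq_top]; trivial)
    (fun m n x y hx hy => pow_mul_mem p G hx hy)
  change ∀ n x y, x ∈ augI p G ^ n → y ∈ augI p G ^ n → _ at hadd
  change ∀ m n x y, x ∈ augI p G ^ m → y ∈ augI p G ^ n → _ at hmul
  change ∀ n x, x ∈ augI p G ^ n → (_ ↔ x ∈ augI p G ^ (n + 1)) at hker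
  have hle : ∀ {m n : ℕ}, m ≤ n → augI p G ^ n ≤ augI p G ^ m := fun h => Ideal.pow_le_pow_right h
  have h0 : ∀ x, x ∈ augI p G ^ 0 := by
    intro x; rw [Submodule.pow_zero, Ideal.one_eq_top]; trivial
  have hz : ∀ n x, x ∈ augI p G ^ (n + 1) → μ n x = 0 := fun n x hx =>
    (hker n x (hle (Nat.le_succ n) hx)).mpr hx
  have hneg : ∀ n x, x ∈ augI p G ^ n → μ n (-x) = - μ n x := by
    intro n x hx
    rw [eq_neg_iff_add_eq_zero, ← hadd _ _ _ (neg_mem hx) hx, neg_add_cancel, hz _ _ (zero_mem _)]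
  have hmuz : ∀ n, μ n 0 = 0 := fun n => hz _ _ (zero_mem _)
  have hpow : ∀ n x k, x ∈ augI p G ^ n → x ^ k ∈ augI p G ^ (k * n) ∧ μ (k * n) (x ^ k) = μ n x ^ k := by
    intro n x k hx
    induction k with
    | zero => rw [zero_mul, pow_zero, pow_zero, hone]; exact ⟨h0 _, rfl⟩
    | succ k ih =>
      rw [Nat.succ_mul, pow_succ, pow_succ, hmul _ _ _ _ ih.1 hx, ih.2]
      exact ⟨pow_mul_mem p G ih.1 hx, rfl⟩
  have hnat : ∀ k : ℕ, μ 0 (k : MonoidAlgebra (ZMod p) G) = k := by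
    intro k
    induction k with
    | zero => rw [Nat.cast_zero, Nat.cast_zero, hmuz]
    | succ k ih => rw [Nat.cast_succ, Nat.cast_succ, hadd _ _ _ (h0 _) (h0 _), ih, hone]
  refine ⟨E, inferInstance, dimD p G, fun n g => μ n (del p G g), ?_⟩
  refine ⟨?_, ?_, ?_, ?_, ?_, ?_, ?_, ?_, ?_⟩
  · rw [eq_top_iff]
    intro g _
    rw [mem_dimD, Submodule.pow_one]
    exact del_mem p G g
  · intro θ n x hx
    rw [mem_dimD] at hx ⊢
    rw [← map_del]
    exact inv_pow p G θ n _ hx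
  · intro n x hx
    exact hle (Nat.le_succ n) hx
  · intro n hn x y hx hy
    rw [mem_dimD] at hx hy
    have hxy := pow_mul_mem p G hx hy
    change μ n (del p G (x * y)) = _
    rw [del_mul, hadd _ _ _ (add_mem hx hy) (hle (by omega) hxy), hadd _ _ _ hx hy,
      hz n _ (hle (by omega) hxy), add_zero]
  · intro n x hx
    exact hker n _ hx
  · intro m n x y hx hy
    rw [mem_dimD] at hx hy ⊢
    rw [del_comm]
    have h1 := pow_mul_mem p G hx hy
    have h2 := pow_mul_mem p G hy hx
    rw [add_comm n m] at h2
    have h3 : (del p G x * del p G y - del p G y * del p G x) * del p G (x⁻¹ * y⁻¹) ∈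
      augI p G ^ (m + n + 1) :=
      pow_mul_mem p G (sub_mem h1 h2) (by rw [Submodule.pow_one]; exact del_mem p G _)
    refine ⟨add_mem (sub_mem h1 h2) (hle (Nat.le_succ _) h3), ?_⟩
    rw [hadd _ _ _ (sub_mem h1 h2) (hle (Nat.le_succ _) h3), hz _ _ h3, add_zero, sub_eq_add_neg,
      hadd _ _ _ h1 (neg_mem h2), hneg _ _ h2, hmul _ _ _ _ hx hy]
    rw [add_comm m n, hmul _ _ _ _ hy hx, Ring.lie_def, sub_eq_add_neg]
  · intro n x k hx hxk
    change μ n (del p G x) ^ p ^ k = 0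
    rw [← (hpow n _ (p ^ k) hx).2, del_pow, hxk, (del_eq_zero p G 1).mpr rfl, hmuz]
  · have hp0 : (p : MonoidAlgebra (ZMod p) G) = 0 := by
      rw [← nsmul_one, ← Nat.cast_smul_eq_nsmul (ZMod p), CharP.cast_eq_zero, zero_smul]
    rw [← hnat, hp0, hmuz]
  · intro ι t K ht hl x k hk
    have key : ∀ n y, y ∈ augI p G ^ n →
        μ n y ∈ AddSubgroup.closure {z | ∃ l : List ι, l.length = n ∧ (l.map t).prod = z} := by
      intro n
      induction n with
      | zero =>
        intro y _
        have h1 : y = (y - (aug p G y) • 1) + ((aug p G y).val : MonoidAlgebra (ZMod p) G) := by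
          rw [smul_eq_nsmul, nsmul_one, sub_add_cancel]
        have h2 : (y - (aug p G y) • 1) ∈ augI p G ^ 1 := by
          rw [Submodule.pow_one, augI, RingHom.mem_ker, map_sub, aug_smul, map_one, mul_one, sub_self]
        rw [h1, hadd _ _ _ (h0 _) (h0 _), hz _ _ h2, zero_add, hnat, ← nsmul_one]
        refine nsmul_mem (AddSubgroup.subset_closure ?_) _
        exact ⟨[], rfl, rfl⟩
      | succ n ih =>
        intro y hy
        rw [Ideal.IsTwoSided.pow_succ] at hy
        induction hy using Submodule.mul_induction_on' with
        | mem_mul_mem a ha b hb =>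
          rw [add_comm n 1, hmul _ _ _ _ (by rwa [Submodule.pow_one]) hb]
          have hA : μ 1 a ∈ AddSubgroup.closure (Set.range t) := by
            have h1 : a ∈ augI p G ^ 1 ∧ μ 1 a ∈ AddSubgroup.closure (Set.range t) := by
              rw [Submodule.pow_one]
              have := augI_eq p G a ha
              clear ha
              induction this using AddSubgroup.closure_induction with
              | mem x hx =>
                obtain ⟨g, rfl⟩ := hx
                exact ⟨del_mem p G g, ht g⟩
              | zero => rw [hmuz]; exact ⟨zero_mem _, zero_mem _⟩
              | add x y _ _ hx hy =>
                rw [hadd _ _ _ (by rw [Submodule.pow_one]; exact hx.1)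
                  (by rw [Submodule.pow_one]; exact hy.1)]
                exact ⟨add_mem hx.1 hy.1, add_mem hx.2 hy.2⟩
              | neg x _ hx =>
                rw [hneg _ _ (by rw [Submodule.pow_one]; exact hx.1)]
                exact ⟨neg_mem hx.1, neg_mem hx.2⟩
            exact h1.2
          have hB := ih b hb
          generalize μ 1 a = u at hA
          generalize μ n b = w at hB
          induction hA using AddSubgroup.closure_induction with
          | mem x hx =>
            obtain ⟨i, rfl⟩ := hx
            induction hB using AddSubgroup.closure_induction with
            | mem x hx =>
              obtain ⟨l, hl, rfl⟩ := hx
              refine AddSubgroup.subset_closure ⟨i :: l, ?_, ?_⟩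
              · rw [List.length_cons, hl, add_comm]
              · rw [List.map_cons, List.prod_cons]
            | zero => rw [mul_zero]; exact zero_mem _
            | add x y _ _ hx hy => rw [mul_add]; exact add_mem hx hy
            | neg x _ hx => rw [mul_neg]; exact neg_mem hx
          | zero => rw [zero_mul]; exact zero_mem _
          | add x y _ _ hx hy => rw [add_mul]; exact add_mem hx hy
          | neg x _ hx => rw [neg_mul]; exact neg_mem hx
        | add a ha b hb h2 h3 =>
          rw [← Ideal.IsTwoSided.pow_succ] at ha hb
          rw [hadd _ _ _ ha hb]; exact add_mem h2 h3
    have hKK : augI p G ^ K ≤ augI p G ^ (K + 1) := by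
      intro y hy
      rw [← hker _ _ hy]
      have := key K y hy
      have hle2 : AddSubgroup.closure {z | ∃ l : List ι, l.length = K ∧ (l.map t).prod = z} ≤ ⊥ := by
        rw [AddSubgroup.closure_le]
        rintro _ ⟨l, h1, rfl⟩
        exact hl l h1
      exact hle2 this
    have hbot := nilp p G hG K hKK
    rw [← del_eq_zero p G, ← del_pow]
    have h1 : del p G x ^ p ^ k ∈ augI p G ^ (p ^ k) := by
      have := (hpow 1 (del p G x) (p ^ k) (by rw [Submodule.pow_one]; exact del_mem p G x)).1
      rwa [mul_one] at this
    have h2 := hle hk h1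
    rw [hbot] at h2
    exact h2

end FrobTwelve


namespace FrobTwelve

theorem fixpt {X : Type} [Finite X] {q : ℕ} [Fact q.Prime] (f : X → X) (hf : f^[q] = id)
    (hX : ¬ q ∣ Nat.card X) : ∃ x, f x = x := by
  classical
  have := Fintype.ofFinite X
  have h1 : (show Function.End X from f) ^ q ^ 1 = 1 := by
    rw [pow_one]
    have : ∀ n : ℕ, (show Function.End X from f) ^ n = f^[n] := by
      intro n
      induction n with
      | zero => rfl
      | succ n ih => rw [pow_succ, ih, Function.iterate_succ]; rfl
    rw [this, hf]; rfl
  have h2 := Equiv.Perm.card_fixedPoints_modEq h1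
  by_contra hcon
  push Not at hcon
  have h3 : Fintype.card (Function.fixedPoints f) = 0 := by
    rw [Fintype.card_eq_zero_iff]
    exact ⟨fun x => hcon x.1 x.2⟩
  have h4 : Fintype.card X ≡ 0 [MOD q] := by
    rw [← h3]; convert h2
  rw [Nat.card_eq_fintype_card] at hX
  exact hX ((Nat.modEq_zero_iff_dvd).mp h4)

theorem fixpt2 {X : Type} [Finite X] (f f' : X → X) (hf : ∀ x, f (f x) = x)
    (hf' : ∀ x, f' (f' x) = x) (hc : ∀ x, f (f' x) = f' (f x))
    (hX : ¬ 2 ∣ Nat.card X) : ∃ x, f x = x ∧ f' x = x := by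
  classical
  have := Fintype.ofFinite X
  have h1 : (show Function.End X from f) ^ 2 ^ 1 = 1 := by
    rw [pow_one, pow_two]
    funext x
    exact hf x
  have h2 := Equiv.Perm.card_fixedPoints_modEq h1
  let Y := Function.fixedPoints f
  have hY : ¬ 2 ∣ Nat.card Y := by
    rw [Nat.card_eq_fintype_card] at hX ⊢
    intro h
    apply hX
    have h3 : Fintype.card X ≡ Fintype.card Y [MOD 2] := by convert h2
    exact (h3.dvd_iff dvd_rfl).mpr h
  obtain ⟨y, hy⟩ := fixpt (q := 2) (X := Y)
    (fun y => ⟨f' y.1, by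
      change f (f' y.1) = f' y.1
      rw [hc]; congr 1; exact y.2⟩)
    (by funext y; apply Subtype.ext; exact hf' y.1) hY
  exact ⟨y.1, y.2, congrArg Subtype.val hy⟩

theorem coset_fix {G : Type} [Group G] [Finite G] (θ : MulAut G) (h3 : ∀ x, θ (θ (θ x)) = x)
    (N : Subgroup G) (hN : ∀ x ∈ N, θ x ∈ N) (hq : ¬ 3 ∣ Nat.card G) (g : G)
    (hg : g⁻¹ * θ g ∈ N) : ∃ n ∈ N, θ (g * n) = g * n := by
  have hNc : ¬ 3 ∣ Nat.card N := fun h => hq (h.trans (Subgroup.card_subgroup_dvd_card N))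
  have : Fact (Nat.Prime 3) := ⟨Nat.prime_three⟩
  obtain ⟨n, hn⟩ := fixpt (q := 3) (X := N) (fun n => ⟨g⁻¹ * θ (g * n.1), by
      rw [map_mul, ← mul_assoc]; exact mul_mem hg (hN _ n.2)⟩) (by
      funext n
      apply Subtype.ext
      change g⁻¹ * θ (g * (g⁻¹ * θ (g * (g⁻¹ * θ (g * n.1))))) = n.1
      simp only [mul_inv_cancel_left, h3, inv_mul_cancel_left]) hNc
  refine ⟨n.1, n.2, ?_⟩
  have := congrArg Subtype.val hn
  change g⁻¹ * θ (g * n.1) = n.1 at this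
  rwa [inv_mul_eq_iff_eq_mul] at this

theorem coset_fix2 {G : Type} [Group G] [Finite G] (α β : MulAut G) (ha : ∀ x, α (α x) = x)
    (hb : ∀ x, β (β x) = x) (hc : ∀ x, α (β x) = β (α x))
    (N : Subgroup G) (hNa : ∀ x ∈ N, α x ∈ N) (hNb : ∀ x ∈ N, β x ∈ N)
    (hq : ¬ 2 ∣ Nat.card G) (g : G)
    (hga : g⁻¹ * α g ∈ N) (hgb : g⁻¹ * β g ∈ N) :
    ∃ n ∈ N, α (g * n) = g * n ∧ β (g * n) = g * n := by
  have : ¬ 2 ∣ Nat.card N := fun h => hq (h.trans (Subgroup.card_subgroup_dvd_card N))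
  obtain ⟨n, hn, hn'⟩ := fixpt2 (X := N) (fun n => ⟨g⁻¹ * α (g * n.1), by
      rw [map_mul, ← mul_assoc]; exact mul_mem hga (hNa _ n.2)⟩)
      (fun n => ⟨g⁻¹ * β (g * n.1), by
      rw [map_mul, ← mul_assoc]; exact mul_mem hgb (hNb _ n.2)⟩) (by
      intro n
      apply Subtype.ext
      change g⁻¹ * α (g * (g⁻¹ * α (g * n.1))) = n.1
      simp only [mul_inv_cancel_left, ha, inv_mul_cancel_left]) (by
      intro n
      apply Subtype.ext
      change g⁻¹ * β (g * (g⁻¹ * β (g * n.1))) = n.1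
      simp only [mul_inv_cancel_left, hb, inv_mul_cancel_left]) (by
      intro n
      apply Subtype.ext
      change g⁻¹ * α (g * (g⁻¹ * β (g * n.1))) = g⁻¹ * β (g * (g⁻¹ * α (g * n.1)))
      simp only [mul_inv_cancel_left, hc]) this
  refine ⟨n.1, n.2, ?_, ?_⟩
  · have := congrArg Subtype.val hn
    change g⁻¹ * α (g * n.1) = n.1 at this
    rwa [inv_mul_eq_iff_eq_mul] at this
  · have := congrArg Subtype.val hn'
    change g⁻¹ * β (g * n.1) = n.1 at this
    rwa [inv_mul_eq_iff_eq_mul] at this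

/-- The action of the Frobenius group of order 12. -/
structure Quad (e : ℕ) {G : Type} [Group G] (σ : Fin 3 → MulAut G) (η : MulAut G) : Prop where
  sq : ∀ i x, σ i (σ i x) = x
  up : ∀ i x, σ i (σ (i + 1) x) = σ (i + 2) x
  dn : ∀ i x, σ (i + 1) (σ i x) = σ (i + 2) x
  cyc : ∀ i x, η (σ i x) = σ (i + 1) (η x)
  cube : ∀ x, η (η (η x)) = x
  fix : ∀ x, σ 0 x = x → σ 1 x = x → x = 1
  fixh : ∀ x, η x = x → x ^ e = 1

end FrobTwelve


attribute [local instance] LieRing.ofAssociativeRing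

namespace FrobTwelve

section
variable {p : ℕ} {G : Type} [Group G] {E : Type} [Ring E] {D : ℕ → Subgroup G}
    {lam : ℕ → G → E} {N : ℕ} {σ : Fin 3 → MulAut G} {η : MulAut G}

theorem Fil.one' (F : Fil p D lam) {n : ℕ} (hn : 1 ≤ n) : lam n 1 = 0 := by
  have := F.mul n hn 1 1 (one_mem _) (one_mem _)
  rw [mul_one] at this
  exact left_eq_add.mp this

theorem Fil.inv' (F : Fil p D lam) {n : ℕ} (hn : 1 ≤ n) {x : G} (hx : x ∈ D n) :
    lam n x⁻¹ = - lam n x := by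
  rw [eq_neg_iff_add_eq_zero, ← F.mul n hn _ _ (inv_mem hx) hx, inv_mul_cancel, F.one' hn]

theorem Fil.eq_iff (F : Fil p D lam) {n : ℕ} (hn : 1 ≤ n) {x y : G} (hx : x ∈ D n) (hy : y ∈ D n) :
    lam n x = lam n y ↔ x⁻¹ * y ∈ D (n + 1) := by
  rw [← F.ker n _ (mul_mem (inv_mem hx) hy), F.mul n hn _ _ (inv_mem hx) hy, F.inv' hn hx,
    neg_add_eq_zero]

theorem Fil.congr (F : Fil p D lam) {n : ℕ} (hn : 1 ≤ n) {x y : G} (hx : x ∈ D n) (hy : y ∈ D n)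
    (h : lam n x = lam n y) (θ : MulAut G) : lam n (θ x) = lam n (θ y) := by
  rw [F.eq_iff hn (F.inv θ _ _ hx) (F.inv θ _ _ hy), ← map_inv, ← map_mul]
  exact F.inv θ _ _ ((F.eq_iff hn hx hy).mp h)

theorem Fil.fixF [Finite G] (F : Fil p D lam) (Q : Quad N σ η) (h2 : ¬ 2 ∣ Nat.card G)
    {n : ℕ} (hn : 1 ≤ n) {x : G} (hx : x ∈ D n) (i : Fin 3) (h0 : lam n (σ i x) = lam n x)
    (h1 : lam n (σ (i + 1) x) = lam n x) : lam n x = 0 := by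
  obtain ⟨y, hy, hy1, hy2⟩ := coset_fix2 (σ i) (σ (i + 1)) (Q.sq i) (Q.sq (i + 1))
    (fun x => by rw [Q.up, Q.dn]) (D (n + 1)) (fun x hx => F.inv _ _ _ hx)
    (fun x hx => F.inv _ _ _ hx) h2 x ((F.eq_iff hn hx (F.inv _ _ _ hx)).mp h0.symm)
    ((F.eq_iff hn hx (F.inv _ _ _ hx)).mp h1.symm)
  have hy3 : σ (i + 2) (x * y) = x * y := by rw [← Q.up, hy2, hy1]
  have h1 : x * y = 1 := by
    apply Q.fix
    · fin_cases i
      · exact hy1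
      · exact hy3
      · exact hy2
    · fin_cases i
      · exact hy2
      · exact hy1
      · exact hy3
  rw [F.ker n x hx, eq_inv_of_mul_eq_one_left h1]
  exact inv_mem hy

theorem Fil.sum4 [Finite G] (F : Fil p D lam) (Q : Quad N σ η) (h2 : ¬ 2 ∣ Nat.card G)
    {n : ℕ} (hn : 1 ≤ n) {x : G} (hx : x ∈ D n) :
    lam n x + lam n (σ 0 x) + lam n (σ 1 x) + lam n (σ 2 x) = 0 := by
  have hm : ∀ (θ : MulAut G) {y}, y ∈ D n → θ y ∈ D n := fun θ y hy => F.inv θ n y hy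
  have hD : x * σ 0 x * σ 1 x * σ 2 x ∈ D n :=
    mul_mem (mul_mem (mul_mem hx (hm _ hx)) (hm _ hx)) (hm _ hx)
  have e4 : ∀ a b c d, a ∈ D n → b ∈ D n → c ∈ D n → d ∈ D n →
      lam n (a * b * c * d) = lam n a + lam n b + lam n c + lam n d := by
    intro a b c d ha hb hc hd
    rw [F.mul n hn _ _ (mul_mem (mul_mem ha hb) hc) hd, F.mul n hn _ _ (mul_mem ha hb) hc,
      F.mul n hn _ _ ha hb]
  have u0 : ∀ x, σ 0 (σ 1 x) = σ 2 x := Q.up 0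
  have u1 : ∀ x, σ 1 (σ 2 x) = σ 0 x := Q.up 1
  have u2 : ∀ x, σ 2 (σ 0 x) = σ 1 x := Q.up 2
  have d0 : ∀ x, σ 1 (σ 0 x) = σ 2 x := Q.dn 0
  have d1 : ∀ x, σ 2 (σ 1 x) = σ 0 x := Q.dn 1
  have d2 : ∀ x, σ 0 (σ 2 x) = σ 1 x := Q.dn 2
  have := F.fixF Q h2 hn hD 0 (by
    rw [map_mul, map_mul, map_mul, Q.sq, u0, d2, e4 _ _ _ _ (hm _ hx) hx (hm _ hx) (hm _ hx),
      e4 _ _ _ _ hx (hm _ hx) (hm _ hx) (hm _ hx)]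
    abel) (by
    rw [zero_add, map_mul, map_mul, map_mul, Q.sq, d0, u1,
      e4 _ _ _ _ (hm _ hx) (hm _ hx) hx (hm _ hx),
      e4 _ _ _ _ hx (hm _ hx) (hm _ hx) (hm _ hx)]
    abel)
  rwa [e4 _ _ _ _ hx (hm _ hx) (hm _ hx) (hm _ hx)] at this

theorem Fil.flip [Finite G] (F : Fil p D lam) (Q : Quad N σ η) (h2 : ¬ 2 ∣ Nat.card G)
    (htwo : ∃ k : ℕ, (k : E) * 2 = 1)
    {n : ℕ} (hn : 1 ≤ n) {x : G} (hx : x ∈ D n) (i : Fin 3) (h : lam n (σ i x) = lam n x) :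
    lam n (σ (i + 1) x) = - lam n x ∧ lam n (σ (i + 2) x) = - lam n x := by
  have h1 : lam n (σ (i + 2) x) = lam n (σ (i + 1) x) := by
    rw [← Q.dn]
    exact F.congr hn (F.inv _ _ _ hx) hx h _
  have hs := F.sum4 Q h2 hn hx
  have hs' : lam n x + lam n (σ i x) + lam n (σ (i + 1) x) + lam n (σ (i + 2) x) = 0 := by
    fin_cases i
    · exact hs
    · change lam n x + lam n (σ 1 x) + lam n (σ 2 x) + lam n (σ 0 x) = 0
      rw [← hs]; abel
    · change lam n x + lam n (σ 2 x) + lam n (σ 0 x) + lam n (σ 1 x) = 0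
      rw [← hs]; abel
  rw [h, h1] at hs'
  obtain ⟨k, hk⟩ := htwo
  have h5 : lam n (σ (i + 1) x) + lam n x = 0 := by
    calc lam n (σ (i + 1) x) + lam n x = ((k : E) * 2) * (lam n (σ (i + 1) x) + lam n x) := by
          rw [hk, one_mul]
      _ = k * (lam n x + lam n x + lam n (σ (i + 1) x) + lam n (σ (i + 1) x)) := by
          noncomm_ring
      _ = 0 := by rw [hs', mul_zero]
  have h6 := eq_neg_of_add_eq_zero_left h5
  exact ⟨h6, h1.trans h6⟩

/-- The system of triples. -/
def TT (D : ℕ → Subgroup G) (lam : ℕ → G → E) (σ : Fin 3 → MulAut G) (η : MulAut G)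
    (n : ℕ) (v : Fin 3 → E) : Prop :=
  1 ≤ n ∧ ∃ x : Fin 3 → G, (∀ i, x i ∈ D n) ∧ (∀ i, x (i + 1) = η (x i)) ∧
    (∀ i, lam n (σ i (x i)) = lam n (x i)) ∧ ∀ i, v i = lam n (x i)

theorem Fil.nilsum [Finite G] (hG : IsPGroup p G) (hp : p.Prime) (F : Fil p D lam)
    (Q : Quad N σ η)
    (hN : 0 < N) (h3 : ¬ 3 ∣ Nat.card G)
    {n : ℕ} (hn : 1 ≤ n) {x : G} (hx : x ∈ D n) (h : lam n (η x) = lam n x) (θ : MulAut G) :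
    lam n (θ x) ^ N = 0 := by
  obtain ⟨y, hy, hxy⟩ := coset_fix η Q.cube (D (n + 1)) (fun x hx => F.inv _ _ _ hx) h3 x
    ((F.eq_iff hn hx (F.inv _ _ _ hx)).mp h.symm)
  have hyn := F.anti n hy
  have h1 : lam n (θ x) = lam n (θ (x * y)) := by
    apply F.congr hn hx (mul_mem hx hyn)
    rw [F.mul n hn _ _ hx hyn, (F.ker n y hyn).mpr hy, add_zero]
  have h2 := Q.fixh _ hxy
  have : Fact p.Prime := ⟨hp⟩
  obtain ⟨k, hk⟩ := IsPGroup.iff_orderOf.mp hG (x * y)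
  have h4 : p ^ k ∣ N := hk ▸ orderOf_dvd_of_pow_eq_one h2
  have h5 : θ (x * y) ^ p ^ k = 1 := by
    rw [← map_pow, ← hk, pow_orderOf_eq_one, map_one]
  have h6 := F.nil n _ k (F.inv θ _ _ (mul_mem hx hyn)) h5
  rw [h1]
  exact pow_eq_zero_of_le (Nat.le_of_dvd hN h4) h6

theorem Fil.two (F : Fil p D lam) (hp : p.Prime) (h : 5 ≤ p) : ∃ k : ℕ, (k : E) * 2 = 1 := by
  have h1 : p % 2 = 1 := Nat.odd_iff.mp (hp.odd_of_ne_two (by omega))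
  refine ⟨(p + 1) / 2, ?_⟩
  have : ((p + 1) / 2) * 2 = p + 1 := by omega
  have h2 := congrArg (Nat.cast (R := E)) this
  push_cast at h2
  rw [F.char, zero_add] at h2
  exact_mod_cast h2

theorem Fil.three (F : Fil p D lam) (hp : p.Prime) (h : 5 ≤ p) : ∃ k : ℕ, (k : E) * 3 = 1 := by
  have h1 : ¬ 3 ∣ p := by
    intro h3
    have := (Nat.prime_dvd_prime_iff_eq Nat.prime_three hp).mp h3
    omega
  have : ∃ k c : ℕ, k * 3 = c * p + 1 := by
    have h2 : p % 3 = 1 ∨ p % 3 = 2 := by omega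
    rcases h2 with h2 | h2
    · exact ⟨(2 * p + 1) / 3, 2, by omega⟩
    · exact ⟨(p + 1) / 3, 1, by omega⟩
  obtain ⟨k, c, hk⟩ := this
  refine ⟨k, ?_⟩
  have h2 := congrArg (Nat.cast (R := E)) hk
  push_cast at h2
  rw [F.char, mul_zero, zero_add] at h2
  exact h2

theorem Fil.sys [Finite G] (hG : IsPGroup p G) (hp : p.Prime) (h5 : 5 ≤ p) (F : Fil p D lam)
    (Q : Quad N σ η) (hN : 0 < N) (h2 : ¬ 2 ∣ Nat.card G) (h3 : ¬ 3 ∣ Nat.card G) :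
    Sys N (TT D lam σ η) := by
  have htwo := F.two hp h5
  have f1 : ∀ i : Fin 3, i + 1 + 1 = i + 2 := by decide
  have f2 : ∀ i : Fin 3, i + 1 + 2 = i := by decide
  have f3 : ∀ i : Fin 3, i + 2 + 1 = i := by decide
  have f4 : ∀ i : Fin 3, i + 2 + 2 = i + 1 := by decide
  have hm : ∀ (θ : MulAut G) {n y}, y ∈ D n → θ y ∈ D n := fun θ n y hy => F.inv θ n y hy
  have hF : ∀ {n : ℕ} (_ : 1 ≤ n) {x : Fin 3 → G} (_ : ∀ i, x i ∈ D n)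
      (_ : ∀ i, lam n (σ i (x i)) = lam n (x i)) (i : Fin 3),
      lam n (σ i (x (i + 1))) = - lam n (x (i + 1)) ∧
      lam n (σ i (x (i + 2))) = - lam n (x (i + 2)) ∧
      lam n (σ (i + 1) (x i)) = - lam n (x i) ∧
      lam n (σ (i + 1) (x (i + 2))) = - lam n (x (i + 2)) := by
    intro n hn x hx hs i
    have a1 := F.flip Q h2 htwo hn (hx (i + 1)) (i + 1) (hs _)
    have a2 := F.flip Q h2 htwo hn (hx (i + 2)) (i + 2) (hs _)
    have a3 := F.flip Q h2 htwo hn (hx i) i (hs _)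
    rw [f1, f2] at a1
    rw [f3, f4] at a2
    exact ⟨a1.2, a2.1, a3.1, a2.2⟩
  have hcom : ∀ (θ : MulAut G) {m n : ℕ} {x y}, x ∈ D m → y ∈ D n →
      lam (m + n) (θ (x * y * x⁻¹ * y⁻¹)) = ⁅lam m (θ x), lam n (θ y)⁆ := by
    intro θ m n x y hx hy
    rw [(F.comm m n _ _ (hm θ hx) (hm θ hy)).2, map_mul, map_mul, map_mul, map_inv, map_inv]
  constructor
  · rintro n v w ⟨hn, x, hx1, hx2, hx3, hx4⟩ ⟨_, y, hy1, hy2, hy3, hy4⟩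
    refine ⟨hn, fun i => x i * y i, fun i => mul_mem (hx1 i) (hy1 i), ?_, ?_, ?_⟩
    · intro i; beta_reduce; rw [hx2, hy2, map_mul]
    · intro i
      beta_reduce
      rw [map_mul, F.mul n hn _ _ (hm _ (hx1 i)) (hm _ (hy1 i)), F.mul n hn _ _ (hx1 i) (hy1 i),
        hx3, hy3]
    · intro i
      beta_reduce
      rw [F.mul n hn _ _ (hx1 i) (hy1 i), ← hx4, ← hy4]; rfl
  · rintro n v ⟨hn, x, hx1, hx2, hx3, hx4⟩
    refine ⟨hn, fun i => (x i)⁻¹, fun i => inv_mem (hx1 i), ?_, ?_, ?_⟩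
    · intro i; beta_reduce; rw [hx2, map_inv]
    · intro i
      beta_reduce
      rw [map_inv, F.inv' hn (hm _ (hx1 i)), F.inv' hn (hx1 i), hx3]
    · intro i
      beta_reduce
      rw [F.inv' hn (hx1 i), ← hx4]; rfl
  · rintro m n v w ⟨hm1, x, hx1, hx2, hx3, hx4⟩ ⟨hn, y, hy1, hy2, hy3, hy4⟩
    refine ⟨by omega, fun i => x (i + 1) * y (i + 2) * (x (i + 1))⁻¹ * (y (i + 2))⁻¹,
      fun i => (F.comm m n _ _ (hx1 _) (hy1 _)).1, ?_, ?_, ?_⟩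
    · intro i
      beta_reduce
      rw [show i + 1 + 2 = i + 2 + 1 by rw [f2, f3], hx2 (i + 1), hy2 (i + 2)]
      simp only [map_mul, map_inv]
    · intro i
      beta_reduce
      rw [hcom _ (hx1 _) (hy1 _), (hF hm1 hx1 hx3 i).1, (hF hn hy1 hy3 i).2.1,
        ← (F.comm m n _ _ (hx1 _) (hy1 _)).2, Ring.lie_def, Ring.lie_def]
      noncomm_ring
    · intro i
      beta_reduce
      rw [← (F.comm m n _ _ (hx1 _) (hy1 _)).2, hx4, hy4]
  · rintro m n v w ⟨hm1, x, hx1, hx2, hx3, hx4⟩ ⟨hn, y, hy1, hy2, hy3, hy4⟩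
    refine ⟨by omega, fun i => x (i + 2) * y (i + 1) * (x (i + 2))⁻¹ * (y (i + 1))⁻¹,
      fun i => (F.comm m n _ _ (hx1 _) (hy1 _)).1, ?_, ?_, ?_⟩
    · intro i
      beta_reduce
      rw [show i + 1 + 2 = i + 2 + 1 by rw [f2, f3], hy2 (i + 1), hx2 (i + 2)]
      simp only [map_mul, map_inv]
    · intro i
      beta_reduce
      rw [hcom _ (hx1 _) (hy1 _), (hF hm1 hx1 hx3 i).2.1, (hF hn hy1 hy3 i).1,
        ← (F.comm m n _ _ (hx1 _) (hy1 _)).2, Ring.lie_def, Ring.lie_def]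
      noncomm_ring
    · intro i
      beta_reduce
      rw [← (F.comm m n _ _ (hx1 _) (hy1 _)).2, hx4, hy4]
  · rintro m n v w ⟨hm1, x, hx1, hx2, hx3, hx4⟩ ⟨hn, y, hy1, hy2, hy3, hy4⟩ i
    have hc := F.comm m n _ _ (hx1 i) (hy1 i)
    rw [hx4, hy4, hc.2]
    refine F.fixF Q h2 (by omega) hc.1 i ?_ ?_
    · rw [hcom _ (hx1 _) (hy1 _), hx3, hy3, hc.2]
    · rw [hcom _ (hx1 _) (hy1 _), (hF hm1 hx1 hx3 i).2.2.1, (hF hn hy1 hy3 i).2.2.1, ← hc.2,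
        Ring.lie_def, Ring.lie_def]
      noncomm_ring
  · rintro n v ⟨hn, x, hx1, hx2, hx3, hx4⟩ i
    have hD := mul_mem (mul_mem (hx1 i) (hx1 (i + 1))) (hx1 (i + 2))
    have := F.nilsum hG hp Q hN h3 hn hD (by
      rw [map_mul, map_mul, ← hx2, ← hx2, ← hx2, f1, f3,
        F.mul n hn _ _ (mul_mem (hx1 _) (hx1 _)) (hx1 _), F.mul n hn _ _ (hx1 _) (hx1 _),
        F.mul n hn _ _ (mul_mem (hx1 _) (hx1 _)) (hx1 _), F.mul n hn _ _ (hx1 _) (hx1 _)]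
      abel) 1
    rw [MulAut.one_apply, F.mul n hn _ _ (mul_mem (hx1 _) (hx1 _)) (hx1 _),
      F.mul n hn _ _ (hx1 _) (hx1 _)] at this
    rw [hx4, hx4, hx4, this]
  · rintro n v ⟨hn, x, hx1, hx2, hx3, hx4⟩ i
    have hD := mul_mem (mul_mem (hx1 i) (hx1 (i + 1))) (hx1 (i + 2))
    have := F.nilsum hG hp Q hN h3 hn hD (by
      rw [map_mul, map_mul, ← hx2, ← hx2, ← hx2, f1, f3,
        F.mul n hn _ _ (mul_mem (hx1 _) (hx1 _)) (hx1 _), F.mul n hn _ _ (hx1 _) (hx1 _),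
        F.mul n hn _ _ (mul_mem (hx1 _) (hx1 _)) (hx1 _), F.mul n hn _ _ (hx1 _) (hx1 _)]
      abel) (σ (i + 1))
    rw [map_mul, map_mul, F.mul n hn _ _ (mul_mem (hm _ (hx1 _)) (hm _ (hx1 _))) (hm _ (hx1 _)),
      F.mul n hn _ _ (hm _ (hx1 _)) (hm _ (hx1 _)), (hF hn hx1 hx3 i).2.2.1, hx3,
      (hF hn hx1 hx3 i).2.2.2] at this
    rw [hx4, hx4, hx4, ← this]
    congr 1
    abel
  · exact htwo
  · exact F.three hp h5

end

end FrobTwelve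


attribute [local instance] LieRing.ofAssociativeRing

namespace FrobTwelve

theorem core (p : ℕ) (hp : p.Prime) (h5 : 5 ≤ p) (G : Type) [Group G] [Finite G]
    (hG : IsPGroup p G) (e : ℕ) (he : 0 < e) (σ : Fin 3 → MulAut G) (η : MulAut G)
    (Q : Quad e σ η) (h2 : ¬ 2 ∣ Nat.card G) (h3 : ¬ 3 ∣ Nat.card G) (g : G)
    (hgen : ∀ S : Subgroup G, g ∈ S → (∀ x ∈ S, σ 0 x ∈ S) → (∀ x ∈ S, η x ∈ S) → S = ⊤) :
    g ^ e ^ bigK e = 1 := by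
  have : Fact p.Prime := ⟨hp⟩
  obtain ⟨E, _, D, lam, F⟩ := exists_fil p G hG
  have htwo := F.two hp h5
  have htop : ∀ x, x ∈ D 1 := fun x => by rw [F.one]; trivial
  have hmul : ∀ x y, lam 1 (x * y) = lam 1 x + lam 1 y := fun x y =>
    F.mul 1 le_rfl x y (htop x) (htop y)
  have hinv : ∀ x, lam 1 x⁻¹ = - lam 1 x := fun x => F.inv' le_rfl (htop x)
  have hD2 : ∀ x, x ∈ D 2 ↔ lam 1 x = 0 := fun x => (F.ker 1 x (htop x)).symm
  have hcong : ∀ x y, lam 1 x = lam 1 y → ∀ θ : MulAut G, lam 1 (θ x) = lam 1 (θ y) :=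
    fun x y h θ => F.congr le_rfl (htop x) (htop y) h θ
  -- the generating triples
  let X : Fin 3 → Fin 3 → G := fun j i => (η ^ ((i - j : Fin 3) : ℕ)) (g * σ j g)
  have hXj : ∀ j, X j j = g * σ j g := by
    intro j
    change (η ^ ((j - j : Fin 3) : ℕ)) (g * σ j g) = _
    rw [sub_self]; rfl
  have hpow : ∀ (a : Fin 3) (x : G), (η ^ ((a + 1 : Fin 3) : ℕ)) x = η ((η ^ (a : ℕ)) x) := by
    intro a x
    fin_cases a
    · rfl
    · rfl
    · exact (Q.cube x).symm
  have hXs : ∀ j i, X j (i + 1) = η (X j i) := by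
    intro j i
    change (η ^ ((i + 1 - j : Fin 3) : ℕ)) (g * σ j g) = _
    rw [show i + 1 - j = i - j + 1 by abel, hpow]
  have hXf : ∀ j i, lam 1 (σ i (X j i)) = lam 1 (X j i) := by
    intro j
    have h0 : lam 1 (σ j (X j j)) = lam 1 (X j j) := by
      rw [hXj, map_mul, Q.sq, hmul, hmul, add_comm]
    have hs : ∀ i, lam 1 (σ i (X j i)) = lam 1 (X j i) →
        lam 1 (σ (i + 1) (X j (i + 1))) = lam 1 (X j (i + 1)) := by
      intro i hi
      rw [hXs, ← Q.cyc]
      exact hcong _ _ hi η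
    intro i
    have h1 := hs _ h0
    have h2 := hs _ h1
    have : i = j ∨ i = j + 1 ∨ i = j + 1 + 1 := by
      have : ∀ i j : Fin 3, i = j ∨ i = j + 1 ∨ i = j + 1 + 1 := by decide
      exact this i j
    rcases this with rfl | rfl | rfl
    · exact h0
    · exact h1
    · exact h2
  let t : Fin 3 → Fin 3 → E := fun j i => lam 1 (X j i)
  have ht : ∀ j, TT D lam σ η 1 (t j) := fun j =>
    ⟨le_rfl, X j, fun i => htop _, hXs j, hXf j, fun i => rfl⟩
  -- generation
  let S : Subgroup G := Subgroup.closure {x | ∃ j i, X j i = x} ⊔ D 2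
  have hXS : ∀ j i, X j i ∈ S := fun j i =>
    (le_sup_left : _ ≤ S) (Subgroup.subset_closure ⟨j, i, rfl⟩)
  have hDS : D 2 ≤ S := le_sup_right
  have hmodS : ∀ x y, lam 1 x = lam 1 y → y ∈ S → x ∈ S := by
    intro x y h hy
    have h1 : x * y⁻¹ ∈ D 2 := by
      rw [hD2, hmul, hinv, h, add_neg_cancel]
    have := mul_mem (hDS h1) hy
    rwa [inv_mul_cancel_right] at this
  have hSinv : ∀ θ : MulAut G, (∀ j i, θ (X j i) ∈ S) → ∀ x ∈ S, θ x ∈ S := by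
    intro θ h x hx
    have : S ≤ S.comap (θ : G →* G) := by
      refine sup_le ?_ ?_
      · rw [Subgroup.closure_le]
        rintro _ ⟨j, i, rfl⟩
        exact h j i
      · intro x hx
        exact hDS (F.inv θ 2 x hx)
    exact this hx
  have hST : S = ⊤ := by
    apply hgen
    · have h1 : lam 1 (g ^ 2) = lam 1 (X 0 0 * X 1 1 * X 2 2) := by
        rw [hXj, hXj, hXj, pow_two]
        simp only [hmul]
        have := F.sum4 Q h2 le_rfl (htop g)
        have h' : lam 1 g + lam 1 (σ 0 g) + (lam 1 g + lam 1 (σ 1 g)) + (lam 1 g + lam 1 (σ 2 g))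
          = lam 1 g + lam 1 g + (lam 1 g + lam 1 (σ 0 g) + lam 1 (σ 1 g) + lam 1 (σ 2 g)) := by
          abel
        rw [h', this, add_zero]
      have h4 : g ^ 2 ∈ S := hmodS _ _ h1 (mul_mem (mul_mem (hXS 0 0) (hXS 1 1)) (hXS 2 2))
      have hodd : Nat.card G % 2 = 1 := by omega
      have h6 : (g ^ 2) ^ ((Nat.card G + 1) / 2) = g := by
        rw [← pow_mul, show 2 * ((Nat.card G + 1) / 2) = Nat.card G + 1 by omega, pow_succ,
          pow_card_eq_one', one_mul]
      rw [← h6]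
      exact pow_mem h4 _
    · apply hSinv
      intro j i
      have hflip : ∀ i' : Fin 3, lam 1 (σ (i' + 1) (X j i')) = - lam 1 (X j i') ∧
          lam 1 (σ (i' + 2) (X j i')) = - lam 1 (X j i') := fun i' =>
        F.flip Q h2 htwo le_rfl (htop (X j i')) i' (hXf j i')
      fin_cases i
      · exact hmodS _ _ (hXf j 0) (hXS j 0)
      · refine hmodS _ (X j 1)⁻¹ ?_ (inv_mem (hXS j 1))
        rw [hinv]; exact (hflip 1).2
      · refine hmodS _ (X j 2)⁻¹ ?_ (inv_mem (hXS j 2))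
        rw [hinv]; exact (hflip 2).1
    · apply hSinv
      intro j i
      rw [← hXs]; exact hXS j _
  let B : AddSubgroup E := AddSubgroup.closure (Set.range (fun q : Fin 3 × Fin 3 => t q.1 q.2))
  have hB : ∀ x, lam 1 x ∈ B := by
    let S' : Subgroup G :=
      { carrier := {x | lam 1 x ∈ B}
        mul_mem' := by
          intro a b ha hb
          change lam 1 (a * b) ∈ B
          rw [hmul]; exact add_mem ha hb
        one_mem' := by
          change lam 1 1 ∈ B
          rw [F.one' le_rfl]; exact zero_mem _
        inv_mem' := by
          intro a ha
          change lam 1 a⁻¹ ∈ B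
          rw [hinv]; exact neg_mem ha }
    have hle : S ≤ S' := by
      refine sup_le ?_ ?_
      · rw [Subgroup.closure_le]
        rintro _ ⟨j, i, rfl⟩
        exact AddSubgroup.subset_closure ⟨(j, i), rfl⟩
      · intro x hx
        change lam 1 x ∈ B
        rw [(hD2 x).mp hx]; exact zero_mem _
    intro x
    rw [hST] at hle
    exact hle (Subgroup.mem_top x)
  by_cases hpe : p ∣ e
  · have hsys := F.sys hG hp h5 Q he h2 h3
    have := F.fin (Fin 3 × Fin 3) (fun q => t q.1 q.2) (bigK e) hB
      (fun l hl => abstract_main e E _ hsys t ht l hl) g (bigK e) (Nat.lt_pow_self hp.one_lt).le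
    obtain ⟨c, hc⟩ := pow_dvd_pow_of_dvd hpe (bigK e)
    rw [hc, pow_mul, this, one_pow]
  · have Q1 : Quad 1 σ η :=
      { sq := Q.sq, up := Q.up, dn := Q.dn, cyc := Q.cyc, cube := Q.cube, fix := Q.fix
        fixh := by
          intro x hx
          have h1 := Q.fixh x hx
          obtain ⟨k, hk⟩ := IsPGroup.iff_orderOf.mp hG x
          have h4 := hk ▸ orderOf_dvd_of_pow_eq_one h1
          have hk0 : k = 0 := by
            by_contra hk0
            exact hpe ((dvd_pow_self p hk0).trans h4)
          rw [hk0, pow_zero, orderOf_eq_one_iff] at hk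
          rw [hk, one_pow] }
    have hsys := F.sys hG hp h5 Q1 one_pos h2 h3
    have ht0 : ∀ j i, t j i = 0 := by
      intro j i
      have hz : ∀ i, t j (i + 1) = 0 := by
        intro i
        have a1 := hsys.nil 1 _ (ht j) i
        have a2 := hsys.nil' 1 _ (ht j) i
        rw [pow_one] at a1 a2
        obtain ⟨k, hk⟩ := htwo
        calc t j (i + 1) = ((k : E) * 2) * t j (i + 1) := by rw [hk, one_mul]
          _ = k * ((t j i + t j (i + 1) + t j (i + 2)) + (t j (i + 1) - t j i - t j (i + 2))) := by
            noncomm_ring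
          _ = 0 := by rw [a1, a2, add_zero, mul_zero]
      have := hz (i - 1)
      rwa [sub_add_cancel] at this
    have := F.fin (Fin 3 × Fin 3) (fun q => t q.1 q.2) 1 hB
      (fun l hl => by
        obtain ⟨q, rfl⟩ := List.length_eq_one_iff.mp hl
        rw [List.map_singleton, List.prod_singleton, ht0]) g 0 le_rfl
    rw [pow_zero, pow_one] at this
    rw [this, one_pow]

end FrobTwelve


namespace FrobTwelve

/-- restriction of an automorphism -/
def restr {G : Type} [Group G] (S : Subgroup G) (θ : MulAut G) (h : ∀ x ∈ S, θ x ∈ S)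
    (h' : ∀ x ∈ S, θ.symm x ∈ S) : MulAut S where
  toFun x := ⟨θ x.1, h _ x.2⟩
  invFun x := ⟨θ.symm x.1, h' _ x.2⟩
  left_inv x := by apply Subtype.ext; simp
  right_inv x := by apply Subtype.ext; simp
  map_mul' x y := by apply Subtype.ext; simp

theorem core' (p : ℕ) (hp : p.Prime) (h5 : 5 ≤ p) (G : Type) [Group G] [Finite G]
    (e : ℕ) (he : 0 < e) (σ : Fin 3 → MulAut G) (η : MulAut G)
    (Q : Quad e σ η) (h2 : ¬ 2 ∣ Nat.card G) (h3 : ¬ 3 ∣ Nat.card G) (P : Subgroup G)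
    (hP : IsPGroup p P) (hP0 : ∀ x ∈ P, σ 0 x ∈ P) (hPe : ∀ x ∈ P, η x ∈ P) (g : G) (hg : g ∈ P) :
    g ^ e ^ bigK e = 1 := by
  let S : Subgroup G := sInf {S | g ∈ S ∧ (∀ x ∈ S, σ 0 x ∈ S) ∧ ∀ x ∈ S, η x ∈ S}
  have hSP : S ≤ P := sInf_le ⟨hg, hP0, hPe⟩
  have hgS : g ∈ S := by
    rw [Subgroup.mem_sInf]; intro T hT; exact hT.1
  have hSe : ∀ x ∈ S, η x ∈ S := by
    intro x hx
    rw [Subgroup.mem_sInf] at hx ⊢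
    intro T hT; exact hT.2.2 x (hx T hT)
  have hS0 : ∀ x ∈ S, σ 0 x ∈ S := by
    intro x hx
    rw [Subgroup.mem_sInf] at hx ⊢
    intro T hT; exact hT.2.1 x (hx T hT)
  have hes : ∀ x, η.symm x = η (η x) := by
    intro x; rw [MulEquiv.symm_apply_eq, Q.cube]
  have hss : ∀ i x, (σ i).symm x = σ i x := by
    intro i x; rw [MulEquiv.symm_apply_eq, Q.sq]
  have hstep : ∀ i, (∀ x ∈ S, σ i x ∈ S) → ∀ x ∈ S, σ (i + 1) x ∈ S := by
    intro i h x hx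
    have := hSe _ (h _ (hSe _ (hSe _ hx)))
    rwa [Q.cyc, Q.cube] at this
  have hS1 : ∀ x ∈ S, σ 1 x ∈ S := hstep 0 hS0
  have hS2 : ∀ x ∈ S, σ 2 x ∈ S := hstep 1 hS1
  have hSi : ∀ i, ∀ x ∈ S, σ i x ∈ S := by
    intro i
    fin_cases i
    · exact hS0
    · exact hS1
    · exact hS2
  let σ' : Fin 3 → MulAut S := fun i => restr S (σ i) (hSi i) (fun x hx => by
    rw [hss]; exact hSi i x hx)
  let η' : MulAut S := restr S η hSe (fun x hx => by rw [hes]; exact hSe _ (hSe _ hx))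
  have hσ : ∀ i x, ((σ' i x : S) : G) = σ i x := fun i x => rfl
  have hη : ∀ x, ((η' x : S) : G) = η x := fun x => rfl
  have Q' : Quad e σ' η' := by
    constructor
    · intro i x; apply Subtype.ext; rw [hσ, hσ, Q.sq]
    · intro i x; apply Subtype.ext; rw [hσ, hσ, hσ, Q.up]
    · intro i x; apply Subtype.ext; rw [hσ, hσ, hσ, Q.dn]
    · intro i x; apply Subtype.ext; rw [hη, hσ, hσ, hη, Q.cyc]
    · intro x; apply Subtype.ext; rw [hη, hη, hη, Q.cube]
    · intro x hx hx'; apply Subtype.ext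
      refine Q.fix _ ?_ ?_
      · rw [← hσ, hx]
      · rw [← hσ, hx']
    · intro x hx; apply Subtype.ext
      rw [Subgroup.coe_pow]
      refine Q.fixh _ ?_
      rw [← hη, hx]
  have hcard := Subgroup.card_subgroup_dvd_card S
  have := core p hp h5 S (hP.to_le hSP) e he σ' η' Q' (fun h => h2 (h.trans hcard))
    (fun h => h3 (h.trans hcard)) ⟨g, hgS⟩ (by
      intro T hgT hT0 hTe
      have hle : S ≤ T.map S.subtype := by
        refine sInf_le ⟨⟨_, hgT, rfl⟩, ?_, ?_⟩
        · rintro _ ⟨x, hx, rfl⟩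
          exact ⟨σ' 0 x, hT0 x hx, rfl⟩
        · rintro _ ⟨x, hx, rfl⟩
          exact ⟨η' x, hTe x hx, rfl⟩
      rw [eq_top_iff]
      intro x _
      obtain ⟨y, hy, hyx⟩ := hle x.2
      rwa [← Subtype.ext (a1 := y) (a2 := x) hyx])
  exact congrArg Subtype.val this

open Pointwise in
theorem smul_smul_sylow {p : ℕ} {G : Type} [Group G] (θ : MulAut G) (g : G) (P : Sylow p G) :
    θ • (g • P) = (θ g) • (θ • P) := by
  apply Sylow.ext
  change θ • (MulAut.conj g • (P : Subgroup G)) = MulAut.conj (θ g) • (θ • (P : Subgroup G))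
  ext x
  simp [Subgroup.mem_pointwise_smul_iff_inv_smul_mem]

theorem inv_sylow (p : ℕ) (hp : p.Prime) (G : Type) [Group G] [Finite G]
    (e : ℕ) (σ : Fin 3 → MulAut G) (η : MulAut G)
    (Q : Quad e σ η) (h2 : ¬ 2 ∣ Nat.card G) :
    ∃ P : Sylow p G, (∀ x ∈ P, σ 0 x ∈ P) ∧ (∀ x ∈ P, η x ∈ P) := by
  have : Fact p.Prime := ⟨hp⟩
  have hsq : ∀ i, σ i * σ i = 1 := fun i => MulEquiv.ext (Q.sq i)
  have hup : ∀ i, σ i * σ (i + 1) = σ (i + 2) := fun i => MulEquiv.ext (Q.up i)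
  have hdn : ∀ i, σ (i + 1) * σ i = σ (i + 2) := fun i => MulEquiv.ext (Q.dn i)
  have hcy : ∀ i, η * σ i = σ (i + 1) * η := fun i => MulEquiv.ext (Q.cyc i)
  obtain ⟨P, hP0, hP1⟩ := fixpt2 (X := Sylow p G) (fun P => σ 0 • P) (fun P => σ 1 • P)
    (fun P => by rw [smul_smul, hsq, one_smul]) (fun P => by rw [smul_smul, hsq, one_smul])
    (fun P => by
      rw [smul_smul, smul_smul]
      congr 1
      exact (hup 0).trans (hdn 0).symm)
    (fun h => h2 ((h.trans (Sylow.card_dvd_index (default : Sylow p G))).trans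
      (Subgroup.index_dvd_card _)))
  have huniq : ∀ P' : Sylow p G, σ 0 • P' = P' → σ 1 • P' = P' → P' = P := by
    intro P' h0 h1
    obtain ⟨g, hg⟩ := MulAction.exists_smul_eq G P P'
    have hN : ∀ θ : MulAut G, θ • P = P → ∀ x ∈ Subgroup.normalizer (P : Set G),
        θ x ∈ Subgroup.normalizer (P : Set G) := by
      intro θ h x hx
      rw [← Sylow.smul_eq_iff_mem_normalizer] at hx ⊢
      have := smul_smul_sylow θ x P
      rw [hx, h] at this
      exact this.symm
    have hg' : ∀ θ : MulAut G, θ • P = P → θ • P' = P' →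
        g⁻¹ * θ g ∈ Subgroup.normalizer (P : Set G) := by
      intro θ h h'
      rw [← Sylow.smul_eq_iff_mem_normalizer, mul_smul, inv_smul_eq_iff]
      have := smul_smul_sylow θ g P
      rw [hg, h, h'] at this
      rw [hg, ← this]
    obtain ⟨n, hn, hn0, hn1⟩ := coset_fix2 (σ 0) (σ 1) (Q.sq 0) (Q.sq 1)
      (fun x => (Q.up 0 x).trans (Q.dn 0 x).symm) _ (hN _ hP0) (hN _ hP1) h2 g
      (hg' _ hP0 h0) (hg' _ hP1 h1)
    have h1 := Q.fix _ hn0 hn1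
    have h2 : g ∈ Subgroup.normalizer (P : Set G) := by
      rw [eq_inv_of_mul_eq_one_left h1]; exact inv_mem hn
    rw [← hg]
    exact Sylow.smul_eq_iff_mem_normalizer.mpr h2
  have hP2 : σ 2 • P = P := by
    rw [← show σ 0 * σ 1 = σ 2 from hup 0, mul_smul]
    change σ 1 • P = P at hP1
    rw [hP1]; exact hP0
  have hPe : η • P = P := by
    apply huniq
    · rw [smul_smul, ← show η * σ 2 = σ 0 * η from hcy 2, mul_smul, hP2]
    · rw [smul_smul, ← show η * σ 0 = σ 1 * η from hcy 0, mul_smul]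
      congr 1
  have hmem : ∀ θ : MulAut G, θ • P = P → ∀ x ∈ P, θ x ∈ P := by
    intro θ h x hx
    have h1 : θ x ∈ θ • P := by
      rw [← SetLike.mem_coe]
      exact Set.smul_mem_smul_set hx
    rwa [h] at h1
  exact ⟨P, hmem _ hP0, hmem _ hPe⟩

theorem all_pow (G : Type) [Group G] [Finite G]
    (e : ℕ) (he : 0 < e) (σ : Fin 3 → MulAut G) (η : MulAut G)
    (Q : Quad e σ η) (h2 : ¬ 2 ∣ Nat.card G) (h3 : ¬ 3 ∣ Nat.card G) (g : G) :
    g ^ e ^ bigK e = 1 := by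
  rw [← orderOf_dvd_iff_pow_eq_one, Nat.dvd_iff_prime_pow_dvd_dvd]
  intro p k hp hk
  rcases Nat.eq_zero_or_pos k with rfl | hkpos
  · simp
  have : Fact p.Prime := ⟨hp⟩
  have hpG : p ∣ Nat.card G :=
    ((dvd_pow_self p hkpos.ne').trans hk).trans (orderOf_dvd_natCard g)
  have h5 : 5 ≤ p := by
    have := hp.two_le
    have n2 : p ≠ 2 := by rintro rfl; exact h2 hpG
    have n3 : p ≠ 3 := by rintro rfl; exact h3 hpG
    have n4 : p ≠ 4 := by rintro rfl; revert hp; decide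
    omega
  obtain ⟨P, hP0, hPe⟩ := inv_sylow p hp G e σ η Q h2
  let x := g ^ (orderOf g / p ^ k)
  have hx : orderOf x = p ^ k := orderOf_pow_orderOf_div (orderOf_pos g).ne' hk
  have hz : IsPGroup p (Subgroup.zpowers x) := by
    apply IsPGroup.of_card (n := k)
    rw [Nat.card_zpowers, hx]
  obtain ⟨P', hP'⟩ := hz.exists_le_sylow
  obtain ⟨c, hc⟩ := MulAction.exists_smul_eq G P' P
  have hxP : c * x * c⁻¹ ∈ P := by
    have h1 : MulAut.conj c x ∈ c • P' := by
      rw [← SetLike.mem_coe]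
      exact Set.smul_mem_smul_set (a := MulAut.conj c) (hP' (Subgroup.mem_zpowers x))
    rwa [hc] at h1
  have := core' p hp h5 G e he σ η Q h2 h3 P P.isPGroup' hP0 hPe _ hxP
  rw [conj_pow, conj_eq_one_iff, ← orderOf_dvd_iff_pow_eq_one, hx] at this
  exact this

end FrobTwelve


theorem exponent_bounded_of_frobenius_order12_action :
    ∃ f : ℕ → ℕ,
      ∀ (W : Type) [Group W] [Finite W] (F H : Subgroup W),
        Nat.card W = 12 →
        F.Normal → Nat.card F = 4 → (∀ g ∈ F, g * g = 1) → Nat.card H = 3 →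
        F ⊓ H = ⊥ → F ⊔ H = ⊤ →
        (∀ h ∈ H, h ≠ 1 → ∀ g ∈ F, h * g = g * h → g = 1) →
      ∀ (G : Type) [Group G] [Finite G] (φ : W →* MulAut G),
        Nat.Coprime (Nat.card G) 12 →
        (∀ x : G, (∀ g ∈ F, φ g x = x) → x = 1) →
        ∀ (e : ℕ), 0 < e →
        (∀ x : G, (∀ h ∈ H, φ h x = x) → x ^ e = 1) →
        Monoid.exponent G ≤ f e := by
  refine ⟨fun e => e ^ FrobTwelve.bigK e, ?_⟩
  intro W _ _ F H _ hFn hF4 hFsq hH3 _ _ hfrob G _ _ φ hcop hfixF e he hfixH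
  have : Fact (Nat.Prime 3) := ⟨Nat.prime_three⟩
  have h2 : ¬ 2 ∣ Nat.card G := fun h => by
    have := Nat.Coprime.eq_one_of_dvd (hcop.symm.coprime_dvd_left (show 2 ∣ 12 by norm_num)) h
    omega
  have h3 : ¬ 3 ∣ Nat.card G := fun h => by
    have := Nat.Coprime.eq_one_of_dvd (hcop.symm.coprime_dvd_left (show 3 ∣ 12 by norm_num)) h
    omega
  have hFnt : Nontrivial F := Finite.one_lt_card_iff_nontrivial.mp (by omega)
  have hHnt : Nontrivial H := Finite.one_lt_card_iff_nontrivial.mp (by omega)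
  obtain ⟨⟨a, haF⟩, ha1⟩ := exists_ne (1 : F)
  obtain ⟨⟨h, hhH⟩, hh1⟩ := exists_ne (1 : H)
  replace ha1 : a ≠ 1 := fun hh => ha1 (Subtype.ext hh)
  have hh1' : h ≠ 1 := fun hh => hh1 (Subtype.ext hh)
  have hcube : h * h * h = 1 := by
    have := pow_card_eq_one' (x := (⟨h, hhH⟩ : H))
    rw [hH3] at this
    have := congrArg Subtype.val this
    change h ^ 3 = 1 at this
    rw [← this, pow_succ, pow_two]
  let A : Fin 3 → W := ![a, h * a * h⁻¹, h * (h * a * h⁻¹) * h⁻¹]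
  have hAs : ∀ i, A (i + 1) = h * A i * h⁻¹ := by
    intro i
    fin_cases i
    · rfl
    · rfl
    · change a = h * (h * (h * a * h⁻¹) * h⁻¹) * h⁻¹
      have e1 : h * (h * (h * a * h⁻¹) * h⁻¹) * h⁻¹ = (h * h * h) * a * (h * h * h)⁻¹ := by group
      rw [e1, hcube]; group
  have hAF : ∀ i, A i ∈ F := by
    have h0 : A 0 ∈ F := haF
    have h1 : A 1 ∈ F := hFn.conj_mem _ h0 h
    have h2 : A 2 ∈ F := hFn.conj_mem _ h1 h
    intro i; fin_cases i
    · exact h0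
    · exact h1
    · exact h2
  have hA1 : ∀ i, A i ≠ 1 := by
    have hs : ∀ i, A i ≠ 1 → A (i + 1) ≠ 1 := by
      intro i hi hc
      rw [hAs, conj_eq_one_iff] at hc
      exact hi hc
    have h0 : A 0 ≠ 1 := ha1
    have h1 : A 1 ≠ 1 := hs 0 h0
    have h2 : A 2 ≠ 1 := hs 1 h1
    intro i; fin_cases i
    · exact h0
    · exact h1
    · exact h2
  have hAne : ∀ i, A i ≠ A (i + 1) := by
    intro i hi
    rw [hAs, eq_mul_inv_iff_mul_eq] at hi
    exact hA1 i (hfrob h hhH hh1' _ (hAF i) hi.symm)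
  have hsq : ∀ x ∈ F, x⁻¹ = x := fun x hx => inv_eq_of_mul_eq_one_left (hFsq x hx)
  have hcomm : ∀ x ∈ F, ∀ y ∈ F, x * y = y * x := by
    intro x hx y hy
    have := hsq _ (mul_mem hx hy)
    rwa [mul_inv_rev, hsq x hx, hsq y hy, eq_comm] at this
  have n01 : A 0 ≠ A 1 := hAne 0
  have n12 : A 1 ≠ A 2 := hAne 1
  have n20 : A 2 ≠ A 0 := hAne 2
  have hFset : ({1, A 0, A 1, A 2} : Set W) = (F : Set W) := by
    apply Set.eq_of_subset_of_ncard_le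
    · rintro x (rfl | rfl | rfl | rfl)
      · exact one_mem _
      · exact hAF 0
      · exact hAF 1
      · exact hAF 2
    · have e1 : ({1, A 0, A 1, A 2} : Set W).ncard = 4 := by
        rw [Set.ncard_insert_of_notMem, Set.ncard_insert_of_notMem, Set.ncard_pair n12]
        · rintro (h | h)
          · exact n01 h
          · exact n20 h.symm
        · rintro (h | h | h)
          · exact hA1 0 h.symm
          · exact hA1 1 h.symm
          · exact hA1 2 h.symm
      rw [e1, ← hF4]
      exact le_rfl
    · exact Set.toFinite _
  have hFm : ∀ x ∈ F, x = 1 ∨ x = A 0 ∨ x = A 1 ∨ x = A 2 := by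
    intro x hx
    have : x ∈ ({1, A 0, A 1, A 2} : Set W) := by rw [hFset]; exact hx
    simpa using this
  have hprod0 : A 0 * A 1 = A 2 := by
    rcases hFm _ (mul_mem (hAF 0) (hAF 1)) with h | h | h | h
    · exact absurd ((eq_inv_of_mul_eq_one_left h).trans (hsq _ (hAF 1))) n01
    · exact absurd (mul_eq_left.mp h) (hA1 1)
    · exact absurd (mul_eq_right.mp h) (hA1 0)
    · exact h
  have hps : ∀ i, A i * A (i + 1) = A (i + 2) → A (i + 1) * A (i + 1 + 1) = A (i + 1 + 2) := by
    intro i hi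
    rw [add_right_comm i 1 2, hAs (i + 2), hAs (i + 1), ← hi, hAs i]
    group
  have hprod1 : A 1 * A 2 = A 0 := hps 0 hprod0
  have hprod2 : A 2 * A 0 = A 1 := hps 1 hprod1
  have hprod : ∀ i, A i * A (i + 1) = A (i + 2) := by
    intro i; fin_cases i
    · exact hprod0
    · exact hprod1
    · exact hprod2
  have hQ : FrobTwelve.Quad e (fun i => φ (A i)) (φ h) := by
    constructor
    · intro i x
      rw [← MulAut.mul_apply, ← map_mul, hFsq _ (hAF i), map_one, MulAut.one_apply]
    · intro i x
      rw [← MulAut.mul_apply, ← map_mul, hprod]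
    · intro i x
      rw [← MulAut.mul_apply, ← map_mul, hcomm _ (hAF _) _ (hAF _), hprod]
    · intro i x
      rw [← MulAut.mul_apply, ← MulAut.mul_apply, ← map_mul, ← map_mul, hAs, inv_mul_cancel_right]
    · intro x
      rw [← MulAut.mul_apply, ← MulAut.mul_apply, ← map_mul, ← map_mul, hcube, map_one,
        MulAut.one_apply]
    · intro x hx0 hx1
      have hx2 : φ (A 2) x = x := by
        rw [← hprod0, map_mul, MulAut.mul_apply, hx1, hx0]
      apply hfixF
      intro g hg
      rcases hFm g hg with rfl | rfl | rfl | rfl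
      · rw [map_one, MulAut.one_apply]
      · exact hx0
      · exact hx1
      · exact hx2
    · intro x hx
      apply hfixH
      intro y hy
      obtain ⟨n, hn⟩ := mem_powers_of_prime_card (p := 3) hH3 hh1 (g' := ⟨y, hy⟩)
      have hn' : h ^ n = y := congrArg Subtype.val hn
      rw [← hn']
      clear hn hn'
      induction n with
      | zero => rw [pow_zero, map_one, MulAut.one_apply]
      | succ n ih => rw [pow_succ, map_mul, MulAut.mul_apply, hx, ih]
  refine Nat.le_of_dvd (pow_pos he _) ?_
  exact Monoid.exponent_dvd_of_forall_pow_eq_one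
    (fun g => FrobTwelve.all_pow G e he _ _ hQ h2 h3 g)
end

section
/- There exists a function f : ℕ × ℕ → ℕ such that the following holds. Let A = V⟨α⟩ be the dihedral group of order 8 acting on the Lie algebra L as in the context with C_L(V) = 0. Assume that there exists x₁ ∈ L₁ such that L is generated as a Lie algebra by x₁ and x₁^α, and that for the generating set X = {x₁, x₁^α} there exist positive integers m and n such that: every element of C_L(α) that is homogeneous with respect to X is ad-nilpotent in L of index at most m, and every pair of elements of C_L(α) that are homogeneous with respect to X generates a Lie subalgebra that is nilpotent of class at most n. Then L is nilpotent of class at most f(m, n). -/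
/-- Commutators of weight `w` in the two generators `x₁, x₂` of a Lie algebra:
a commutator of weight `1` is one of the generators, and a commutator of weight
`w₁ + w₂` is a bracket of commutators of weights `w₁` and `w₂`. -/
inductive IsCommutatorOfWeight {L : Type} [LieRing L] (x₁ x₂ : L) : ℕ → L → Prop
  | base₁ : IsCommutatorOfWeight x₁ x₂ 1 x₁
  | base₂ : IsCommutatorOfWeight x₁ x₂ 1 x₂
  | bracket {w₁ w₂ : ℕ} {a b : L} : IsCommutatorOfWeight x₁ x₂ w₁ a →
      IsCommutatorOfWeight x₁ x₂ w₂ b → IsCommutatorOfWeight x₁ x₂ (w₁ + w₂) ⁅a, b⁆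

/-- An element of a Lie algebra is homogeneous (of some weight `w`) with respect to
the generating set `{x₁, x₂}` if it is a linear combination of commutators of
weight `w` in `x₁, x₂`. -/
def IsHomogeneousElement (R : Type) {L : Type} [CommRing R] [LieRing L]
    [LieAlgebra R L] (x₁ x₂ : L) (y : L) : Prop :=
  ∃ w : ℕ, y ∈ Submodule.span R {z : L | IsCommutatorOfWeight x₁ x₂ w z}


/-- The commutative algebra step. -/
theorem comm_step {S : Type*} [CommRing S] (h2 : IsUnit (2 : S)) (p q : S) (m : ℕ)
    (h1 : (p + q) ^ m = 0) (h3 : p * (p * q * (p - q) ^ 2) ^ m = 0) (i j : ℕ)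
    (hij : 2 * ((4 * m + 1) * m) + m ≤ i + j) : p ^ i * q ^ j = 0 := by
  have hd : (p + q) ∣ p * (p * q * (p - q) ^ 2) ^ m - p * (p * (-p) * (p - (-p)) ^ 2) ^ m := by
    rw [← mul_sub]
    apply Dvd.dvd.mul_left
    refine dvd_trans ?_ (sub_dvd_pow_sub_pow _ _ m)
    exact ⟨p * (p - q) ^ 2 - p ^ 2 * (q - 3 * p), by ring⟩
  rw [h3, zero_sub, dvd_neg] at hd
  have e : p * (p * (-p) * (p - (-p)) ^ 2) ^ m = (-(2 * 2)) ^ m * p ^ (4 * m + 1) := by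
    have e1 : p * (-p) * (p - (-p)) ^ 2 = (-(2 * 2)) * p ^ 4 := by ring
    rw [e1, mul_pow, ← pow_mul, pow_succ]
    ring
  rw [e] at hd
  have hu : IsUnit ((-(2 * 2) : S) ^ m) := ((h2.mul h2).neg).pow m
  have hd2 : (p + q) ∣ p ^ (4 * m + 1) := (hu.dvd_mul_left).1 hd
  have hp : p ^ ((4 * m + 1) * m) = 0 := by
    have := pow_dvd_pow_of_dvd hd2 m
    rw [h1, zero_dvd_iff, ← pow_mul] at this
    exact this
  have hq : q ^ ((4 * m + 1) * m + m) = 0 := by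
    have : q = (p + q) + (-p) := by ring
    rw [this]
    refine (Commute.all _ _).add_pow_eq_zero_of_add_le_succ_of_pow_eq_zero (m := m) (n := (4 * m + 1) * m) h1 ?_ (by omega)
    rw [neg_pow, hp, mul_zero]
  by_cases h : (4 * m + 1) * m ≤ i
  · rw [pow_eq_zero_of_le h hp, zero_mul]
  · rw [pow_eq_zero_of_le (m := (4 * m + 1) * m + m) (by omega) hq, mul_zero]

section
variable {R L : Type} [CommRing R] [LieRing L] [LieAlgebra R L]

structure Core (M : Submodule R L) (x₁ x₂ : L) : Prop where
  h3 : ⁅x₁, x₂⁆ ∈ M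
  hP : ∀ w ∈ M, ⁅x₁, ⁅x₁, w⁆⁆ ∈ M
  hQ : ∀ w ∈ M, ⁅x₂, ⁅x₂, w⁆⁆ ∈ M
  h12 : ∀ w ∈ M, ⁅x₁, ⁅x₂, w⁆⁆ = 0
  h21 : ∀ w ∈ M, ⁅x₂, ⁅x₁, w⁆⁆ = 0
  hM : ∀ z ∈ M, ∀ w ∈ M, ⁅z, w⁆ = 0
  h1 : ∀ z ∈ M, ∀ w ∈ M, ⁅x₁, ⁅z, ⁅x₁, w⁆⁆⁆ = 0
  h2 : ∀ z ∈ M, ∀ w ∈ M, ⁅x₂, ⁅z, ⁅x₂, w⁆⁆⁆ = 0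

variable {M : Submodule R L} {x₁ x₂ : L}

theorem Core.x3X1 (H : Core M x₁ x₂) {w : L} (hw : w ∈ M) :
    ⁅⁅x₁, x₂⁆, ⁅x₁, w⁆⁆ = - ⁅x₂, ⁅x₁, ⁅x₁, w⁆⁆⁆ := by
  rw [lie_lie, H.h21 w hw]; simp

theorem Core.x3X2 (H : Core M x₁ x₂) {w : L} (hw : w ∈ M) :
    ⁅⁅x₁, x₂⁆, ⁅x₂, w⁆⁆ = ⁅x₁, ⁅x₂, ⁅x₂, w⁆⁆⁆ := by
  rw [lie_lie, H.h12 w hw]; simp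

/-- the two squares commute -/
theorem Core.comm (H : Core M x₁ x₂) {w : L} (hw : w ∈ M) :
    ⁅x₁, ⁅x₁, ⁅x₂, ⁅x₂, w⁆⁆⁆⁆ = ⁅x₂, ⁅x₂, ⁅x₁, ⁅x₁, w⁆⁆⁆⁆ := by
  have key : ⁅⁅x₂, ⁅x₁, ⁅x₁, x₂⁆⁆⁆, w⁆ = 0 := by rw [H.h21 _ H.h3, zero_lie]
  have e : ⁅⁅x₂, ⁅x₁, ⁅x₁, x₂⁆⁆⁆, w⁆ =
      ⁅x₂, ⁅x₁, ⁅⁅x₁, x₂⁆, w⁆⁆⁆ - ⁅x₂, ⁅⁅x₁, x₂⁆, ⁅x₁, w⁆⁆⁆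
        - (⁅x₁, ⁅⁅x₁, x₂⁆, ⁅x₂, w⁆⁆⁆ - ⁅⁅x₁, x₂⁆, ⁅x₁, ⁅x₂, w⁆⁆⁆) := by
    rw [lie_lie x₂ ⁅x₁, ⁅x₁, x₂⁆⁆ w, lie_lie x₁ ⁅x₁, x₂⁆ w, lie_lie x₁ ⁅x₁, x₂⁆ ⁅x₂, w⁆, lie_sub]
  rw [e, H.hM _ H.h3 _ hw, H.x3X1 hw, H.x3X2 hw, H.h12 w hw] at key
  simp only [lie_zero, lie_neg, zero_sub, sub_zero, neg_neg] at key
  exact (sub_eq_zero.1 key).symm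

theorem dbl_lie (a z t : L) : ⁅⁅a, ⁅a, z⁆⁆, t⁆
    = ⁅a, ⁅a, ⁅z, t⁆⁆⁆ - ⁅a, ⁅z, ⁅a, t⁆⁆⁆ - ⁅a, ⁅z, ⁅a, t⁆⁆⁆ + ⁅z, ⁅a, ⁅a, t⁆⁆⁆ := by
  rw [lie_lie a ⁅a, z⁆ t, lie_lie a z t, lie_lie a z ⁅a, t⁆, lie_sub]
  abel

theorem Core.PX1 (H : Core M x₁ x₂) {z w : L} (hz : z ∈ M) (hw : w ∈ M) :
    ⁅⁅x₁, ⁅x₁, z⁆⁆, ⁅x₁, w⁆⁆ = ⁅z, ⁅x₁, ⁅x₁, ⁅x₁, w⁆⁆⁆⁆ := by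
  rw [dbl_lie, H.h1 z hz w hw, H.hM z hz _ (H.hP w hw)]; simp

theorem Core.QX2 (H : Core M x₁ x₂) {z w : L} (hz : z ∈ M) (hw : w ∈ M) :
    ⁅⁅x₂, ⁅x₂, z⁆⁆, ⁅x₂, w⁆⁆ = ⁅z, ⁅x₂, ⁅x₂, ⁅x₂, w⁆⁆⁆⁆ := by
  rw [dbl_lie, H.h2 z hz w hw, H.hM z hz _ (H.hQ w hw)]; simp

theorem Core.QX1 (H : Core M x₁ x₂) {z w : L} (hw : w ∈ M) :
    ⁅⁅x₂, ⁅x₂, z⁆⁆, ⁅x₁, w⁆⁆ = ⁅x₂, ⁅x₂, ⁅z, ⁅x₁, w⁆⁆⁆⁆ := by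
  rw [lie_lie, lie_lie x₂ z, lie_lie x₂ z, H.h21 w hw]; simp

theorem Core.PX2 (H : Core M x₁ x₂) {z w : L} (hw : w ∈ M) :
    ⁅⁅x₁, ⁅x₁, z⁆⁆, ⁅x₂, w⁆⁆ = ⁅x₁, ⁅x₁, ⁅z, ⁅x₂, w⁆⁆⁆⁆ := by
  rw [lie_lie, lie_lie x₁ z, lie_lie x₁ z, H.h12 w hw]; simp

/-- ad x₁ squared on M -/
def Core.P (H : Core M x₁ x₂) : Module.End R M :=
  ((LieAlgebra.ad R L x₁) ∘ₗ (LieAlgebra.ad R L x₁)).restrict (fun w hw => H.hP w hw)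

def Core.Q (H : Core M x₁ x₂) : Module.End R M :=
  ((LieAlgebra.ad R L x₂) ∘ₗ (LieAlgebra.ad R L x₂)).restrict (fun w hw => H.hQ w hw)

theorem Core.P_apply (H : Core M x₁ x₂) (w : M) : (H.P w : L) = ⁅x₁, ⁅x₁, (w : L)⁆⁆ := rfl
theorem Core.Q_apply (H : Core M x₁ x₂) (w : M) : (H.Q w : L) = ⁅x₂, ⁅x₂, (w : L)⁆⁆ := rfl

theorem Core.commute (H : Core M x₁ x₂) : H.P * H.Q = H.Q * H.P := by
  ext w
  exact H.comm w.2

/-- the special element -/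
theorem Core.yX1 (H : Core M x₁ x₂) (w : M) :
    ⁅⁅x₁, ⁅x₁, ⁅x₁, x₂⁆⁆⁆ - ⁅x₂, ⁅x₂, ⁅x₁, x₂⁆⁆⁆, ⁅x₁, (w : L)⁆⁆
      = - ⁅x₂, ((H.P * (H.P - H.Q)) w : L)⁆ := by
  have hc := H.comm w.2
  rw [sub_lie, H.PX1 H.h3 w.2, H.QX1 w.2, H.x3X1 w.2, H.x3X1 (H.hP _ w.2)]
  simp only [Module.End.mul_apply, LinearMap.sub_apply, H.P_apply, H.Q_apply,
    AddSubgroupClass.coe_sub, lie_sub, lie_neg, hc]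
  abel

theorem Core.yX2 (H : Core M x₁ x₂) (w : M) :
    ⁅⁅x₁, ⁅x₁, ⁅x₁, x₂⁆⁆⁆ - ⁅x₂, ⁅x₂, ⁅x₁, x₂⁆⁆⁆, ⁅x₂, (w : L)⁆⁆
      = ⁅x₁, ((H.Q * (H.P - H.Q)) w : L)⁆ := by
  have hc := H.comm w.2
  rw [sub_lie, H.PX2 w.2, H.QX2 H.h3 w.2, H.x3X2 w.2, H.x3X2 (H.hQ _ w.2)]
  simp only [Module.End.mul_apply, LinearMap.sub_apply, H.P_apply, H.Q_apply,
    AddSubgroupClass.coe_sub, lie_sub, hc]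

theorem iter_two (y : L) (k : ℕ) (z : L) :
    (fun u => ⁅u, y⁆)^[2 * k] z = (fun u => ⁅y, ⁅y, u⁆⁆)^[k] z := by
  rw [Function.iterate_mul]
  congr 2
  funext u
  show ⁅⁅u, y⁆, y⁆ = _
  rw [← lie_skew, ← lie_skew u y, lie_neg, neg_neg]

theorem iter_zero (y : L) (m : ℕ) (h : ∀ z : L, (fun u => ⁅u, y⁆)^[m] z = 0) (z : L) :
    (fun u => ⁅y, ⁅y, u⁆⁆)^[m] z = 0 := by
  rw [← iter_two, two_mul, Function.iterate_add_apply, h]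

theorem Core.sum_pow (H : Core M x₁ x₂) (m : ℕ)
    (h : ∀ z : L, (fun u => ⁅u, x₁ + x₂⁆)^[m] z = 0) : (H.P + H.Q) ^ m = 0 := by
  have key : ∀ (k : ℕ) (w : M), (fun u => ⁅x₁ + x₂, ⁅x₁ + x₂, u⁆⁆)^[k] (w : L)
      = (((H.P + H.Q) ^ k) w : M) := by
    intro k
    induction k with
    | zero => intro w; simp
    | succ k ih =>
      intro w
      rw [Function.iterate_succ_apply, pow_succ, Module.End.mul_apply, ← ih]
      congr 1
      simp [H.P_apply, H.Q_apply, H.h12 _ w.2, H.h21 _ w.2]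
  ext w
  rw [← key, iter_zero _ _ h]; rfl

theorem Core.prod_pow (H : Core M x₁ x₂) (m : ℕ)
    (h : ∀ z : L, (fun u => ⁅u, ⁅x₁, ⁅x₁, ⁅x₁, x₂⁆⁆⁆ - ⁅x₂, ⁅x₂, ⁅x₁, x₂⁆⁆⁆⁆)^[m] z = 0) :
    H.P * (-(H.Q * (H.P - H.Q) * (H.P * (H.P - H.Q)))) ^ m = 0 := by
  set y := ⁅x₁, ⁅x₁, ⁅x₁, x₂⁆⁆⁆ - ⁅x₂, ⁅x₂, ⁅x₁, x₂⁆⁆⁆ with hy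
  have key : ∀ (k : ℕ) (w : M), (fun u => ⁅y, ⁅y, u⁆⁆)^[k] ⁅x₁, (w : L)⁆
      = ⁅x₁, (((-(H.Q * (H.P - H.Q) * (H.P * (H.P - H.Q)))) ^ k) w : L)⁆ := by
    intro k
    induction k with
    | zero => intro w; simp
    | succ k ih =>
      intro w
      rw [Function.iterate_succ_apply, pow_succ, Module.End.mul_apply, ← ih]
      congr 1
      rw [hy, H.yX1, lie_neg, H.yX2, LinearMap.neg_apply, Module.End.mul_apply (_ * _)]
      simp only [NegMemClass.coe_neg, lie_neg]
  ext w
  rw [Module.End.mul_apply, H.P_apply, ← key, iter_zero _ _ h, lie_zero]; rfl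

theorem Core.vanish (H : Core M x₁ x₂) (h2 : IsUnit (2 : R)) (m : ℕ)
    (hs : ∀ z : L, (fun u => ⁅u, x₁ + x₂⁆)^[m] z = 0)
    (hy : ∀ z : L, (fun u => ⁅u, ⁅x₁, ⁅x₁, ⁅x₁, x₂⁆⁆⁆ - ⁅x₂, ⁅x₂, ⁅x₁, x₂⁆⁆⁆⁆)^[m] z = 0)
    (i j : ℕ) (hij : 2 * ((4 * m + 1) * m) + m ≤ i + j) : H.P ^ i * H.Q ^ j = 0 := by
  have hcm : ∀ a ∈ ({H.P, H.Q} : Set (Module.End R M)), ∀ b ∈ ({H.P, H.Q} : Set (Module.End R M)),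
      a * b = b * a := by
    rintro a (rfl | rfl) b (rfl | rfl)
    · rfl
    · exact H.commute
    · exact H.commute.symm
    · rfl
  let S := Algebra.adjoin R ({H.P, H.Q} : Set (Module.End R M))
  have hS : IsMulCommutative S := Algebra.isMulCommutative_adjoin R hcm
  let _ : CommRing S := { S.toRing with mul_comm := fun a b => hS.is_comm.comm a b }
  let p : S := ⟨H.P, Algebra.subset_adjoin (by simp)⟩
  let q : S := ⟨H.Q, Algebra.subset_adjoin (by simp)⟩
  have h1 : (p + q) ^ m = 0 := Subtype.ext (H.sum_pow m hs)
  have h3 : p * (-(q * (p - q) * (p * (p - q)))) ^ m = 0 := Subtype.ext (H.prod_pow m hy)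
  have h3' : p * (p * q * (p - q) ^ 2) ^ m = 0 := by
    have e : p * q * (p - q) ^ 2 = (-1) * (-(q * (p - q) * (p * (p - q)))) := by ring
    rw [e, mul_pow, mul_left_comm, h3, mul_zero]
  have hu : IsUnit (2 : S) := by
    have := h2.map (algebraMap R S)
    rwa [map_ofNat] at this
  have := comm_step hu p q m h1 h3' i j hij
  exact congrArg Subtype.val this

/-- The filtration. -/
def Core.I (H : Core M x₁ x₂) (k : ℕ) : Submodule R L :=
  Submodule.span R {z : L | (k = 0 ∧ (z = x₁ ∨ z = x₂)) ∨
    ∃ i j : ℕ, (k + 1 ≤ 2 * (i + j) + 2 ∧ z = ((H.P ^ i * H.Q ^ j) ⟨_, H.h3⟩ : M)) ∨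
      (k + 1 ≤ 2 * (i + j) + 3 ∧ (z = ⁅x₁, (((H.P ^ i * H.Q ^ j) ⟨_, H.h3⟩ : M) : L)⁆ ∨
        z = ⁅x₂, (((H.P ^ i * H.Q ^ j) ⟨_, H.h3⟩ : M) : L)⁆))}

theorem Core.I_anti (H : Core M x₁ x₂) (k : ℕ) : H.I (k + 1) ≤ H.I k := by
  apply Submodule.span_mono
  rintro z (⟨h, -⟩ | ⟨i, j, ⟨h, h'⟩ | ⟨h, h'⟩⟩)
  · omega
  · exact Or.inr ⟨i, j, Or.inl ⟨by omega, h'⟩⟩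
  · exact Or.inr ⟨i, j, Or.inr ⟨by omega, h'⟩⟩

theorem Core.x3_mem (H : Core M x₁ x₂) : ⁅x₁, x₂⁆ ∈ H.I 1 :=
  Submodule.subset_span (Or.inr ⟨0, 0, Or.inl ⟨by omega, by simp⟩⟩)

theorem Core.I_x1 (H : Core M x₁ x₂) (k : ℕ) (z : L) (hz : z ∈ H.I k) :
    ⁅x₁, z⁆ ∈ H.I (k + 1) := by
  have : H.I k ≤ (H.I (k + 1)).comap (LieAlgebra.ad R L x₁ : L →ₗ[R] L) := by
    refine Submodule.span_le.2 ?_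
    rintro z (⟨rfl, h | h⟩ | ⟨i, j, ⟨h, rfl⟩ | ⟨h, rfl | rfl⟩⟩)
    · rw [h]; simp
    · rw [h]; simpa using H.x3_mem
    · exact Submodule.subset_span (Or.inr ⟨i, j, Or.inr ⟨by omega, Or.inl rfl⟩⟩)
    · refine Submodule.subset_span (Or.inr ⟨i + 1, j, Or.inl ⟨by omega, ?_⟩⟩)
      rw [pow_succ', mul_assoc, Module.End.mul_apply H.P]
      rfl
    · show ⁅x₁, ⁅x₂, (_ : L)⁆⁆ ∈ H.I (k + 1)
      rw [H.h12 _ (Subtype.prop _)]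
      exact zero_mem _
  exact this hz

theorem Core.I_x2 (H : Core M x₁ x₂) (k : ℕ) (z : L) (hz : z ∈ H.I k) :
    ⁅x₂, z⁆ ∈ H.I (k + 1) := by
  have : H.I k ≤ (H.I (k + 1)).comap (LieAlgebra.ad R L x₂ : L →ₗ[R] L) := by
    refine Submodule.span_le.2 ?_
    rintro z (⟨rfl, h | h⟩ | ⟨i, j, ⟨h, rfl⟩ | ⟨h, rfl | rfl⟩⟩)
    · rw [h]
      show ⁅x₂, x₁⁆ ∈ H.I (0 + 1)
      rw [← lie_skew]
      exact neg_mem H.x3_mem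
    · rw [h]; simp
    · exact Submodule.subset_span (Or.inr ⟨i, j, Or.inr ⟨by omega, Or.inr rfl⟩⟩)
    · show ⁅x₂, ⁅x₁, (_ : L)⁆⁆ ∈ H.I (k + 1)
      rw [H.h21 _ (Subtype.prop _)]
      exact zero_mem _
    · refine Submodule.subset_span (Or.inr ⟨i, j + 1, Or.inl ⟨by omega, ?_⟩⟩)
      have hc : Commute (H.P ^ i) H.Q := Commute.pow_left H.commute i
      rw [pow_succ', ← mul_assoc, hc.eq, mul_assoc, Module.End.mul_apply H.Q]
      rfl
  exact this hz

theorem Core.I_lie (H : Core M x₁ x₂) (hg : LieSubalgebra.lieSpan R L {x₁, x₂} = ⊤) (y : L) :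
    ∀ (k : ℕ) (z : L), z ∈ H.I k → ⁅y, z⁆ ∈ H.I (k + 1) := by
  have hy : y ∈ LieSubalgebra.lieSpan R L {x₁, x₂} := by rw [hg]; trivial
  induction hy using LieSubalgebra.lieSpan_induction with
  | mem x hx =>
    rcases hx with rfl | rfl
    · exact H.I_x1
    · exact H.I_x2
  | zero => intro k z _; simp
  | add x y _ _ hx hy => intro k z hz; rw [add_lie]; exact add_mem (hx k z hz) (hy k z hz)
  | smul a x _ hx => intro k z hz; rw [smul_lie]; exact Submodule.smul_mem _ _ (hx k z hz)
  | lie x y _ _ hx hy =>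
    intro k z hz
    rw [lie_lie]
    exact H.I_anti _ (sub_mem (hx _ _ (hy _ _ hz)) (hy _ _ (hx _ _ hz)))

theorem Core.I_top (H : Core M x₁ x₂) (hg : LieSubalgebra.lieSpan R L {x₁, x₂} = ⊤) (y : L) :
    y ∈ H.I 0 := by
  have hy : y ∈ LieSubalgebra.lieSpan R L {x₁, x₂} := by rw [hg]; trivial
  induction hy using LieSubalgebra.lieSpan_induction with
  | mem x hx => exact Submodule.subset_span (Or.inl ⟨rfl, hx⟩)
  | zero => exact zero_mem _
  | add x y _ _ hx hy => exact add_mem hx hy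
  | smul a x _ hx => exact Submodule.smul_mem _ _ hx
  | lie x y _ _ hx hy => exact H.I_anti _ (H.I_lie hg x _ _ hy)

theorem Core.lcs_le (H : Core M x₁ x₂) (hg : LieSubalgebra.lieSpan R L {x₁, x₂} = ⊤) (k : ℕ) :
    (LieModule.lowerCentralSeries R L L k).toSubmodule ≤ H.I k := by
  induction k with
  | zero => intro y _; exact H.I_top hg y
  | succ k ih =>
    rw [LieModule.lowerCentralSeries_succ, LieSubmodule.lieIdeal_oper_eq_linear_span']
    refine Submodule.span_le.2 ?_
    rintro _ ⟨x, -, z, hz, rfl⟩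
    exact H.I_lie hg x k z (ih hz)

theorem Core.nilp (H : Core M x₁ x₂) (hg : LieSubalgebra.lieSpan R L {x₁, x₂} = ⊤)
    (h2 : IsUnit (2 : R)) (m : ℕ)
    (hs : ∀ z : L, (fun u => ⁅u, x₁ + x₂⁆)^[m] z = 0)
    (hy : ∀ z : L, (fun u => ⁅u, ⁅x₁, ⁅x₁, ⁅x₁, x₂⁆⁆⁆ - ⁅x₂, ⁅x₂, ⁅x₁, x₂⁆⁆⁆⁆)^[m] z = 0) :
    LieModule.lowerCentralSeries R L L (2 * (2 * ((4 * m + 1) * m) + m) + 1) = ⊥ := by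
  have hv := H.vanish h2 m hs hy
  generalize 2 * ((4 * m + 1) * m) + m = K at hv
  rw [← LieSubmodule.toSubmodule_eq_bot, eq_bot_iff]
  refine (H.lcs_le hg _).trans (Submodule.span_le.2 ?_)
  rintro z (⟨h, -⟩ | ⟨i, j, ⟨h, rfl⟩ | ⟨h, rfl | rfl⟩⟩)
  · omega
  all_goals rw [hv i j (by omega)]; simp
end

/-- **Proposition 2.3.** There is a function `f : ℕ × ℕ → ℕ` such that the
following holds.  Let the dihedral group `A = V⟨α⟩` of order `8` (with
`V = {1,v₁,v₂,v₃}` a Klein four-group, `α` an involution, `v₁^α = v₂`) act by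
automorphisms on a Lie algebra `L` over a commutative ring in which `2` is
invertible, with `C_L(V) = 0`.  Suppose `L = ⟨x₁, x₁^α⟩` for some `x₁ ∈ L₁`,
every homogeneous element of `L_α` (w.r.t. this generating set) is ad-nilpotent
of index at most `m`, and every pair of homogeneous elements of `L_α` generates
a subalgebra nilpotent of class at most `n`.  Then `L` is nilpotent of class at
most `f (m, n)`. -/
theorem lie_nilpotent_of_D8_action :
    ∃ f : ℕ × ℕ → ℕ,
      ∀ (R : Type) [CommRing R] (L : Type) [LieRing L] [LieAlgebra R L],
        IsUnit (2 : R) →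
      ∀ (v₁ v₂ α : L ≃ₗ⁅R⁆ L),
        (∀ x, v₁ (v₁ x) = x) → (∀ x, v₂ (v₂ x) = x) →
        (∀ x, v₁ (v₂ x) = v₂ (v₁ x)) →
        (∀ x, α (α x) = x) →
        (∀ x, α (v₁ (α x)) = v₂ x) →
        (∀ x : L, v₁ x = x → v₂ x = x → x = 0) →
      ∀ (x₁ : L), v₁ x₁ = x₁ →
        LieSubalgebra.lieSpan R L {x₁, α x₁} = ⊤ →
      ∀ (m n : ℕ), 0 < m → 0 < n →
        (∀ y : L, α y = y → IsHomogeneousElement R x₁ (α x₁) y →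
          ∀ z : L, (fun u => ⁅u, y⁆)^[m] z = 0) →
        (∀ y z : L, α y = y → α z = z →
          IsHomogeneousElement R x₁ (α x₁) y → IsHomogeneousElement R x₁ (α x₁) z →
          LieModule.lowerCentralSeries R (LieSubalgebra.lieSpan R L {y, z})
            (LieSubalgebra.lieSpan R L {y, z}) n = ⊥) →
        LieModule.lowerCentralSeries R L L (f (m, n)) = ⊥ := by
  refine ⟨fun p => 2 * (2 * ((4 * p.1 + 1) * p.1) + p.1) + 1, ?_⟩
  intro R _ L _ _ h2 v₁ v₂ α hv1 hv2 hv12 hα hαv hC x₁ hx₁ hg m n _ _ hm _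
  have a2 : v₂ (α x₁) = α x₁ := by rw [← hαv, hα, hx₁]
  have b1 : v₂ x₁ = -x₁ := by
    refine eq_neg_of_add_eq_zero_left (hC _ ?_ ?_)
    · rw [map_add, hv12, hx₁]
    · rw [map_add, hv2, add_comm]
  have b2 : v₁ (α x₁) = -α x₁ := by
    refine eq_neg_of_add_eq_zero_left (hC _ ?_ ?_)
    · rw [map_add, hv1, add_comm]
    · rw [map_add, ← hv12, a2]
  let M : Submodule R L :=
    { carrier := {w | v₁ w = -w ∧ v₂ w = -w}
      add_mem' := by
        rintro a b ⟨ha, ha'⟩ ⟨hb, hb'⟩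
        constructor
        · rw [map_add, ha, hb, neg_add]
        · rw [map_add, ha', hb', neg_add]
      zero_mem' := by simp
      smul_mem' := by
        rintro c a ⟨ha, ha'⟩
        constructor
        · rw [map_smul, ha, smul_neg]
        · rw [map_smul, ha', smul_neg] }
  have H : Core M x₁ (α x₁) := by
    constructor
    · constructor <;> simp [LieEquiv.map_lie, hx₁, a2, b1, b2]
    · rintro w ⟨h, h'⟩
      constructor <;> simp [LieEquiv.map_lie, hx₁, b1, h, h']
    · rintro w ⟨h, h'⟩
      constructor <;> simp [LieEquiv.map_lie, a2, b2, h, h']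
    · rintro w ⟨h, h'⟩
      apply hC <;> simp only [LieEquiv.map_lie, hx₁, a2, b1, b2, h, h', lie_neg, neg_lie, neg_neg]
    · rintro w ⟨h, h'⟩
      apply hC <;> simp only [LieEquiv.map_lie, hx₁, a2, b1, b2, h, h', lie_neg, neg_lie, neg_neg]
    · rintro z ⟨g, g'⟩ w ⟨h, h'⟩
      apply hC <;> simp only [LieEquiv.map_lie, g, g', h, h', lie_neg, neg_lie, neg_neg]
    · rintro z ⟨g, g'⟩ w ⟨h, h'⟩
      apply hC <;> simp only [LieEquiv.map_lie, g, g', hx₁, b1, h, h', lie_neg, neg_lie, neg_neg]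
    · rintro z ⟨g, g'⟩ w ⟨h, h'⟩
      apply hC <;> simp only [LieEquiv.map_lie, g, g', a2, b2, h, h', lie_neg, neg_lie, neg_neg]
  have c3 : IsCommutatorOfWeight x₁ (α x₁) (1 + 1) ⁅x₁, α x₁⁆ := .bracket .base₁ .base₂
  refine H.nilp hg h2 m (hm _ ?_ ⟨1, ?_⟩) (hm _ ?_ ⟨1 + (1 + (1 + 1)), ?_⟩)
  · rw [map_add, hα, add_comm]
  · exact add_mem (Submodule.subset_span .base₁) (Submodule.subset_span .base₂)
  · rw [map_sub]
    simp only [LieEquiv.map_lie, hα]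
    rw [← lie_skew x₁ (α x₁)]
    simp only [lie_neg]
    abel
  · exact sub_mem (Submodule.subset_span (.bracket .base₁ (.bracket .base₁ c3)))
      (Submodule.subset_span (.bracket .base₂ (.bracket .base₂ c3)))
end
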